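/- arXiv:2507.12086 — 4 statements merged into one kernel-verified Lean document; each statement's English description precedes it below -/
import Mathlib

section
/- Let G be a CND graph (a finite connected simple graph with no hamiltonian path in which every vertex has detour order equal to τ(G)). Then τ(G) ≥ 9 (and consequently G has order at least 10). -/
open SimpleGraph

/-- The detour order of a vertex `v`: the maximum number of vertices of a path
in `G` having `v` as an endvertex. -/
noncomputable def vertexDetourOrder {V : Type*} (G : SimpleGraph V) (v : V) : ℕ :=
  sSup {n | ∃ (w : V) (p : G.Walk v w), p.IsPath ∧ n = p.length + 1}

/-- The detour order of `G`: the maximum number of vertices of a path in `G`. -/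
noncomputable def detourOrder {V : Type*} (G : SimpleGraph V) : ℕ :=
  sSup {n | ∃ (u w : V) (p : G.Walk u w), p.IsPath ∧ n = p.length + 1}

/-- A graph is traceable if it has a hamiltonian path, i.e. a path through all vertices. -/
def Traceable {V : Type*} (G : SimpleGraph V) : Prop :=
  ∃ (u w : V) (p : G.Walk u w), p.IsPath ∧ ∀ x, x ∈ p.support

structure Ctx {V : Type*} (G : SimpleGraph V) (t : ℕ) : Prop where
  le : ∀ l : List V, l.IsChain G.Adj → l.Nodup → l.length ≤ t
  st : ∀ v : V, ∃ l : List V, (v :: l).IsChain G.Adj ∧ (v :: l).Nodup ∧ l.length + 1 = t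
  nt : ∀ l : List V, l.IsChain G.Adj → l.Nodup → ∃ x, x ∉ l
  conn : G.Connected

theorem ctx_of {V : Type*} [Fintype V] (G : SimpleGraph V)
    (hconn : G.Connected) (hnt : ¬ Traceable G)
    (hdet : ∀ v : V, vertexDetourOrder G v = detourOrder G) : Ctx G (detourOrder G) := by
  have hb : ∀ (u w : V) (p : G.Walk u w), p.IsPath → p.length + 1 ≤ Fintype.card V := by
    intro u w p hp
    have := hp.length_lt
    omega
  have hle : ∀ l : List V, l.IsChain G.Adj → l.Nodup → l.length ≤ detourOrder G := by
    intro l hl hn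
    by_cases hne : l = []
    · simp [hne]
    have : (SimpleGraph.Walk.ofSupport l hne hl).length + 1 ≤ detourOrder G := by
      apply le_csSup
      · refine ⟨Fintype.card V, ?_⟩
        rintro n ⟨u, w, p, hp, rfl⟩
        exact hb u w p hp
      · refine ⟨_, _, SimpleGraph.Walk.ofSupport l hne hl, ?_, rfl⟩
        rw [SimpleGraph.Walk.isPath_def, SimpleGraph.Walk.support_ofSupport]
        exact hn
    rw [SimpleGraph.Walk.length_ofSupport] at this
    omega
  refine ⟨hle, ?_, ?_, hconn⟩
  · intro v
    have h1 : vertexDetourOrder G v ∈ {n | ∃ (w : V) (p : G.Walk v w), p.IsPath ∧ n = p.length + 1} := by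
      apply Nat.sSup_mem
      · exact ⟨1, v, SimpleGraph.Walk.nil, by simp, by simp⟩
      · refine ⟨Fintype.card V, ?_⟩
        rintro n ⟨w, p, hp, rfl⟩
        exact hb v w p hp
    obtain ⟨w, p, hp, h⟩ := h1
    rw [hdet] at h
    refine ⟨p.support.tail, ?_, ?_, ?_⟩
    · rw [SimpleGraph.Walk.cons_tail_support]; exact p.isChain_adj_support
    · rw [SimpleGraph.Walk.cons_tail_support]; exact hp.support_nodup
    · simp [h]
  · intro l hl hn
    by_contra hcon
    push Not at hcon
    have hne : l ≠ [] := by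
      rintro rfl
      obtain ⟨v⟩ := hconn.nonempty
      simpa using hcon v
    apply hnt
    refine ⟨_, _, SimpleGraph.Walk.ofSupport l hne hl, ?_, ?_⟩
    · rw [SimpleGraph.Walk.isPath_def, SimpleGraph.Walk.support_ofSupport]
      exact hn
    · rw [SimpleGraph.Walk.support_ofSupport]
      exact hcon

/-- A set that is nonempty and not everything has a boundary edge. -/
theorem exists_boundary {V : Type*} {G : SimpleGraph V} (hc : G.Connected) (B : Set V) (b v : V)
    (hb : b ∈ B) (hv : v ∉ B) : ∃ x ∈ B, ∃ y, y ∉ B ∧ G.Adj x y := by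
  obtain ⟨p⟩ := hc.preconnected b v
  obtain ⟨d, hd, h1, h2⟩ := p.exists_boundary_dart B hb hv
  exact ⟨d.fst, h1, d.snd, h2, d.adj⟩

theorem chain_closed {V : Type*} {G : SimpleGraph V} (B : Set V) (u : V)
    (hB : ∀ b ∈ B, ∀ w, G.Adj b w → w = u ∨ w ∈ B) :
    ∀ (l : List V) (a : V), a ∈ B → (a :: l).IsChain G.Adj → u ∉ l → ∀ x ∈ l, x ∈ B := by
  intro l
  induction l with
  | nil => simp
  | cons b l ih =>
    intro a ha hch hu x hx
    rw [List.isChain_cons_cons] at hch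
    have hb : b ∈ B := by
      rcases hB a ha b hch.1 with h | h
      · simp [h] at hu
      · exact h
    rcases List.mem_cons.1 hx with h | h
    · exact h ▸ hb
    · exact ih b hb hch.2 (fun h => hu (List.mem_cons_of_mem _ h)) x h

theorem Ctx.cut {V : Type*} {G : SimpleGraph V} {t : ℕ} (h : Ctx G t) (B : Set V) (u b v : V)
    (hu : u ∉ B) (hb : b ∈ B) (hv : v ∉ B) (hvu : v ≠ u)
    (hB : ∀ b ∈ B, ∀ w, G.Adj b w → w = u ∨ w ∈ B) : False := by
  -- neighbour of u in B
  obtain ⟨x, hx, y, hy, hxy⟩ := exists_boundary h.conn B b u hb hu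
  have hyu : y = u := by
    rcases hB x hx y hxy with h | h
    · exact h
    · exact absurd h hy
  subst hyu
  -- neighbour outside
  obtain ⟨x', hx', y', hy', hxy'⟩ := exists_boundary h.conn {w | w ∉ B ∧ w ≠ y} v y ⟨hv, hvu⟩ (by simp)
  have hyu' : y' = y := by
    by_contra hne
    have : y' ∈ B := by
      by_contra h'
      exact hy' ⟨h', hne⟩
    rcases hB y' this x' hxy'.symm with h | h
    · exact hx'.2 h
    · exact hx'.1 h
  subst hyu'
  obtain ⟨l, hl, hn, hlen⟩ := h.st y'
  have key : ∃ z, G.Adj z y' ∧ z ∉ y' :: l := by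
    cases l with
    | nil => exact ⟨x, hxy, by simpa using hxy.ne⟩
    | cons a l =>
      rw [List.isChain_cons_cons] at hl
      have hyl : y' ∉ l := fun h => by simp [h] at hn
      by_cases haB : a ∈ B
      · refine ⟨x', hxy', ?_⟩
        have := chain_closed B y' hB l a haB hl.2 hyl
        intro hm
        rcases List.mem_cons.1 hm with h | h
        · exact hx'.2 h
        · rcases List.mem_cons.1 h with h | h
          · exact hx'.1 (h ▸ haB)
          · exact hx'.1 (this _ h)
      · refine ⟨x, hxy, ?_⟩
        have := chain_closed {w | w ∉ B ∧ w ≠ y'} y' (by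
          intro p hp w hw
          by_cases hwy : w = y'
          · exact Or.inl hwy
          · refine Or.inr ⟨?_, hwy⟩
            intro hwB
            rcases hB w hwB p hw.symm with h | h
            · exact hp.2 h
            · exact hp.1 h) l a ⟨haB, hl.1.ne'⟩ hl.2 hyl
        intro hm
        rcases List.mem_cons.1 hm with h | h
        · exact hxy.ne h
        · rcases List.mem_cons.1 h with h | h
          · exact haB (h ▸ hx)
          · exact (this _ h).1 hx
  obtain ⟨z, hz, hzl⟩ := key
  have := h.le (z :: y' :: l) (List.isChain_cons_cons.2 ⟨hz, hl⟩) (List.nodup_cons.2 ⟨hzl, hn⟩)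
  simp at this
  omega

theorem Ctx.third {V : Type*} {G : SimpleGraph V} {t : ℕ} (h : Ctx G t) (u v : V) :
    ∃ w, w ≠ u ∧ w ≠ v := by
  have hstep : ∀ l : List V, l.IsChain G.Adj → l.Nodup → ∃ x, x ∉ l := h.nt
  by_cases huv : u = v
  · subst huv
    obtain ⟨x, hx⟩ := h.nt [u] (by simp) (by simp)
    exact ⟨x, by simpa using hx, by simpa using hx⟩
  · by_contra hcon
    push Not at hcon
    obtain ⟨x, hx, y, hy, hxy⟩ := exists_boundary h.conn {u} u v rfl (by simpa using Ne.symm huv)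
    have hx' : x = u := hx
    subst hx'
    have hy' := hcon y hy
    subst hy'
    obtain ⟨z, hz⟩ := h.nt [x, y] (by simp [hxy]) (by simp [huv])
    simp at hz
    exact hz.2 (hcon z hz.1)

theorem Ctx.deg {V : Type*} {G : SimpleGraph V} {t : ℕ} (h : Ctx G t) (v u : V) :
    ∃ w, G.Adj v w ∧ w ≠ u := by
  by_contra hcon
  push Not at hcon
  obtain ⟨u', hu'⟩ : ∃ u', u' ≠ v ∧ ∀ w, G.Adj v w → w = u' := by
    by_cases huv : u = v
    · obtain ⟨w, hw, _⟩ := h.third v v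
      refine ⟨w, hw, fun w' hw' => ?_⟩
      exact absurd ((hcon w' hw').trans huv) hw'.ne'
    · exact ⟨u, huv, hcon⟩
  obtain ⟨w, hw1, hw2⟩ := h.third u' v
  exact h.cut {v} u' v w (by simpa using hu'.1) rfl (by simpa using hw2) hw1 (by
    rintro b rfl w hw
    exact Or.inl (hu'.2 w hw))

/-- closed walk lists -/
def IsCyc {V : Type*} (G : SimpleGraph V) (a : V) (l : List V) : Prop :=
  (a :: (l ++ [a])).IsChain G.Adj ∧ (a :: l).Nodup ∧ 2 ≤ l.length

theorem Ctx.exists_cyc {V : Type*} {G : SimpleGraph V} {t : ℕ} (h : Ctx G t) :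
    ∃ a l, IsCyc G a l := by
  obtain ⟨v⟩ := h.conn.nonempty
  obtain ⟨l, hl, hn, hlen⟩ := h.st v
  cases l with
  | nil =>
    obtain ⟨w, hw, _⟩ := h.deg v v
    have := h.le [v, w] (by simp [hw]) (by simp [hw.ne])
    simp at this hlen; omega
  | cons w l =>
    obtain ⟨x, hx, hxw⟩ := h.deg v w
    have hxl : x ∈ l := by
      by_contra hxl
      have := h.le (x :: v :: w :: l) (List.isChain_cons_cons.2 ⟨hx.symm, hl⟩)
        (List.nodup_cons.2 ⟨by simp [hx.ne', hxw, hxl], hn⟩)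
      simp at this hlen; omega
    obtain ⟨r1, r2, rfl⟩ := List.append_of_mem hxl
    refine ⟨v, w :: (r1 ++ [x]), ?_, ?_, by simp⟩
    · have h1 : (v :: w :: r1 ++ x :: r2).IsChain G.Adj := hl
      rw [List.isChain_split] at h1
      have : (v :: w :: r1 ++ x :: [v]).IsChain G.Adj := by
        rw [List.isChain_split]
        exact ⟨h1.1, by simp [hx.symm]⟩
      simpa using this
    · refine hn.sublist ?_
      simp

theorem Ctx.cyc_lt {V : Type*} {G : SimpleGraph V} {t : ℕ} (h : Ctx G t) (a : V) (l : List V)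
    (hc : IsCyc G a l) : l.length + 2 ≤ t := by
  obtain ⟨h1, h2, h3⟩ := hc
  obtain ⟨x, hx⟩ := h.nt (a :: l) (by
    have : ((a :: l) ++ [a]).IsChain G.Adj := h1
    exact this.left_of_append) h2
  obtain ⟨y, hy, z, hz, hyz⟩ := exists_boundary h.conn {w | w ∈ a :: l} a x (by simp) hx
  simp only [Set.mem_ofPred_eq] at hy hz
  by_cases hya : y = a
  · subst hya
    have := h.le (z :: y :: l) (List.isChain_cons_cons.2 ⟨hyz.symm, by
      have : ((y :: l) ++ [y]).IsChain G.Adj := h1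
      exact this.left_of_append⟩) (List.nodup_cons.2 ⟨hz, h2⟩)
    simp at this
    omega
  · have hyl : y ∈ l := by simpa [hya] using hy
    obtain ⟨r1, r2, rfl⟩ := List.append_of_mem hyl
    have h4 : ((a :: r1) ++ y :: (r2 ++ [a])).IsChain G.Adj := by simpa using h1
    rw [List.isChain_split] at h4
    have h5 : ((y :: r2) ++ a :: r1).IsChain G.Adj := by
      rw [List.isChain_split]
      refine ⟨by simpa using h4.2, ?_⟩
      have : ((a :: r1) ++ [y]).IsChain G.Adj := h4.1
      exact this.left_of_append
    have hperm : ((y :: r2) ++ a :: r1).Perm (a :: (r1 ++ y :: r2)) := by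
      have : (a :: (r1 ++ y :: r2)) = (a :: r1) ++ (y :: r2) := by simp
      rw [this]
      exact List.perm_append_comm
    have := h.le (z :: ((y :: r2) ++ a :: r1)) (by
      rw [List.cons_append] at h5 ⊢
      exact List.isChain_cons_cons.2 ⟨hyz.symm, h5⟩) (List.nodup_cons.2 ⟨by
        rw [hperm.mem_iff]; exact hz, hperm.nodup_iff.2 h2⟩)
    simp at this ⊢
    omega

structure CC {V : Type*} (G : SimpleGraph V) (t m : ℕ) (c : Fin (m + 1) → V) : Prop
    extends Ctx G t where
  inj : Function.Injective c
  ad : ∀ i, G.Adj (c i) (c (i + 1))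
  mx : ∀ a l, IsCyc G a l → l.length ≤ m
  lt : m + 2 ≤ t
  t8 : t ≤ 8

section
variable {V : Type*} {G : SimpleGraph V} {t m : ℕ} {c : Fin (m + 1) → V}

theorem CC.rot (h : CC G t m c) (k : Fin (m + 1)) : CC G t m (fun i => c (i + k)) :=
  { h with
    inj := fun i j hij => by simpa using h.inj hij
    ad := fun i => by
      have := h.ad (i + k)
      rwa [show i + k + 1 = i + 1 + k from add_right_comm _ _ _] at this }

theorem CC.refl (h : CC G t m c) : CC G t m (fun i => c (-i)) :=
  { h with
    inj := fun i j hij => by simpa using h.inj hij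
    ad := fun i => by
      have := h.ad (-(i + 1))
      rw [show -(i + 1) + 1 = -i by abel] at this
      exact this.symm }

theorem CC.aj (h : CC G t m c) (i j : Fin (m + 1)) (hij : j = i + 1 ∨ i = j + 1) :
    G.Adj (c i) (c j) := by
  rcases hij with rfl | rfl
  · exact h.ad _
  · exact (h.ad _).symm

theorem CC.ne (h : CC G t m c) (i j : Fin (m + 1)) (hij : i ≠ j) : c i ≠ c j :=
  fun e => hij (h.inj e)

theorem CC.pf (h : CC G t m c) (l : List V) (h1 : l.IsChain G.Adj) (h2 : l.Nodup)
    (h3 : t < l.length) : False := by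
  have := h.le l h1 h2
  omega

theorem CC.cf (h : CC G t m c) (a : V) (l : List V) (h1 : (a :: (l ++ [a])).IsChain G.Adj)
    (h2 : (a :: l).Nodup) (h3 : 2 ≤ l.length) (h4 : m < l.length) : False := by
  have := h.mx a l ⟨h1, h2, h3⟩
  omega

theorem Ctx.path (h : Ctx G t) (v : V) (k : ℕ) (hk : k ≤ t) :
    ∃ p : ℕ → V, p 0 = v ∧ (∀ i, i + 1 < k → G.Adj (p i) (p (i + 1))) ∧
      ∀ i < k, ∀ j < k, p i = p j → i = j := by
  obtain ⟨l, hl, hn, hlen⟩ := h.st v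
  refine ⟨fun i => (v :: l).getD i v, by simp, ?_, ?_⟩
  · intro i hi
    have h1 : i < (v :: l).length := by simp; omega
    have h2 : i + 1 < (v :: l).length := by simp; omega
    simp only [List.getD_eq_getElem _ _ h1, List.getD_eq_getElem _ _ h2]
    exact hl.getElem _ _
  · intro i hi j hj hij
    have h1 : i < (v :: l).length := by simp; omega
    have h2 : j < (v :: l).length := by simp; omega
    simp only [List.getD_eq_getElem _ _ h1, List.getD_eq_getElem _ _ h2] at hij
    exact (hn.getElem_inj_iff).1 hij

open Classical in
theorem cnt (p : ℕ → V) (k : ℕ) (hp : ∀ i < k, ∀ j < k, p i = p j → i = j) (S : Finset V) :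
    ∑ i ∈ Finset.range k, (if p i ∈ S then 1 else 0) ≤ S.card := by
  rw [← Finset.card_filter]
  apply Finset.card_le_card_of_injOn p
  · intro i hi
    simpa using (Finset.mem_filter.1 hi).2
  · intro i hi j hj hij
    simp at hi hj
    exact hp i hi.1 j hj.1 hij

open Classical in
/-- Counting: a path starting in `S` whose edges outside `S` all lie inside `D`. -/
theorem cntD (p : ℕ → V) (k : ℕ) (hk : 1 ≤ k)
    (ha : ∀ i, i + 1 < k → G.Adj (p i) (p (i + 1)))
    (hp : ∀ i < k, ∀ j < k, p i = p j → i = j) (S D : Finset V) (h0 : p 0 ∈ S)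
    (hD : ∀ u v, G.Adj u v → u ∉ S → v ∉ S → u ∈ D) :
    k ≤ 2 * S.card + (D.card - 1) := by
  have h1 := cnt p k hp S
  have h2 := cnt p k hp D
  have key : ∀ j, j < k →
      (p j ∈ S → j + 2 ≤ 2 * (∑ i ∈ Finset.range (j + 1), (if p i ∈ S then 1 else 0)) +
        ((∑ i ∈ Finset.range (j + 1), (if p i ∈ D then 1 else 0)) - 1)) ∧
      (p j ∉ S → j + 1 ≤ 2 * (∑ i ∈ Finset.range (j + 1), (if p i ∈ S then 1 else 0)) +
        ((∑ i ∈ Finset.range (j + 1), (if p i ∈ D then 1 else 0)) - 1)) ∧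
      (p j ∈ D → 1 ≤ (∑ i ∈ Finset.range (j + 1), (if p i ∈ D then 1 else 0))) := by
    intro j
    induction j with
    | zero =>
      intro _
      simp only [Nat.zero_add, Finset.sum_range_one, h0, if_true]
      refine ⟨fun _ => by omega, fun h => by simp at h, fun h => by simp [h]⟩
    | succ j ih =>
      intro hj
      obtain ⟨i1, i2, i3⟩ := ih (by omega)
      have hadj := ha j hj
      rw [Finset.sum_range_succ _ (j + 1), Finset.sum_range_succ _ (j + 1)]
      generalize (∑ i ∈ Finset.range (j + 1), (if p i ∈ S then 1 else 0)) = σ at *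
      generalize (∑ i ∈ Finset.range (j + 1), (if p i ∈ D then 1 else 0)) = δ at *
      by_cases a1 : p j ∈ S
      · have := i1 a1
        by_cases a2 : p (j + 1) ∈ S <;> by_cases a3 : p (j + 1) ∈ D <;> simp [a2, a3] <;> omega
      · have := i2 a1
        by_cases a2 : p (j + 1) ∈ S
        · by_cases a3 : p (j + 1) ∈ D <;> simp [a2, a3] <;> omega
        · have a3 := hD _ _ hadj a1 a2
          have a4 := hD _ _ hadj.symm a2 a1
          have := i3 a3
          simp [a2, a4]; omega
  obtain ⟨k, rfl⟩ : ∃ k', k = k' + 1 := ⟨k - 1, by omega⟩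
  obtain ⟨i1, i2, i3⟩ := key k (by omega)
  by_cases a1 : p k ∈ S
  · have := i1 a1; omega
  · have := i2 a1; omega

theorem Ctx.cD (h : Ctx G t) (v : V) (S D : Finset V) (h0 : v ∈ S) (n d : ℕ)
    (hS : S.card ≤ n) (hDc : D.card ≤ d + 1) (ht : 2 * n + d < t)
    (hD : ∀ u v, G.Adj u v → u ∉ S → v ∉ S → u ∈ D) : False := by
  obtain ⟨p, hp0, hpa, hpi⟩ := h.path v t le_rfl
  have := cntD p t (by omega) hpa hpi S D (by rw [hp0]; exact h0) hD
  omega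

open Classical in
theorem Ctx.c3 (h : Ctx G t) (v : V) (S : Finset V) (h0 : v ∈ S)
    (hS : S.card ≤ 2) (ht : 7 ≤ t)
    (hD : ∀ u v w, G.Adj u v → G.Adj v w → u ≠ w → u ∉ S → v ∉ S → w ∉ S → False) : False := by
  obtain ⟨p, hp0, hpa, hpi⟩ := h.path v 7 ht
  have h1 := cnt p 7 hpi S
  simp only [Finset.sum_range_succ, Finset.range_zero, Finset.sum_empty] at h1
  have key : ∀ i, i + 2 < 7 → 1 ≤ (if p i ∈ S then 1 else 0) + (if p (i + 1) ∈ S then 1 else 0)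
      + (if p (i + 2) ∈ S then 1 else 0) := by
    intro i hi
    by_cases a1 : p i ∈ S
    · simp only [a1, if_true]; omega
    · by_cases a2 : p (i + 1) ∈ S
      · simp only [a2, if_true]; omega
      · by_cases a3 : p (i + 2) ∈ S
        · simp only [a3, if_true]; omega
        · exact (hD _ _ _ (hpa i (by omega)) (hpa (i + 1) (by omega))
            (fun e => by have := hpi i (by omega) (i + 2) (by omega) e; omega) a1 a2 a3).elim
  have k1 := key 1 (by omega)
  have k4 := key 4 (by omega)
  simp only [Nat.reduceAdd] at k1 k4
  rw [← hp0] at h0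
  rw [if_pos h0] at h1
  omega

open Classical in
theorem Ctx.c4 (h : Ctx G t) (v : V) (S : Finset V) (h0 : v ∈ S)
    (hS : S.card ≤ 4) (ht : 8 ≤ t)
    (hD : ∀ u v, G.Adj u v → u ∉ S → v ∉ S → False) :
    ∃ o s' o' s'', s' ∈ S ∧ s'' ∈ S ∧ o ∉ S ∧ o' ∉ S ∧ s' ≠ v ∧ s'' ≠ v ∧ s' ≠ s'' ∧
      G.Adj v o ∧ G.Adj o s' ∧ G.Adj s' o' ∧ G.Adj o' s'' := by
  obtain ⟨p, hp0, hpa, hpi⟩ := h.path v 8 ht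
  have h1 := cnt p 8 hpi S
  simp only [Finset.sum_range_succ, Finset.range_zero, Finset.sum_empty] at h1
  subst hp0
  have key : ∀ i, i + 1 < 8 → 1 ≤ (if p i ∈ S then 1 else 0) + (if p (i + 1) ∈ S then 1 else 0) := by
    intro i hi
    by_cases a1 : p i ∈ S
    · simp [a1]
    · by_cases a2 : p (i + 1) ∈ S
      · simp [a2]
      · exact (hD _ _ (hpa i hi) a1 a2).elim
  have k0 := key 0 (by omega)
  have k1 := key 1 (by omega)
  have k2 := key 2 (by omega)
  have k3 := key 3 (by omega)
  have k4 := key 4 (by omega)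
  have k5 := key 5 (by omega)
  have k6 := key 6 (by omega)
  simp only [Nat.reduceAdd] at k0 k1 k2 k3 k4 k5 k6
  rw [if_pos h0] at h1 k0
  have a1 : p 1 ∉ S := by intro hh; rw [if_pos hh] at h1; omega
  rw [if_neg a1] at h1 k0 k1
  have a2 : p 2 ∈ S := by by_contra hh; rw [if_neg hh] at k1; omega
  rw [if_pos a2] at h1 k1 k2
  have a3 : p 3 ∉ S := by intro hh; rw [if_pos hh] at h1; omega
  rw [if_neg a3] at h1 k2 k3
  have a4 : p 4 ∈ S := by by_contra hh; rw [if_neg hh] at k3; omega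
  refine ⟨p 1, p 2, p 3, p 4, a2, a4, a1, a3, ?_, ?_, ?_, hpa 0 (by omega), hpa 1 (by omega),
    hpa 2 (by omega), hpa 3 (by omega)⟩
  · intro e; have := hpi 2 (by omega) 0 (by omega) e; omega
  · intro e; have := hpi 4 (by omega) 0 (by omega) e; omega
  · intro e; have := hpi 2 (by omega) 4 (by omega) e; omega

/-- outside vertices -/
def Out (c : Fin (m + 1) → V) (x : V) : Prop := ∀ i, x ≠ c i

def OG (G : SimpleGraph V) (c : Fin (m + 1) → V) : SimpleGraph V where
  Adj a b := G.Adj a b ∧ Out c a ∧ Out c b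
  symm := ⟨fun _ _ h => ⟨h.1.symm, h.2.2, h.2.1⟩⟩
  loopless := ⟨fun _ h => h.1.ne rfl⟩

theorem out_or (c : Fin (m + 1) → V) (x : V) : Out c x ∨ ∃ i, x = c i := by
  by_cases h : Out c x
  · exact Or.inl h
  · right; unfold Out at h; push Not at h; exact h

theorem OG.out (p : V) (hp : Out c p) (v : V) (h : (OG G c).Reachable p v) : Out c v := by
  obtain ⟨w⟩ := h
  induction w with
  | nil => exact hp
  | cons h w ih => exact ih h.2.2

theorem CC.fan (h : CC G t m c) (hm : 1 ≤ m) (p q : V) (hp : Out c p) (hq : Out c q) (hpq : G.Adj p q) :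
    ∃ x y i j, x ≠ y ∧ i ≠ j ∧ G.Adj x (c i) ∧ G.Adj y (c j) ∧ (OG G c).Reachable p x ∧
      (OG G c).Reachable p y := by
  by_contra hcon
  have hout : ∀ v, (OG G c).Reachable p v → Out c v := fun v hv => OG.out p hp v hv
  have hcl : ∀ v w, (OG G c).Reachable p v → G.Adj v w → Out c w → (OG G c).Reachable p w := by
    intro v w hv hvw hw
    exact hv.trans (SimpleGraph.Adj.reachable ⟨hvw, hout v hv, hw⟩)
  have hcon' : ∀ x y i j, i ≠ j → G.Adj x (c i) → G.Adj y (c j) → (OG G c).Reachable p x →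
      (OG G c).Reachable p y → x = y := by
    intro x y i j hij h1 h2 h3 h4
    by_contra hxy
    exact hcon ⟨x, y, i, j, hxy, hij, h1, h2, h3, h4⟩
  have hci : ∀ i, ¬ (OG G c).Reachable p (c i) := fun i hi => hout _ hi i rfl
  obtain ⟨x, hx, y, hy, hxy⟩ := exists_boundary h.conn {v | (OG G c).Reachable p v} p (c 0)
    (SimpleGraph.Reachable.refl p) (hci 0)
  obtain ⟨i, rfl⟩ : ∃ i, y = c i := by
    rcases out_or c y with h' | h'
    · exact absurd (hcl x y hx hxy h') hy
    · exact h'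
  have h01 : (0 : Fin (m + 1)) ≠ 1 := by
    intro h; have := congrArg Fin.val h; simp [Nat.mod_eq_of_lt (show 1 < m + 1 by omega)] at this
  obtain ⟨i', hi'⟩ : ∃ i', i' ≠ i := by
    by_cases h0 : (0 : Fin (m + 1)) = i
    · exact ⟨1, fun h => h01 (h0.trans h.symm)⟩
    · exact ⟨0, h0⟩
  have : ∃ b w, (OG G c).Reachable p b ∧ G.Adj b w ∧ w ≠ c i ∧ ¬ (OG G c).Reachable p w := by
    by_contra hno
    push Not at hno
    refine h.cut {v | (OG G c).Reachable p v} (c i) p (c i') (hci i) (SimpleGraph.Reachable.refl p)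
      (hci i') (h.ne _ _ hi') ?_
    intro b hb w hw
    by_cases hwi : w = c i
    · exact Or.inl hwi
    · exact Or.inr (hno b w hb hw hwi)
  obtain ⟨b, w, hb, hbw, hwi, hw⟩ := this
  obtain ⟨j, rfl⟩ : ∃ j, w = c j := by
    rcases out_or c w with h' | h'
    · exact absurd (hcl b w hb hbw h') hw
    · exact h'
  have hij : i ≠ j := fun e => hwi (by rw [e])
  have hxb := hcon' x b i j hij hxy hbw hx hb
  subst hxb
  have hr : (OG G c).Reachable p q := hcl p q (SimpleGraph.Reachable.refl p) hpq hq
  obtain ⟨z, hz, hzx⟩ : ∃ z, (OG G c).Reachable p z ∧ z ≠ x := by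
    by_cases hpx : p = x
    · exact ⟨q, hr, fun e => hpq.ne (hpx.trans e.symm)⟩
    · exact ⟨p, SimpleGraph.Reachable.refl p, hpx⟩
  refine h.cut {v | (OG G c).Reachable p v ∧ v ≠ x} x z (c i) (by simp) ⟨hz, hzx⟩ (fun h => hci i h.1)
    (fun e => hout x hx i e.symm) ?_
  rintro b ⟨hb, hbx⟩ w hw
  by_cases hwx : w = x
  · exact Or.inl hwx
  rcases out_or c w with h' | ⟨k, rfl⟩
  · exact Or.inr ⟨hcl b w hb hw h', hwx⟩
  · exfalso
    by_cases hki : k = i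
    · exact hbx (hcon' b x k j (by rw [hki]; exact hij) hw hbw hb hx)
    · exact hbx (hcon' b x k i hki hw hxy hb hx)

open Classical in
theorem CC.fan2 (h : CC G t m c) (hm : 1 ≤ m) (p q : V) (hp : Out c p) (hq : Out c q) (hpq : G.Adj p q) :
    ∃ x y i j, ∃ n : ℕ, x ≠ y ∧ i ≠ j ∧ G.Adj x (c i) ∧ G.Adj y (c j) ∧ Out c x ∧ Out c y ∧
      (OG G c).Reachable p x ∧ (OG G c).Reachable p y ∧ (∃ x', Out c x' ∧ G.Adj x x') ∧
      (n = 0 → G.Adj x y) ∧ ∀ arc : List V, (y :: (arc ++ [x])).IsChain G.Adj → arc.Nodup →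
        (∀ v ∈ arc, ∃ i, v = c i) → 1 ≤ arc.length → arc.length + n + 1 ≤ m := by
  obtain ⟨x, y, i, j, hxy, hij, hxi, hyj, hx, hy⟩ := h.fan hm p q hp hq hpq
  have ox := OG.out p hp x hx
  have oy := OG.out p hp y hy
  obtain ⟨w, hw⟩ := (hx.symm.trans hy).exists_isPath
  have hlen : 1 ≤ w.length := by
    rcases Nat.eq_zero_or_pos w.length with h0 | h0
    · exact absurd (SimpleGraph.Walk.eq_of_length_eq_zero h0) hxy
    · exact h0
  have hch : w.support.IsChain G.Adj := w.isChain_adj_support.imp (fun a b h => h.1)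
  have hso : ∀ v ∈ w.support, Out c v := by
    intro v hv
    exact OG.out x ox v ⟨w.takeUntil v hv⟩
  obtain ⟨l, hl⟩ : ∃ l, w.support = x :: (l ++ [y]) := by
    cases w with
    | nil => simp at hlen
    | cons h' w' =>
      refine ⟨w'.support.dropLast, ?_⟩
      rw [SimpleGraph.Walk.support_cons]
      congr 1
      have := List.dropLast_append_getLast w'.support_ne_nil
      rw [SimpleGraph.Walk.getLast_support] at this
      exact this.symm
  have hnd := hw.support_nodup
  rw [hl] at hch hso hnd
  refine ⟨x, y, i, j, l.length, hxy, hij, hxi, hyj, ox, oy, hx, hy, ?_, ?_, ?_⟩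
  · cases l with
    | nil => exact ⟨y, oy, by simpa using hch⟩
    | cons a l => exact ⟨a, hso a (by simp), by simp at hch; exact hch.1⟩
  · intro h0
    have : l = [] := List.length_eq_zero_iff.1 h0
    subst this
    simpa using hch
  · intro arc h1 h2 h3 h4
    have := h.mx x (l ++ y :: arc) ⟨?_, ?_, ?_⟩
    · simp at this; omega
    · have : ((x :: l) ++ y :: (arc ++ [x])).IsChain G.Adj := by
        rw [List.isChain_split]
        exact ⟨by simpa using hch, h1⟩
      simpa using this
    · have : (x :: (l ++ y :: arc)) = (x :: (l ++ [y])) ++ arc := by simp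
      rw [this, List.nodup_append]
      refine ⟨hnd, h2, ?_⟩
      intro a ha b hb hab
      obtain ⟨k, hk⟩ := h3 b hb
      exact hso a ha k (hab.trans hk)
    · simp; omega
end

section
variable {V : Type*} {G : SimpleGraph V} {t m : ℕ} {c : Fin (m + 1) → V}

theorem out_rot (k : Fin (m + 1)) (v : V) : Out (fun i => c (i + k)) v ↔ Out c v := by
  constructor
  · intro h i
    have := h (i - k)
    simpa using this
  · intro h i
    exact h _

theorem out_refl (v : V) : Out (fun i => c (-i)) v ↔ Out c v := by
  constructor
  · intro h i
    have := h (-i)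
    simpa using this
  · intro h i
    exact h _

theorem CC.fan3 (h : CC G t m c) (hm : 1 ≤ m) (p q : V) (hp : Out c p) (hq : Out c q) (hpq : G.Adj p q) :
    ∃ c' : Fin (m + 1) → V, CC G t m c' ∧ (∀ v, Out c' v ↔ Out c v) ∧
    ∃ x y j, ∃ n : ℕ, x ≠ y ∧ j ≠ 0 ∧ G.Adj x (c' 0) ∧ G.Adj y (c' j) ∧ Out c x ∧ Out c y ∧
      (OG G c).Reachable p x ∧ (OG G c).Reachable p y ∧ (∃ x', Out c x' ∧ G.Adj x x') ∧
      (n = 0 → G.Adj x y) ∧ ∀ arc : List V, (y :: (arc ++ [x])).IsChain G.Adj → arc.Nodup →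
        (∀ v ∈ arc, ∃ i, v = c' i) → 1 ≤ arc.length → arc.length + n + 1 ≤ m := by
  obtain ⟨x, y, i, j, n, h1, h2, h3, h4, h5, h6, h7, h8, h9, h10, h11⟩ := h.fan2 hm p q hp hq hpq
  refine ⟨_, h.rot i, out_rot i, x, y, j - i, n, h1, ?_, ?_, ?_, h5, h6, h7, h8, h9, h10, ?_⟩
  · rw [Ne, sub_eq_zero]; exact h2.symm
  · simpa using h3
  · simpa using h4
  · intro arc a1 a2 a3 a4
    refine h11 arc a1 a2 (fun v hv => ?_) a4
    obtain ⟨k, hk⟩ := a3 v hv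
    exact ⟨_, hk⟩

theorem indep2 {c : Fin 3 → V} (h : CC G t 2 c) (p q : V) (hp : Out c p) (hq : Out c q)
    (hpq : G.Adj p q) : False := by
  obtain ⟨c', hc, ho, x, y, j, n, h1, h2, h3, h4, h5, h6, h7, h8, h9, h10, h11⟩ :=
    h.fan3 (by omega) p q hp hq hpq
  fin_cases j
  · simp at h2
  · have := h11 [c' 1, c' 2, c' 0] (by simp_all [hc.aj, G.adj_comm]) (by simp [hc.inj.eq_iff]) (by simp) (by simp)
    simp only [List.length] at this; omega
  · have := h11 [c' 2, c' 1, c' 0] (by simp_all [hc.aj, G.adj_comm]) (by simp [hc.inj.eq_iff]) (by simp) (by simp)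
    simp only [List.length] at this; omega

theorem indep3 {c : Fin 4 → V} (h : CC G t 3 c) (p q : V) (hp : Out c p) (hq : Out c q)
    (hpq : G.Adj p q) : False := by
  obtain ⟨c', hc, ho, x, y, j, n, h1, h2, h3, h4, h5, h6, h7, h8, h9, h10, h11⟩ :=
    h.fan3 (by omega) p q hp hq hpq
  fin_cases j
  · simp at h2
  · have := h11 [c' 1, c' 2, c' 3, c' 0] (by simp_all [hc.aj, G.adj_comm]) (by simp [hc.inj.eq_iff]) (by simp) (by simp)
    simp only [List.length] at this; omega
  · have := h11 [c' 2, c' 3, c' 0] (by simp_all [hc.aj, G.adj_comm]) (by simp [hc.inj.eq_iff]) (by simp) (by simp)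
    simp only [List.length] at this; omega
  · have := h11 [c' 3, c' 2, c' 1, c' 0] (by simp_all [hc.aj, G.adj_comm]) (by simp [hc.inj.eq_iff]) (by simp) (by simp)
    simp only [List.length] at this; omega

theorem indep4 {c : Fin 5 → V} (h : CC G t 4 c) (p q : V) (hp : Out c p) (hq : Out c q)
    (hpq : G.Adj p q) : False := by
  obtain ⟨c', hc, ho, x, y, j, n, h1, h2, h3, h4, h5, h6, h7, h8, h9, h10, h11⟩ :=
    h.fan3 (by omega) p q hp hq hpq
  fin_cases j
  · simp at h2
  · have := h11 [c' 1, c' 2, c' 3, c' 4, c' 0] (by simp_all [hc.aj, G.adj_comm]) (by simp [hc.inj.eq_iff]) (by simp) (by simp)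
    simp only [List.length] at this; omega
  · have := h11 [c' 2, c' 3, c' 4, c' 0] (by simp_all [hc.aj, G.adj_comm]) (by simp [hc.inj.eq_iff]) (by simp) (by simp)
    simp only [List.length] at this; omega
  · have := h11 [c' 3, c' 2, c' 1, c' 0] (by simp_all [hc.aj, G.adj_comm]) (by simp [hc.inj.eq_iff]) (by simp) (by simp)
    simp only [List.length] at this; omega
  · have := h11 [c' 4, c' 3, c' 2, c' 1, c' 0] (by simp_all [hc.aj, G.adj_comm]) (by simp [hc.inj.eq_iff]) (by simp) (by simp)
    simp only [List.length] at this; omega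

theorem Out.n1 {x : V} (hx : Out c x) (i : Fin (m + 1)) : x ≠ c i := hx i
theorem Out.n2 {x : V} (hx : Out c x) (i : Fin (m + 1)) : c i ≠ x := (hx i).symm

def Ind (G : SimpleGraph V) (c : Fin (m + 1) → V) : Prop :=
  ∀ p q, Out c p → Out c q → ¬ G.Adj p q

theorem Ind.rot (hI : Ind G c) (k : Fin (m + 1)) : Ind G (fun i => c (i + k)) :=
  fun p q hp hq => hI p q ((out_rot _ _).1 hp) ((out_rot _ _).1 hq)

theorem Ind.refl (hI : Ind G c) : Ind G (fun i => c (-i)) :=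
  fun p q hp hq => hI p q ((out_refl _).1 hp) ((out_refl _).1 hq)

theorem Out.rot {x : V} (hx : Out c x) (k : Fin (m + 1)) : Out (fun i => c (i + k)) x :=
  (out_rot _ _).2 hx

theorem Out.refl {x : V} (hx : Out c x) : Out (fun i => c (-i)) x := (out_refl _).2 hx

theorem CC.nb (h : CC G t m c) (hI : Ind G c) {y : V} (hy : Out c y) (i : Fin (m + 1)) :
    ∃ j, j ≠ i ∧ G.Adj y (c j) := by
  obtain ⟨w, hw, hwi⟩ := h.deg y (c i)
  rcases out_or c w with ho | ⟨j, rfl⟩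
  · exact absurd hw (hI y w hy ho)
  · exact ⟨j, fun e => hwi (by rw [e]), hw⟩

/-- After a rotation some outside vertex is adjacent to `c 0` and another `c k`. -/
theorem CC.two (h : CC G t m c) (hI : Ind G c) {y : V} (hy : Out c y) :
    ∃ c' : Fin (m + 1) → V, CC G t m c' ∧ Ind G c' ∧ (∀ v, Out c' v ↔ Out c v) ∧
      ∃ k, k ≠ 0 ∧ G.Adj y (c' 0) ∧ G.Adj y (c' k) := by
  obtain ⟨i, _, hi⟩ := h.nb hI hy 0
  obtain ⟨j, hij, hj⟩ := h.nb hI hy i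
  refine ⟨_, h.rot i, hI.rot i, out_rot i, j - i, ?_, by simpa using hi, by simpa using hj⟩
  rwa [Ne, sub_eq_zero]
end

open Classical in
theorem exists_cc {V : Type*} {G : SimpleGraph V} {t : ℕ} (h : Ctx G t) (ht : t ≤ 8) :
    ∃ m, ∃ c : Fin (m + 1) → V, 2 ≤ m ∧ m ≤ 6 ∧ CC G t m c := by
  have hne : ({n | ∃ a l, IsCyc G a l ∧ l.length = n} : Set ℕ).Nonempty := by
    obtain ⟨a, l, hl⟩ := h.exists_cyc
    exact ⟨l.length, a, l, hl, rfl⟩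
  have hbd : BddAbove ({n | ∃ a l, IsCyc G a l ∧ l.length = n} : Set ℕ) := by
    refine ⟨t, ?_⟩
    rintro n ⟨a, l, hl, rfl⟩
    have := h.cyc_lt a l hl
    omega
  obtain ⟨a, l, hl, hm⟩ := Nat.sSup_mem hne hbd
  have hmx : ∀ a' l', IsCyc G a' l' → l'.length ≤ l.length := by
    intro a' l' hl'
    rw [hm]
    exact le_csSup hbd ⟨a', l', hl', rfl⟩
  have h1 := h.cyc_lt a l hl
  have h2 := hl.2.2
  refine ⟨l.length, fun i => (a :: l)[i.val]'(by have := i.isLt; simp only [List.length_cons]; omega), h2, by omega, ⟨h, ?_, ?_, hmx, h1, ht⟩⟩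
  · intro i j hij
    have := (hl.2.1.getElem_inj_iff).1 hij
    exact Fin.ext this
  · intro i
    have hch := hl.1
    by_cases hi : i.val < l.length
    · have h3 := hch.left_of_append (l₁ := a :: l) (l₂ := [a])
      have h4 : (i + 1).val = i.val + 1 := Fin.val_add_one_of_lt (by
        rw [Fin.lt_def]; simpa using hi)
      have h5 := h3.getElem i.val (by simp; omega)
      simp only [h4]
      exact h5
    · have hi' : i = Fin.last _ := by
        apply Fin.ext; simp; omega
      subst hi'
      have h5 := hch.getElem l.length (by simp)
      simp only [Fin.last_add_one]
      have e1 : (a :: (l ++ [a]))[l.length + 1]'(by simp) = a := by simp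
      have e2 : (a :: (l ++ [a]))[l.length]'(by simp) = (a :: l)[l.length]'(by simp) := by
        have : (a :: (l ++ [a])) = (a :: l) ++ [a] := rfl
        simp only [this]
        rw [List.getElem_append_left]
      rw [e1, e2] at h5
      simpa using h5

set_option linter.all false

section
variable {V : Type*} {G : SimpleGraph V} {t m : ℕ} {c : Fin (m + 1) → V}

open Classical in
theorem CC.edC (h : CC G t m c) (hI : Ind G c) (S : Finset (Fin (m + 1)))
    (hN : ∀ y, Out c y → ∀ j, j ∉ S → ¬ G.Adj y (c j)) (u v : V) (huv : G.Adj u v)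
    (hu : u ∉ S.image c) (hv : v ∉ S.image c) :
    ∃ i j, u = c i ∧ v = c j ∧ i ∉ S ∧ j ∉ S := by
  have key : ∀ i, c i ∉ S.image c → i ∉ S := fun i hi hS => hi (Finset.mem_image_of_mem c hS)
  rcases out_or c u with ou | ⟨i, rfl⟩ <;> rcases out_or c v with ov | ⟨j, rfl⟩
  · exact (hI u v ou ov huv).elim
  · exact (hN u ou j (key j hv) huv).elim
  · exact (hN v ov i (key i hu) huv.symm).elim
  · exact ⟨i, j, rfl, rfl, key i hu, key j hv⟩

open Classical in
theorem CC.cDi (h : CC G t m c) (hI : Ind G c) (S D : Finset (Fin (m + 1))) {i0 : Fin (m + 1)}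
    (h0 : i0 ∈ S) (ht : 2 * S.card + (D.card - 1) < t)
    (hN : ∀ y, Out c y → ∀ j, j ∉ S → ¬ G.Adj y (c j))
    (hE : ∀ i j, i ∉ S → j ∉ S → i < j → G.Adj (c i) (c j) → i ∈ D ∧ j ∈ D) : False := by
  refine h.cD (c i0) (S.image c) (D.image c) (Finset.mem_image_of_mem c h0) S.card (D.card - 1)
    Finset.card_image_le (Finset.card_image_le.trans (by omega)) ht ?_
  intro u v huv hu hv
  obtain ⟨i, j, rfl, rfl, hi, hj⟩ := h.edC hI S hN u v huv hu hv
  apply Finset.mem_image_of_mem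
  rcases lt_trichotomy i j with hij | hij | hij
  · exact (hE i j hi hj hij huv).1
  · subst hij; exact (huv.ne rfl).elim
  · exact (hE j i hj hi hij huv.symm).2
end

section
variable {V : Type*} {G : SimpleGraph V} {t : ℕ}

/-! ### longest cycle of length 3 -/
theorem three_nc {c : Fin 3 → V} (h : CC G t 2 c) {x : V} (hx : Out c x) (a : G.Adj x (c 0))
    (b : G.Adj x (c 1)) : False := 
  h.cf (x) [c 0, c 2, c 1] (by simp [h.aj, a, a.symm, b, b.symm]) (by simp [h.inj.eq_iff, hx.n1, hx.n2]) (by simp) (by simp)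

theorem CC.exOut {m : ℕ} {c : Fin (m + 1) → V} (h : CC G t m c) : ∃ x, Out c x := by
  classical
  by_contra hcon
  push Not at hcon
  have hc : ∀ x, ∃ i, x = c i := fun x => by
    rcases out_or c x with h1 | h1
    · exact absurd h1 (hcon x)
    · exact h1
  obtain ⟨l, hl, hn, hlen⟩ := h.st (c 0)
  obtain ⟨x, hx⟩ := h.nt _ hl hn
  have hsurj : Function.Surjective c := fun x => by
    obtain ⟨i, hi⟩ := hc x; exact ⟨i, hi.symm⟩
  have : Fintype V := Fintype.ofSurjective c hsurj
  have h1 := Fintype.card_le_of_surjective c hsurj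
  have h2 := hn.length_le_card
  simp at h1 h2
  have := h.lt
  omega

theorem case_three {c : Fin 3 → V} (h : CC G t 2 c) : False := by
  have hI : Ind G c := fun p q hp hq hpq => indep2 h p q hp hq hpq
  obtain ⟨x, hx⟩ := h.exOut
  obtain ⟨c', h', hI', ho, k, hk, a, b⟩ := h.two hI hx
  have hx' := (ho x).2 hx
  fin_cases k
  · simp at hk
  · exact three_nc h' hx' a b
  · exact three_nc (h'.rot 2) (hx'.rot 2) b a

/-! ### longest cycle of length 4 -/
theorem four_nc {c : Fin 4 → V} (h : CC G t 3 c) {x : V} (hx : Out c x) (a : G.Adj x (c 0))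
    (b : G.Adj x (c 1)) : False := 
  h.cf (x) [c 0, c 3, c 2, c 1] (by simp [h.aj, a, a.symm, b, b.symm]) (by simp [h.inj.eq_iff, hx.n1, hx.n2]) (by simp) (by simp)

theorem four_a {c : Fin 4 → V} (h : CC G t 3 c) (hI : Ind G c) {x : V} (hx : Out c x)
    (a : G.Adj x (c 0)) (b : G.Adj x (c 2)) : False := by
  have n1 : ∀ y, Out c y → ¬ (G.Adj y (c 1) ∧ G.Adj y (c 3)) := by
    rintro y hy ⟨d, e⟩
    by_cases hyx : y = x
    · subst hyx
      exact four_nc h hy a d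
    · exact h.cf (c 0) [x, c 2, c 1, y, c 3] (by simp [h.aj, a, a.symm, b, b.symm, d, d.symm, e, e.symm]) (by simp [h.inj.eq_iff, hx.n1, hx.n2, hy.n1, hy.n2, hyx, Ne.symm hyx]) (by simp) (by simp)
  have n2 : ∀ y, Out c y → ¬ G.Adj y (c 1) := by
    intro y hy d
    obtain ⟨j, hj, e⟩ := h.nb hI hy 1
    fin_cases j
    · exact four_nc h hy e d
    · simp at hj
    · exact four_nc (h.rot 1) (hy.rot 1) d e
    · exact n1 y hy ⟨d, e⟩
  have n3 : ∀ y, Out c y → ¬ G.Adj y (c 3) := by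
    intro y hy d
    obtain ⟨j, hj, e⟩ := h.nb hI hy 3
    fin_cases j
    · exact four_nc (h.rot 3) (hy.rot 3) d e
    · exact n1 y hy ⟨e, d⟩
    · exact four_nc (h.rot 2) (hy.rot 2) e d
    · simp at hj
  have n4 : ¬ G.Adj (c 1) (c 3) := fun d =>
    h.cf (c 0) [x, c 2, c 3, c 1] (by simp [h.aj, a, a.symm, b, b.symm, d, d.symm]) (by simp [h.inj.eq_iff, hx.n1, hx.n2]) (by simp) (by simp)
  refine h.cDi hI {0, 2} ∅ (i0 := 0) (by decide) (by have := h.lt; simp; omega) ?_ ?_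
  · intro y hy j hj e
    fin_cases j <;> first | exact absurd hj (by decide) | exact n2 y hy e | exact n3 y hy e
  · intro i j hi hj hij e
    fin_cases i <;> fin_cases j <;> first
      | exact absurd hi (by decide) | exact absurd hj (by decide)
      | exact absurd hij (by decide) | exact (n4 e).elim

theorem case_four {c : Fin 4 → V} (h : CC G t 3 c) : False := by
  have hI : Ind G c := fun p q hp hq hpq => indep3 h p q hp hq hpq
  obtain ⟨x, hx⟩ := h.exOut
  obtain ⟨c', h', hI', ho, k, hk, a, b⟩ := h.two hI hx
  have hx' := (ho x).2 hx
  fin_cases k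
  · simp at hk
  · exact four_nc h' hx' a b
  · exact four_a h' hI' hx' a b
  · exact four_nc (h'.rot 3) (hx'.rot 3) b a
end

section
variable {V : Type*} {G : SimpleGraph V} {t : ℕ}

/-! ### longest cycle of length 5 -/
theorem five_nc {c : Fin 5 → V} (h : CC G t 4 c) {x : V} (hx : Out c x) (a : G.Adj x (c 0))
    (b : G.Adj x (c 1)) : False := 
  h.cf (x) [c 0, c 4, c 3, c 2, c 1] (by simp [h.aj, a, a.symm, b, b.symm]) (by simp [h.inj.eq_iff, hx.n1, hx.n2]) (by simp) (by simp)

theorem five_mid {c : Fin 5 → V} (h : CC G t 4 c) (hI : Ind G c) {x : V} (hx : Out c x)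
    (a : G.Adj x (c 0)) (b : G.Adj x (c 2)) {y : V} (hy : Out c y) (d : G.Adj y (c 1)) : False := by
  by_cases hyx : y = x
  · subst hyx
    exact five_nc h hy a d
  obtain ⟨j, hj, e⟩ := h.nb hI hy 1
  fin_cases j
  · exact five_nc h hy e d
  · simp at hj
  · exact five_nc (h.rot 1) (hy.rot 1) d e
  · have e' : G.Adj y (c 3) := e
    exact h.cf (c 0) [x, c 2, c 1, y, c 3, c 4] (by simp [h.aj, a, a.symm, b, b.symm, d, d.symm, e', e'.symm]) (by simp [h.inj.eq_iff, hx.n1, hx.n2, hy.n1, hy.n2, hyx, Ne.symm hyx]) (by simp) (by simp)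
  · have e' : G.Adj y (c 4) := e
    exact h.cf (c 2) [x, c 0, c 1, y, c 4, c 3] (by simp [h.aj, a, a.symm, b, b.symm, d, d.symm, e', e'.symm]) (by simp [h.inj.eq_iff, hx.n1, hx.n2, hy.n1, hy.n2, hyx, Ne.symm hyx]) (by simp) (by simp)

theorem five_b {c : Fin 5 → V} (h : CC G t 4 c) (hI : Ind G c) {x y : V} (hx : Out c x)
    (hy : Out c y) (a : G.Adj x (c 0)) (b : G.Adj x (c 2)) (d : G.Adj y (c 3)) : False := by
  have hyx : y ≠ x := by
    rintro rfl
    exact five_nc (h.rot 2) (hx.rot 2) b d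
  have e : G.Adj y (c 0) := by
    obtain ⟨j, hj, e⟩ := h.nb hI hy 3
    fin_cases j
    · exact e
    · exact (five_mid h hI hx a b hy e).elim
    · exact (five_nc (h.rot 2) (hy.rot 2) e d).elim
    · simp at hj
    · exact (five_nc (h.rot 3) (hy.rot 3) d e).elim
  have ht := h.le [x, c 2, c 1, c 0, c 4, c 3, y] (by simp [h.aj, a, a.symm, b, b.symm, d, d.symm, e, e.symm]) (by simp [h.inj.eq_iff, hx.n1, hx.n2, hy.n1, hy.n2, hyx, Ne.symm hyx])
  simp only [List.length] at ht
  have n4 : ¬ G.Adj (c 1) (c 4) := fun f =>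
    h.cf (x) [c 2, c 1, c 4, c 3, y, c 0] (by simp [h.aj, a, a.symm, b, b.symm, d, d.symm, e, e.symm, f, f.symm]) (by simp [h.inj.eq_iff, hx.n1, hx.n2, hy.n1, hy.n2, hyx, Ne.symm hyx]) (by simp) (by simp)
  refine h.cDi hI {0, 2, 3} ∅ (i0 := 0) (by decide) ?_ ?_ ?_
  · have : ({0, 2, 3} : Finset (Fin 5)).card = 3 := by decide
    rw [this]; simp; omega
  · intro z hz j hj f
    fin_cases j <;> first
      | exact absurd hj (by decide)
      | exact five_mid h hI hx a b hz f
      | exact five_mid (h.rot 3) (hI.rot 3) (hy.rot 3) d e (hz.rot 3) f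
  · intro i j hi hj hij e
    fin_cases i <;> fin_cases j <;> first
      | exact absurd hi (by decide)
      | exact absurd hj (by decide)
      | exact absurd hij (by decide)
      | exact (n4 e).elim

theorem five_a {c : Fin 5 → V} (h : CC G t 4 c) (hI : Ind G c) {x : V} (hx : Out c x)
    (a : G.Adj x (c 0)) (b : G.Adj x (c 2)) : False := by
  have n3 : ∀ y, Out c y → ¬ G.Adj y (c 3) := fun y hy d => five_b h hI hx hy a b d
  have n4 : ∀ y, Out c y → ¬ G.Adj y (c 4) := fun y hy d =>
    five_b (h.refl.rot 3) (hI.refl.rot 3) (hx.refl.rot 3) (hy.refl.rot 3) b a d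
  have m1 : ¬ G.Adj (c 1) (c 3) := fun d => h.cf (c 0) [x, c 2, c 1, c 3, c 4] (by simp [h.aj, a, a.symm, b, b.symm, d, d.symm]) (by simp [h.inj.eq_iff, hx.n1, hx.n2]) (by simp) (by simp)
  have m2 : ¬ G.Adj (c 1) (c 4) := fun d => h.cf (c 2) [x, c 0, c 1, c 4, c 3] (by simp [h.aj, a, a.symm, b, b.symm, d, d.symm]) (by simp [h.inj.eq_iff, hx.n1, hx.n2]) (by simp) (by simp)
  refine h.cDi hI {0, 2} {3, 4} (i0 := 0) (by decide) ?_ ?_ ?_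
  · have := h.lt
    have e1 : ({0, 2} : Finset (Fin 5)).card = 2 := by decide
    have e2 : ({3, 4} : Finset (Fin 5)).card = 2 := by decide
    rw [e1, e2]; omega
  · intro z hz j hj f
    fin_cases j <;> first
      | exact absurd hj (by decide)
      | exact five_mid h hI hx a b hz f
      | exact n3 z hz f
      | exact n4 z hz f
  · intro i j hi hj hij e
    fin_cases i <;> fin_cases j <;> first
      | exact absurd hi (by decide)
      | exact absurd hj (by decide)
      | exact absurd hij (by decide)
      | exact ⟨by decide, by decide⟩
      | exact (m1 e).elim
      | exact (m2 e).elim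

theorem case_five {c : Fin 5 → V} (h : CC G t 4 c) : False := by
  have hI : Ind G c := fun p q hp hq hpq => indep4 h p q hp hq hpq
  obtain ⟨x, hx⟩ := h.exOut
  obtain ⟨c', h', hI', ho, k, hk, a, b⟩ := h.two hI hx
  have hx' := (ho x).2 hx
  fin_cases k
  · simp at hk
  · exact five_nc h' hx' a b
  · exact five_a h' hI' hx' a b
  · exact five_a (h'.rot 3) (hI'.rot 3) (hx'.rot 3) b a
  · exact five_nc (h'.rot 4) (hx'.rot 4) b a

/-! ### longest cycle of length 7 -/
theorem seven_nc {c : Fin 7 → V} (h : CC G t 6 c) {x y : V} (hx : Out c x) (hy : Out c y)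
    (a : G.Adj x (c 0)) (b : G.Adj y (c 1)) : False := by
  have := h.t8
  by_cases hyx : y = x
  · subst hyx
    exact h.cf (y) [c 0, c 6, c 5, c 4, c 3, c 2, c 1] (by simp [h.aj, a, a.symm, b, b.symm]) (by simp [h.inj.eq_iff, hx.n1, hx.n2]) (by simp) (by simp)
  · exact h.pf [x, c 0, c 6, c 5, c 4, c 3, c 2, c 1, y] (by simp [h.aj, a, a.symm, b, b.symm]) (by simp [h.inj.eq_iff, hx.n1, hx.n2, hy.n1, hy.n2, hyx, Ne.symm hyx]) (by simp only [List.length]; omega)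

theorem seven_ind {c : Fin 7 → V} (h : CC G t 6 c) : Ind G c := by
  intro p q hp hq hpq
  obtain ⟨c', h, ho, x, y, j, n, h1, h2, h3, h4, h5, h6, h7, h8, ⟨z, h9, h12⟩, h10, h11⟩ :=
    h.fan3 (by omega) p q hp hq hpq
  have hx := (ho x).2 h5
  have hz := (ho z).2 h9
  have := h.t8
  have hne := h12.ne
  exact h.pf [z, x, c' 0, c' 1, c' 2, c' 3, c' 4, c' 5, c' 6] (by simp [h.aj, h12, h12.symm, h3, h3.symm]) (by simp [h.inj.eq_iff, hx.n1, hx.n2, hz.n1, hz.n2, hne, Ne.symm hne]) (by simp only [List.length]; omega)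

theorem seven_other {c : Fin 7 → V} (h : CC G t 6 c) {x : V} (hx : Out c x) (a : G.Adj x (c 0)) :
    ∃ y, Out c y ∧ y ≠ x := by
  obtain ⟨y, hy⟩ := h.nt [x, c 0, c 1, c 2, c 3, c 4, c 5, c 6] (by simp [h.aj, a])
    (by simp [h.inj.eq_iff, hx.n1, hx.n2])
  simp only [List.mem_cons, List.not_mem_nil, not_or] at hy
  refine ⟨y, ?_, hy.1⟩
  intro i
  fin_cases i <;> simp <;> tauto

open Classical in
theorem seven_L {c : Fin 7 → V} (h : CC G t 6 c) (hI : Ind G c) (b : Fin 7) (hb : b ≠ 0)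
    (hN : ∀ y, Out c y → ∀ k, G.Adj y (c k) → k = 0 ∨ k = b) : False := by
  have hN0 : ∀ y, Out c y → G.Adj y (c 0) := by
    intro y hy
    obtain ⟨j, hj, e⟩ := h.nb hI hy b
    rcases hN y hy j e with rfl | rfl
    · exact e
    · exact absurd rfl hj
  have ht : t = 8 := by have := h.t8; have := h.lt; omega
  obtain ⟨p, hp0, hpa, hpi⟩ := h.path (c 0) 8 (by omega)
  have hS := cnt p 8 hpi {c 0, c b}
  have hD := cnt p 8 hpi ((Finset.univ \ {0, b}).image c)
  have cS : ({c 0, c b} : Finset V).card ≤ 2 := Finset.card_le_two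
  have cD : ((Finset.univ \ {0, b}).image c).card ≤ 5 := by
    refine Finset.card_image_le.trans ?_
    rw [Finset.card_sdiff_of_subset (Finset.subset_univ _), Finset.card_pair hb.symm]
    simp
  have key : ∀ i, (if p i ∈ ({c 0, c b} : Finset V) then 1 else 0) +
      (if p i ∈ ((Finset.univ \ {0, b}).image c) then 1 else 0) + (if Out c (p i) then 1 else 0) = 1 := by
    intro i
    rcases out_or c (p i) with ho | ⟨k, hk⟩
    · have a1 : p i ∉ ({c 0, c b} : Finset V) := by simp [ho.n1]
      have a2 : p i ∉ ((Finset.univ \ {0, b}).image c) := by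
        simp only [Finset.mem_image, not_exists, not_and]
        intro k _ e
        exact ho k e.symm
      rw [if_neg a1, if_neg a2, if_pos ho]
    · have a3 : ¬ Out c (p i) := fun ho => ho k hk
      rw [if_neg a3, hk]
      by_cases hk' : k = 0 ∨ k = b
      · have a1 : c k ∈ ({c 0, c b} : Finset V) := by simp [h.inj.eq_iff, hk']
        have a2 : c k ∉ ((Finset.univ \ {0, b}).image c) := by
          intro hm
          obtain ⟨k', hk1, e⟩ := Finset.mem_image.1 hm
          have e' := h.inj e
          subst e'
          refine (Finset.mem_sdiff.1 hk1).2 ?_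
          rw [Finset.mem_insert, Finset.mem_singleton]
          exact hk'
        rw [if_pos a1, if_neg a2]
      · have a1 : c k ∉ ({c 0, c b} : Finset V) := by simp [h.inj.eq_iff, hk']
        have a2 : c k ∈ ((Finset.univ \ {0, b}).image c) := by
          refine Finset.mem_image_of_mem c (Finset.mem_sdiff.2 ⟨Finset.mem_univ _, ?_⟩)
          rw [Finset.mem_insert, Finset.mem_singleton]
          exact hk'
        rw [if_neg a1, if_pos a2]
  have nbS : ∀ u v, G.Adj u v → Out c u → v ∈ ({c 0, c b} : Finset V) := by
    intro u v huv hu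
    rcases out_or c v with ho | ⟨k, rfl⟩
    · exact (hI u v hu ho huv).elim
    · rcases hN u hu k huv with rfl | rfl <;> simp
  have k1 : ∀ i, i + 1 < 8 → (if Out c (p i) then 1 else 0) ≤
      (if p (i + 1) ∈ ({c 0, c b} : Finset V) then 1 else 0) := by
    intro i hi
    by_cases ho : Out c (p i)
    · rw [if_pos (nbS _ _ (hpa i hi) ho)]; split_ifs <;> omega
    · rw [if_neg ho]; omega
  have k2 : ∀ i, i + 1 < 8 → (if Out c (p (i + 1)) then 1 else 0) ≤
      (if p i ∈ ({c 0, c b} : Finset V) then 1 else 0) := by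
    intro i hi
    by_cases ho : Out c (p (i + 1))
    · rw [if_pos (nbS _ _ (hpa i hi).symm ho)]; split_ifs <;> omega
    · rw [if_neg ho]; omega
  obtain ⟨s, hs⟩ : ∃ s : ℕ → ℕ, ∀ i, s i = if p i ∈ ({c 0, c b} : Finset V) then 1 else 0 :=
    ⟨_, fun _ => rfl⟩
  obtain ⟨d, hd⟩ : ∃ s : ℕ → ℕ, ∀ i, s i = if p i ∈ ((Finset.univ \ {0, b}).image c) then 1 else 0 :=
    ⟨_, fun _ => rfl⟩
  obtain ⟨o, ho⟩ : ∃ s : ℕ → ℕ, ∀ i, s i = if Out c (p i) then 1 else 0 :=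
    ⟨_, fun _ => rfl⟩
  simp only [← hs, ← hd, ← ho, Finset.sum_range_succ, Finset.range_zero, Finset.sum_empty] at hS hD key k1 k2
  have hs0 : s 0 = 1 := by rw [hs, hp0]; simp
  have hout : ∀ i, o i = 0 → ¬ Out c (p i) := by
    intro i hi hh
    rw [ho, if_pos hh] at hi
    omega
  have hout1 : ∀ i, o i = 1 → Out c (p i) := by
    intro i hi
    by_contra hh
    rw [ho, if_neg hh] at hi
    omega
  have main : (o 1 = 1 ∧ o 0 = 0 ∧ o 2 = 0 ∧ o 3 = 0 ∧ o 4 = 0 ∧ o 5 = 0 ∧ o 6 = 0 ∧ o 7 = 0) ∨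
      o 7 = 1 := by
    have q0 := key 0; have q1 := key 1; have q2 := key 2; have q3 := key 3
    have q4 := key 4; have q5 := key 5; have q6 := key 6; have q7 := key 7
    have r0 := k1 0 (by omega); have r1 := k1 1 (by omega); have r2 := k1 2 (by omega)
    have r3 := k1 3 (by omega); have r4 := k1 4 (by omega); have r5 := k1 5 (by omega)
    have r6 := k1 6 (by omega)
    have t0 := k2 0 (by omega); have t1 := k2 1 (by omega); have t2 := k2 2 (by omega)
    have t3 := k2 3 (by omega); have t4 := k2 4 (by omega); have t5 := k2 5 (by omega)
    have t6 := k2 6 (by omega)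
    simp only [Nat.reduceAdd] at r0 r1 r2 r3 r4 r5 r6 t0 t1 t2 t3 t4 t5 t6
    omega
  have hch : (List.map p [0, 1, 2, 3, 4, 5, 6, 7]).IsChain G.Adj := by
    simp only [List.map, List.isChain_cons_cons, List.isChain_singleton, and_true]
    exact ⟨hpa 0 (by omega), hpa 1 (by omega), hpa 2 (by omega), hpa 3 (by omega),
      hpa 4 (by omega), hpa 5 (by omega), hpa 6 (by omega)⟩
  have hnd : (List.map p [0, 1, 2, 3, 4, 5, 6, 7]).Nodup := by
    refine List.Nodup.map_on ?_ (by decide)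
    intro i hi j hj e
    refine hpi i ?_ j ?_ e
    · simp at hi; omega
    · simp at hj; omega
  rcases main with hm | hm
  · obtain ⟨y, hy, hne⟩ := seven_other h (hout1 1 hm.1) (hN0 _ (hout1 1 hm.1))
    refine h.pf (y :: List.map p [0, 1, 2, 3, 4, 5, 6, 7]) ?_ ?_ (by simp; omega)
    · simp only [List.map] at hch ⊢
      rw [List.isChain_cons_cons]
      exact ⟨by rw [hp0]; exact hN0 y hy, hch⟩
    · refine List.nodup_cons.2 ⟨?_, hnd⟩
      simp only [List.mem_map, not_exists, not_and]
      intro i hi e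
      subst e
      simp at hi
      rcases hi with rfl | rfl | rfl | rfl | rfl | rfl | rfl | rfl <;>
      first
        | exact hne rfl
        | exact hout _ (by tauto) hy
  · have o7 := hN0 _ (hout1 7 hm)
    rw [← hp0] at o7
    refine h.cf (p 0) [p 1, p 2, p 3, p 4, p 5, p 6, p 7] ?_ hnd (by simp) (by simp)
    simp only [List.map, List.isChain_cons_cons, List.isChain_singleton, and_true,
      List.cons_append, List.nil_append] at hch ⊢
    tauto

theorem seven_a1 {c : Fin 7 → V} (h : CC G t 6 c) (hI : Ind G c) {x y : V} (hx : Out c x)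
    (hy : Out c y) (a : G.Adj x (c 0)) (b : G.Adj x (c 2)) (d : G.Adj y (c 4)) : False := by
  have := h.t8
  have := h.lt
  have n1 : ∀ z, Out c z → ¬ G.Adj z (c 1) := fun z hz e => seven_nc h hx hz a e
  have n3 : ∀ z, Out c z → ¬ G.Adj z (c 3) := fun z hz e => seven_nc (h.rot 2) (hx.rot 2) (hz.rot 2) b e
  have n5 : ∀ z, Out c z → ¬ G.Adj z (c 5) := fun z hz e => seven_nc (h.rot 4) (hy.rot 4) (hz.rot 4) d e
  have n6 : ∀ z, Out c z → ¬ G.Adj z (c 6) := fun z hz e => seven_nc (h.rot 6) (hz.rot 6) (hx.rot 6) e a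
  have m1 : ¬ G.Adj (c 1) (c 3) := fun e => h.cf (x) [c 2, c 1, c 3, c 4, c 5, c 6, c 0] (by simp [h.aj, a, a.symm, b, b.symm, e, e.symm]) (by simp [h.inj.eq_iff, hx.n1, hx.n2]) (by simp) (by simp)
  have m2 : ¬ G.Adj (c 1) (c 6) := fun e => h.cf (x) [c 0, c 1, c 6, c 5, c 4, c 3, c 2] (by simp [h.aj, a, a.symm, b, b.symm, e, e.symm]) (by simp [h.inj.eq_iff, hx.n1, hx.n2]) (by simp) (by simp)
  have m3 : ¬ G.Adj (c 3) (c 5) := by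
    intro e
    by_cases hyx : y = x
    · subst hyx
      exact h.cf (y) [c 2, c 1, c 0, c 6, c 5, c 3, c 4] (by simp [h.aj, a, a.symm, b, b.symm, d, d.symm, e, e.symm]) (by simp [h.inj.eq_iff, hx.n1, hx.n2]) (by simp) (by simp)
    · exact h.pf [x, c 2, c 1, c 0, c 6, c 5, c 3, c 4, y] (by simp [h.aj, a, a.symm, b, b.symm, d, d.symm, e, e.symm]) (by simp [h.inj.eq_iff, hx.n1, hx.n2, hy.n1, hy.n2, hyx, Ne.symm hyx]) (by simp only [List.length]; omega)
  have m4 : ¬ G.Adj (c 1) (c 5) := by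
    intro e
    by_cases hyx : y = x
    · subst hyx
      exact h.cf (y) [c 0, c 6, c 5, c 1, c 2, c 3, c 4] (by simp [h.aj, a, a.symm, b, b.symm, d, d.symm, e, e.symm]) (by simp [h.inj.eq_iff, hx.n1, hx.n2]) (by simp) (by simp)
    · exact h.pf [x, c 0, c 6, c 5, c 1, c 2, c 3, c 4, y] (by simp [h.aj, a, a.symm, b, b.symm, d, d.symm, e, e.symm]) (by simp [h.inj.eq_iff, hx.n1, hx.n2, hy.n1, hy.n2, hyx, Ne.symm hyx]) (by simp only [List.length]; omega)
  have m5 : ¬ G.Adj (c 3) (c 6) := by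
    intro e
    by_cases hyx : y = x
    · subst hyx
      exact h.cf (y) [c 0, c 1, c 2, c 3, c 6, c 5, c 4] (by simp [h.aj, a, a.symm, b, b.symm, d, d.symm, e, e.symm]) (by simp [h.inj.eq_iff, hx.n1, hx.n2]) (by simp) (by simp)
    · exact h.pf [x, c 0, c 1, c 2, c 3, c 6, c 5, c 4, y] (by simp [h.aj, a, a.symm, b, b.symm, d, d.symm, e, e.symm]) (by simp [h.inj.eq_iff, hx.n1, hx.n2, hy.n1, hy.n2, hyx, Ne.symm hyx]) (by simp only [List.length]; omega)
  refine h.cDi hI {0, 2, 4} {5, 6} (i0 := 0) (by decide) ?_ ?_ ?_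
  · have e1 : ({0, 2, 4} : Finset (Fin 7)).card = 3 := by decide
    have e2 : ({5, 6} : Finset (Fin 7)).card = 2 := by decide
    rw [e1, e2]; omega
  · intro z hz j hj f
    fin_cases j <;> first
      | exact absurd hj (by decide)
      | exact n1 z hz f
      | exact n3 z hz f
      | exact n5 z hz f
      | exact n6 z hz f
  · intro i j hi hj hij e
    fin_cases i <;> fin_cases j <;> first
      | exact absurd hi (by decide)
      | exact absurd hj (by decide)
      | exact absurd hij (by decide)
      | exact ⟨by decide, by decide⟩
      | exact (m1 e).elim
      | exact (m2 e).elim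
      | exact (m3 e).elim
      | exact (m4 e).elim
      | exact (m5 e).elim

theorem seven_a {c : Fin 7 → V} (h : CC G t 6 c) (hI : Ind G c) {x : V} (hx : Out c x)
    (a : G.Adj x (c 0)) (b : G.Adj x (c 2)) : False := by
  refine seven_L h hI 2 (by decide) ?_
  intro z hz k e
  fin_cases k
  · exact Or.inl rfl
  · exact (seven_nc h hx hz a e).elim
  · exact Or.inr rfl
  · exact (seven_nc (h.rot 2) (hx.rot 2) (hz.rot 2) b e).elim
  · exact (seven_a1 h hI hx hz a b e).elim
  · exact (seven_a1 (h.refl.rot 5) (hI.refl.rot 5) (hx.refl.rot 5) (hz.refl.rot 5) b a e).elim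
  · exact (seven_nc (h.rot 6) (hz.rot 6) (hx.rot 6) e a).elim

theorem seven_b {c : Fin 7 → V} (h : CC G t 6 c) (hI : Ind G c) {x : V} (hx : Out c x)
    (a : G.Adj x (c 0)) (b : G.Adj x (c 3)) : False := by
  refine seven_L h hI 3 (by decide) ?_
  intro z hz k e
  fin_cases k
  · exact Or.inl rfl
  · exact (seven_nc h hx hz a e).elim
  · exact (seven_nc (h.rot 2) (hz.rot 2) (hx.rot 2) e b).elim
  · exact Or.inr rfl
  · exact (seven_nc (h.rot 3) (hx.rot 3) (hz.rot 3) b e).elim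
  · exfalso
    obtain ⟨j, hj, f⟩ := h.nb hI hz 5
    fin_cases j
    · exact seven_a (h.rot 5) (hI.rot 5) (hz.rot 5) e f
    · exact (seven_nc h hx hz a f).elim
    · exact (seven_nc (h.rot 2) (hz.rot 2) (hx.rot 2) f b).elim
    · exact seven_a (h.rot 3) (hI.rot 3) (hz.rot 3) f e
    · exact (seven_nc (h.rot 3) (hx.rot 3) (hz.rot 3) b f).elim
    · simp at hj
    · exact (seven_nc (h.rot 6) (hz.rot 6) (hx.rot 6) f a).elim
  · exact (seven_nc (h.rot 6) (hz.rot 6) (hx.rot 6) e a).elim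

theorem case_seven {c : Fin 7 → V} (h : CC G t 6 c) : False := by
  have hI : Ind G c := seven_ind h
  obtain ⟨x, hx⟩ := h.exOut
  obtain ⟨c', h', hI', ho, k, hk, a, b⟩ := h.two hI hx
  have hx' := (ho x).2 hx
  fin_cases k
  · simp at hk
  · exact seven_nc h' hx' hx' a b
  · exact seven_a h' hI' hx' a b
  · exact seven_b h' hI' hx' a b
  · exact seven_b (h'.rot 4) (hI'.rot 4) (hx'.rot 4) b a
  · exact seven_a (h'.rot 5) (hI'.rot 5) (hx'.rot 5) b a
  · exact seven_nc (h'.rot 6) (hx'.rot 6) (hx'.rot 6) b a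
end

section
variable {V : Type*} {G : SimpleGraph V} {t m : ℕ} {c : Fin (m + 1) → V}

open Classical in
theorem CC.c4i (h : CC G t m c) (hI : Ind G c) (S : Finset (Fin (m + 1))) {i0 : Fin (m + 1)}
    (h0 : i0 ∈ S) (hS : S.card ≤ 4) (ht : 8 ≤ t)
    (hN : ∀ y, Out c y → ∀ j, j ∉ S → ¬ G.Adj y (c j))
    (hE : ∀ i j, i ∉ S → j ∉ S → i < j → ¬ G.Adj (c i) (c j)) :
    ∃ o j o' k, j ∈ S ∧ k ∈ S ∧ (∀ i ∈ S, o ≠ c i) ∧ (∀ i ∈ S, o' ≠ c i) ∧ j ≠ i0 ∧ k ≠ i0 ∧ j ≠ k ∧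
      G.Adj o (c i0) ∧ G.Adj o (c j) ∧ G.Adj o' (c j) ∧ G.Adj o' (c k) := by
  obtain ⟨o, s1, o', s2, hs1, hs2, ho, ho', n1, n2, n3, e1, e2, e3, e4⟩ :=
    h.c4 (c i0) (S.image c) (Finset.mem_image_of_mem c h0) (Finset.card_image_le.trans hS) ht (by
      intro u v huv hu hv
      obtain ⟨i, j, rfl, rfl, hi, hj⟩ := h.edC hI S hN u v huv hu hv
      rcases lt_trichotomy i j with hij | hij | hij
      · exact hE i j hi hj hij huv
      · subst hij; exact huv.ne rfl
      · exact hE j i hj hi hij huv.symm)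
  obtain ⟨j, hj, rfl⟩ := Finset.mem_image.1 hs1
  obtain ⟨k, hk, rfl⟩ := Finset.mem_image.1 hs2
  refine ⟨o, j, o', k, hj, hk, ?_, ?_, fun e => n1 (by rw [e]), fun e => n2 (by rw [e]),
    fun e => n3 (by rw [e]), e1.symm, e2, e3.symm, e4⟩
  · rintro i hi rfl
    exact ho (Finset.mem_image_of_mem c hi)
  · rintro i hi rfl
    exact ho' (Finset.mem_image_of_mem c hi)
end

section
variable {V : Type*} {G : SimpleGraph V} {t : ℕ}

theorem fin6 (j : Fin 6) : j = 0 ∨ j = 1 ∨ j = 2 ∨ j = 3 ∨ j = 4 ∨ j = 5 := by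
  revert j; decide

/-! ### longest cycle of length 6 -/
theorem six_nc {c : Fin 6 → V} (h : CC G t 5 c) {x : V} (hx : Out c x) (a : G.Adj x (c 0))
    (b : G.Adj x (c 1)) : False :=
  h.cf (x) [c 0, c 5, c 4, c 3, c 2, c 1] (by simp [h.aj, a, a.symm, b, b.symm]) (by simp [h.inj.eq_iff, hx.n1, hx.n2]) (by simp) (by simp)

theorem six_mid {c : Fin 6 → V} (h : CC G t 5 c) (hI : Ind G c) {x : V} (hx : Out c x)
    (a : G.Adj x (c 0)) (b : G.Adj x (c 2)) {y : V} (hy : Out c y) (d : G.Adj y (c 1)) : False := by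
  by_cases hyx : y = x
  · subst hyx
    exact six_nc h hy a d
  obtain ⟨j, hj, e⟩ := h.nb hI hy 1
  rcases fin6 j with rfl | rfl | rfl | rfl | rfl | rfl
  · exact six_nc h hy e d
  · exact hj rfl
  · exact six_nc (h.rot 1) (hy.rot 1) d e
  · exact h.cf (c 0) [x, c 2, c 1, y, c 3, c 4, c 5] (by simp [h.aj, a, a.symm, b, b.symm, d, d.symm, e, e.symm]) (by simp [h.inj.eq_iff, hx.n1, hx.n2, hy.n1, hy.n2, hyx, Ne.symm hyx]) (by simp) (by simp)
  · exact h.cf (c 0) [x, c 2, c 3, c 4, y, c 1] (by simp [h.aj, a, a.symm, b, b.symm, d, d.symm, e, e.symm]) (by simp [h.inj.eq_iff, hx.n1, hx.n2, hy.n1, hy.n2, hyx, Ne.symm hyx]) (by simp) (by simp)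
  · exact h.cf (c 2) [x, c 0, c 1, y, c 5, c 4, c 3] (by simp [h.aj, a, a.symm, b, b.symm, d, d.symm, e, e.symm]) (by simp [h.inj.eq_iff, hx.n1, hx.n2, hy.n1, hy.n2, hyx, Ne.symm hyx]) (by simp) (by simp)

theorem six_ch1 {c : Fin 6 → V} (h : CC G t 5 c) {x : V} (hx : Out c x)
    (a : G.Adj x (c 0)) (b : G.Adj x (c 2)) : ¬ G.Adj (c 1) (c 3) := fun d =>
  h.cf (c 0) [x, c 2, c 1, c 3, c 4, c 5] (by simp [h.aj, a, a.symm, b, b.symm, d, d.symm]) (by simp [h.inj.eq_iff, hx.n1, hx.n2]) (by simp) (by simp)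

theorem six_ch2 {c : Fin 6 → V} (h : CC G t 5 c) {x : V} (hx : Out c x)
    (a : G.Adj x (c 0)) (b : G.Adj x (c 2)) : ¬ G.Adj (c 1) (c 5) := fun d =>
  h.cf (c 2) [x, c 0, c 1, c 5, c 4, c 3] (by simp [h.aj, a, a.symm, b, b.symm, d, d.symm]) (by simp [h.inj.eq_iff, hx.n1, hx.n2]) (by simp) (by simp)

theorem six_b1 {c : Fin 6 → V} (h : CC G t 5 c) (hI : Ind G c) {x y : V} (hx : Out c x)
    (hy : Out c y) (a : G.Adj x (c 0)) (b : G.Adj x (c 2)) (d : G.Adj y (c 3))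
    (e : G.Adj y (c 5)) : False := by
  have hyx : y ≠ x := by
    rintro rfl
    exact six_nc (h.rot 2) (hx.rot 2) b d
  have ht := h.le [x, c 2, c 1, c 0, c 5, c 4, c 3, y] (by simp [h.aj, a, a.symm, b, b.symm, d, d.symm, e, e.symm]) (by simp [h.inj.eq_iff, hx.n1, hx.n2, hy.n1, hy.n2, hyx, Ne.symm hyx])
  simp only [List.length] at ht
  have t8 := h.t8
  have n1 : ∀ z, Out c z → ¬ G.Adj z (c 1) := fun z hz f => six_mid h hI hx a b hz f
  have n4 : ∀ z, Out c z → ¬ G.Adj z (c 4) := fun z hz f =>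
    six_mid (h.rot 3) (hI.rot 3) (hy.rot 3) d e (hz.rot 3) f
  have m13 := six_ch1 h hx a b
  have m15 := six_ch2 h hx a b
  have m40 : ¬ G.Adj (c 4) (c 0) := six_ch1 (h.rot 3) (hy.rot 3) d e
  have m42 : ¬ G.Adj (c 4) (c 2) := six_ch2 (h.rot 3) (hy.rot 3) d e
  have m14 : ¬ G.Adj (c 1) (c 4) := fun f => h.cf (c 0) [x, c 2, c 3, y, c 5, c 4, c 1] (by simp [h.aj, a, a.symm, b, b.symm, d, d.symm, e, e.symm, f, f.symm]) (by simp [h.inj.eq_iff, hx.n1, hx.n2, hy.n1, hy.n2, hyx, Ne.symm hyx]) (by simp) (by simp)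
  obtain ⟨o, j, o', k, hj, hk, ho, ho', hj0, hk0, hjk, e1, e2, e3, e4⟩ :=
    h.c4i hI {0, 2, 3, 5} (i0 := 0) (by decide) (by decide) (by omega) (by
      intro z hz j hj f
      rcases fin6 j with rfl | rfl | rfl | rfl | rfl | rfl <;> first
        | exact absurd hj (by decide)
        | exact n1 z hz f
        | exact n4 z hz f) (by
      intro i j hi hj hij f
      rcases fin6 i with rfl | rfl | rfl | rfl | rfl | rfl <;> first
        | exact absurd hi (by decide)
        | (rcases fin6 j with rfl | rfl | rfl | rfl | rfl | rfl <;> first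
            | exact absurd hj (by decide)
            | exact absurd hij (by decide)
            | exact m14 f))
  have K : ∀ z, (∀ i ∈ ({0, 2, 3, 5} : Finset (Fin 6)), z ≠ c i) → (G.Adj z (c 0) ∨ G.Adj z (c 2)) →
      (G.Adj z (c 3) ∨ G.Adj z (c 5)) → False := by
    intro z hz f g
    rcases out_or c z with oz | ⟨i, rfl⟩
    · rcases f with f | f <;> rcases g with g | g
      · have zx : z ≠ x := by
          rintro rfl
          exact six_nc (h.rot 2) (oz.rot 2) b g
        have zy : z ≠ y := by
          rintro rfl
          exact six_nc (h.rot 5) (oz.rot 5) e f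
        exact h.pf [c 1, c 2, x, c 0, z, c 3, y, c 5, c 4] (by simp [h.aj, a, a.symm, b, b.symm, d, d.symm, e, e.symm, f, f.symm, g, g.symm]) (by simp [h.inj.eq_iff, hx.n1, hx.n2, hy.n1, hy.n2, oz.n1, oz.n2, hyx, Ne.symm hyx, zx, Ne.symm zx, zy, Ne.symm zy]) (by simp only [List.length]; omega)
      · exact six_nc (h.rot 5) (oz.rot 5) g f
      · exact six_nc (h.rot 2) (oz.rot 2) f g
      · have zx : z ≠ x := by
          rintro rfl
          exact six_nc (h.rot 5) (oz.rot 5) g a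
        have zy : z ≠ y := by
          rintro rfl
          exact six_nc (h.rot 2) (oz.rot 2) f d
        exact h.pf [c 1, c 0, x, c 2, z, c 5, y, c 3, c 4] (by simp [h.aj, a, a.symm, b, b.symm, d, d.symm, e, e.symm, f, f.symm, g, g.symm]) (by simp [h.inj.eq_iff, hx.n1, hx.n2, hy.n1, hy.n2, oz.n1, oz.n2, hyx, Ne.symm hyx, zx, Ne.symm zx, zy, Ne.symm zy]) (by simp only [List.length]; omega)
    · rcases fin6 i with rfl | rfl | rfl | rfl | rfl | rfl
      · exact hz 0 (by decide) rfl
      · exact g.elim m13 m15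
      · exact hz 2 (by decide) rfl
      · exact hz 3 (by decide) rfl
      · exact f.elim m40 m42
      · exact hz 5 (by decide) rfl
  rcases fin6 j with rfl | rfl | rfl | rfl | rfl | rfl
  · exact hj0 rfl
  · exact absurd hj (by decide)
  · rcases fin6 k with rfl | rfl | rfl | rfl | rfl | rfl
    · exact hk0 rfl
    · exact absurd hk (by decide)
    · exact hjk rfl
    · exact K o' ho' (Or.inr e3) (Or.inl e4)
    · exact absurd hk (by decide)
    · exact K o' ho' (Or.inr e3) (Or.inr e4)
  · exact K o ho (Or.inl e1) (Or.inl e2)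
  · exact absurd hj (by decide)
  · exact K o ho (Or.inl e1) (Or.inr e2)

theorem six_b2 {c : Fin 6 → V} (h : CC G t 5 c) (hI : Ind G c) {x y : V} (hx : Out c x)
    (hy : Out c y) (a : G.Adj x (c 0)) (b : G.Adj x (c 2)) (d : G.Adj y (c 3))
    (e : G.Adj y (c 0)) (hz35 : ∀ z, Out c z → G.Adj z (c 3) → ¬ G.Adj z (c 5)) : False := by
  have hyx : y ≠ x := by
    rintro rfl
    exact six_nc (h.rot 2) (hx.rot 2) b d
  have ht := h.le [x, c 2, c 1, c 0, c 5, c 4, c 3, y] (by simp [h.aj, a, a.symm, b, b.symm, d, d.symm, e, e.symm]) (by simp [h.inj.eq_iff, hx.n1, hx.n2, hy.n1, hy.n2, hyx, Ne.symm hyx])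
  simp only [List.length] at ht
  have t8 := h.t8
  have n1 : ∀ z, Out c z → ¬ G.Adj z (c 1) := fun z hz f => six_mid h hI hx a b hz f
  have n5 : ∀ z, Out c z → ¬ G.Adj z (c 5) := by
    intro z hz f
    obtain ⟨j, hj, g⟩ := h.nb hI hz 5
    rcases fin6 j with rfl | rfl | rfl | rfl | rfl | rfl
    · exact six_nc (h.rot 5) (hz.rot 5) f g
    · exact n1 z hz g
    · have zy : z ≠ y := by
        rintro rfl
        exact six_nc (h.rot 2) (hz.rot 2) g d
      exact h.cf (c 0) [y, c 3, c 4, c 5, z, c 2, c 1] (by simp [h.aj, d, d.symm, e, e.symm, f, f.symm, g, g.symm]) (by simp [h.inj.eq_iff, hy.n1, hy.n2, hz.n1, hz.n2, zy, Ne.symm zy]) (by simp) (by simp)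
    · exact hz35 z hz g f
    · exact six_nc (h.rot 4) (hz.rot 4) g f
    · exact hj rfl
  have n24 : ∀ z, Out c z → G.Adj z (c 2) → ¬ G.Adj z (c 4) := fun z hz f g =>
    six_mid (h.rot 2) (hI.rot 2) (hz.rot 2) f g (hy.rot 2) d
  have m13 := six_ch1 h hx a b
  have m15 := six_ch2 h hx a b
  have m14 : ¬ G.Adj (c 1) (c 4) := fun f => h.cf (y) [c 3, c 2, c 1, c 4, c 5, c 0] (by simp [h.aj, d, d.symm, e, e.symm, f, f.symm]) (by simp [h.inj.eq_iff, hy.n1, hy.n2]) (by simp) (by simp)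
  have m52 : ¬ G.Adj (c 5) (c 2) := fun f => h.cf (c 0) [y, c 3, c 4, c 5, c 2, c 1] (by simp [h.aj, d, d.symm, e, e.symm, f, f.symm]) (by simp [h.inj.eq_iff, hy.n1, hy.n2]) (by simp) (by simp)
  by_cases hz4 : ∃ z, Out c z ∧ G.Adj z (c 4)
  · obtain ⟨z, hz, f⟩ := hz4
    have g : G.Adj z (c 0) := by
      obtain ⟨j, hj, g⟩ := h.nb hI hz 4
      rcases fin6 j with rfl | rfl | rfl | rfl | rfl | rfl
      · exact g
      · exact (n1 z hz g).elim
      · exact (n24 z hz g f).elim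
      · exact (six_nc (h.rot 3) (hz.rot 3) g f).elim
      · exact (hj rfl).elim
      · exact (n5 z hz g).elim
    have m53 : ¬ G.Adj (c 5) (c 3) := fun k => h.cf (c 0) [z, c 4, c 5, c 3, c 2, c 1] (by simp [h.aj, f, f.symm, g, g.symm, k, k.symm]) (by simp [h.inj.eq_iff, hz.n1, hz.n2]) (by simp) (by simp)
    obtain ⟨o, j, o', k, hj, hk, ho, ho', hj0, hk0, hjk, e1, e2, e3, e4⟩ :=
      h.c4i hI {0, 2, 3, 4} (i0 := 0) (by decide) (by decide) (by omega) (by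
        intro z hz j hj f
        rcases fin6 j with rfl | rfl | rfl | rfl | rfl | rfl <;> first
          | exact absurd hj (by decide)
          | exact n1 z hz f
          | exact n5 z hz f) (by
        intro i j hi hj hij f
        rcases fin6 i with rfl | rfl | rfl | rfl | rfl | rfl <;> first
          | exact absurd hi (by decide)
          | (rcases fin6 j with rfl | rfl | rfl | rfl | rfl | rfl <;> first
              | exact absurd hj (by decide)
              | exact absurd hij (by decide)
              | exact m15 f))
    have K : ∀ w, (∀ i ∈ ({0, 2, 3, 4} : Finset (Fin 6)), w ≠ c i) →
        ¬ (G.Adj w (c 2) ∧ G.Adj w (c 3)) ∧ ¬ (G.Adj w (c 3) ∧ G.Adj w (c 4)) ∧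
        ¬ (G.Adj w (c 2) ∧ G.Adj w (c 4)) := by
      intro w hw
      rcases out_or c w with ow | ⟨i, rfl⟩
      · exact ⟨fun p => six_nc (h.rot 2) (ow.rot 2) p.1 p.2, fun p => six_nc (h.rot 3) (ow.rot 3) p.1 p.2,
          fun p => n24 w ow p.1 p.2⟩
      · rcases fin6 i with rfl | rfl | rfl | rfl | rfl | rfl
        · exact (hw 0 (by decide) rfl).elim
        · exact ⟨fun p => m13 p.2, fun p => m13 p.1, fun p => m14 p.2⟩
        · exact (hw 2 (by decide) rfl).elim
        · exact (hw 3 (by decide) rfl).elim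
        · exact (hw 4 (by decide) rfl).elim
        · exact ⟨fun p => m52 p.1, fun p => m53 p.1, fun p => m52 p.1⟩
    obtain ⟨k1, k2, k3⟩ := K o' ho'
    rcases fin6 j with rfl | rfl | rfl | rfl | rfl | rfl <;> first
      | exact absurd hj (by decide)
      | exact hj0 rfl
      | (rcases fin6 k with rfl | rfl | rfl | rfl | rfl | rfl <;> first
          | exact absurd hk (by decide)
          | exact hk0 rfl
          | exact hjk rfl
          | exact k1 ⟨e3, e4⟩
          | exact k1 ⟨e4, e3⟩
          | exact k2 ⟨e3, e4⟩
          | exact k2 ⟨e4, e3⟩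
          | exact k3 ⟨e3, e4⟩
          | exact k3 ⟨e4, e3⟩)
  · push Not at hz4
    refine h.cDi hI {0, 2, 3} {4, 5} (i0 := 0) (by decide) ?_ ?_ ?_
    · have e1 : ({0, 2, 3} : Finset (Fin 6)).card = 3 := by decide
      have e2 : ({4, 5} : Finset (Fin 6)).card = 2 := by decide
      rw [e1, e2]; omega
    · intro z hz j hj f
      rcases fin6 j with rfl | rfl | rfl | rfl | rfl | rfl <;> first
        | exact absurd hj (by decide)
        | exact n1 z hz f
        | exact hz4 z hz f
        | exact n5 z hz f
    · intro i j hi hj hij f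
      rcases fin6 i with rfl | rfl | rfl | rfl | rfl | rfl <;> first
        | exact absurd hi (by decide)
        | (rcases fin6 j with rfl | rfl | rfl | rfl | rfl | rfl <;> first
            | exact absurd hj (by decide)
            | exact absurd hij (by decide)
            | exact ⟨by decide, by decide⟩
            | exact (m14 f).elim
            | exact (m15 f).elim)

theorem six_ab {c : Fin 6 → V} (h : CC G t 5 c) (hI : Ind G c) {x y : V} (hx : Out c x)
    (hy : Out c y) (a : G.Adj x (c 0)) (b : G.Adj x (c 2)) (d : G.Adj y (c 3)) : False := by
  by_cases hz : ∃ z, Out c z ∧ G.Adj z (c 3) ∧ G.Adj z (c 5)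
  · obtain ⟨z, hz, f, g⟩ := hz
    exact six_b1 h hI hx hz a b f g
  · push Not at hz
    obtain ⟨j, hj, e⟩ := h.nb hI hy 3
    rcases fin6 j with rfl | rfl | rfl | rfl | rfl | rfl
    · exact six_b2 h hI hx hy a b d e hz
    · exact six_mid h hI hx a b hy e
    · exact six_nc (h.rot 2) (hy.rot 2) e d
    · exact hj rfl
    · exact six_nc (h.rot 3) (hy.rot 3) d e
    · exact hz y hy d e

theorem six_other {c : Fin 6 → V} (h : CC G t 5 c) {x : V} (hx : Out c x) (a : G.Adj x (c 0)) :
    ∃ y, Out c y ∧ y ≠ x := by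
  obtain ⟨y, hy⟩ := h.nt [x, c 0, c 1, c 2, c 3, c 4, c 5] (by simp [h.aj, a])
    (by simp [h.inj.eq_iff, hx.n1, hx.n2])
  simp only [List.mem_cons, List.not_mem_nil, not_or] at hy
  refine ⟨y, ?_, hy.1⟩
  intro i
  rcases fin6 i with rfl | rfl | rfl | rfl | rfl | rfl <;> tauto

theorem six_a {c : Fin 6 → V} (h : CC G t 5 c) (hI : Ind G c) {x : V} (hx : Out c x)
    (a : G.Adj x (c 0)) (b : G.Adj x (c 2)) : False := by
  have n1 : ∀ z, Out c z → ¬ G.Adj z (c 1) := fun z hz f => six_mid h hI hx a b hz f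
  have n3 : ∀ z, Out c z → ¬ G.Adj z (c 3) := fun z hz f => six_ab h hI hx hz a b f
  have n5 : ∀ z, Out c z → ¬ G.Adj z (c 5) := fun z hz f =>
    six_ab (h.refl.rot 4) (hI.refl.rot 4) (hx.refl.rot 4) (hz.refl.rot 4) b a f
  have m13 := six_ch1 h hx a b
  have m15 := six_ch2 h hx a b
  have t7 := h.lt
  have t8 := h.t8
  have cS : ({0, 2, 4} : Finset (Fin 6)).card = 3 := by decide
  have nb : ∀ z, Out c z → ∀ j, j ∉ ({0, 2, 4} : Finset (Fin 6)) → ¬ G.Adj z (c j) := by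
    intro z hz j hj f
    rcases fin6 j with rfl | rfl | rfl | rfl | rfl | rfl <;> first
      | exact absurd hj (by decide)
      | exact n1 z hz f
      | exact n3 z hz f
      | exact n5 z hz f
  by_cases m35 : G.Adj (c 3) (c 5)
  · by_cases ht : t = 8
    · refine h.cDi hI {0, 2, 4} {3, 5} (i0 := 0) (by decide) ?_ nb ?_
      · have e2 : ({3, 5} : Finset (Fin 6)).card = 2 := by decide
        rw [cS, e2]; omega
      · intro i j hi hj hij f
        rcases fin6 i with rfl | rfl | rfl | rfl | rfl | rfl <;> first
          | exact absurd hi (by decide)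
          | (rcases fin6 j with rfl | rfl | rfl | rfl | rfl | rfl <;> first
              | exact absurd hj (by decide)
              | exact absurd hij (by decide)
              | exact ⟨by decide, by decide⟩
              | exact (m13 f).elim
              | exact (m15 f).elim)
    · have n4 : ∀ z, Out c z → ¬ G.Adj z (c 4) := by
        intro y hy f
        by_cases hyx : y = x
        · subst hyx
          exact h.cf (y) [c 2, c 1, c 0, c 5, c 3, c 4] (by simp [h.aj, b, b.symm, f, f.symm, m35, m35.symm]) (by simp [h.inj.eq_iff, hx.n1, hx.n2]) (by simp) (by simp)
        · exact h.pf [x, c 2, c 1, c 0, c 5, c 3, c 4, y] (by simp [h.aj, b, b.symm, f, f.symm, m35, m35.symm]) (by simp [h.inj.eq_iff, hx.n1, hx.n2, hy.n1, hy.n2, hyx, Ne.symm hyx]) (by simp only [List.length]; omega)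
      obtain ⟨y, hy, hyx⟩ := six_other h hx a
      have d : G.Adj y (c 0) := by
        obtain ⟨j, hj, g⟩ := h.nb hI hy 2
        rcases fin6 j with rfl | rfl | rfl | rfl | rfl | rfl
        · exact g
        · exact (n1 y hy g).elim
        · exact (hj rfl).elim
        · exact (n3 y hy g).elim
        · exact (n4 y hy g).elim
        · exact (n5 y hy g).elim
      have m14 : ¬ G.Adj (c 1) (c 4) := fun f =>
        h.pf [y, c 0, x, c 2, c 1, c 4, c 3, c 5] (by simp [h.aj, a, a.symm, b, b.symm, d, d.symm, f, f.symm, m35, m35.symm]) (by simp [h.inj.eq_iff, hx.n1, hx.n2, hy.n1, hy.n2, hyx, Ne.symm hyx]) (by simp only [List.length]; omega)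
      refine h.cDi hI {0, 2} {3, 4, 5} (i0 := 0) (by decide) ?_ ?_ ?_
      · have e1 : ({0, 2} : Finset (Fin 6)).card = 2 := by decide
        have e2 : ({3, 4, 5} : Finset (Fin 6)).card = 3 := by decide
        rw [e1, e2]; omega
      · intro z hz j hj f
        rcases fin6 j with rfl | rfl | rfl | rfl | rfl | rfl <;> first
          | exact absurd hj (by decide)
          | exact n1 z hz f
          | exact n3 z hz f
          | exact n4 z hz f
          | exact n5 z hz f
      · intro i j hi hj hij f
        rcases fin6 i with rfl | rfl | rfl | rfl | rfl | rfl <;> first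
          | exact absurd hi (by decide)
          | (rcases fin6 j with rfl | rfl | rfl | rfl | rfl | rfl <;> first
              | exact absurd hj (by decide)
              | exact absurd hij (by decide)
              | exact ⟨by decide, by decide⟩
              | exact (m13 f).elim
              | exact (m14 f).elim
              | exact (m15 f).elim)
  · refine h.cDi hI {0, 2, 4} ∅ (i0 := 0) (by decide) ?_ nb ?_
    · rw [cS]; simp; omega
    · intro i j hi hj hij f
      rcases fin6 i with rfl | rfl | rfl | rfl | rfl | rfl <;> first
        | exact absurd hi (by decide)
        | (rcases fin6 j with rfl | rfl | rfl | rfl | rfl | rfl <;> first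
            | exact absurd hj (by decide)
            | exact absurd hij (by decide)
            | exact (m13 f).elim
            | exact (m15 f).elim
            | exact (m35 f).elim)

theorem six_bn {c : Fin 6 → V} (h : CC G t 5 c) (hI : Ind G c) {x y : V} (hx : Out c x)
    (hy : Out c y) (a : G.Adj x (c 0)) (b : G.Adj x (c 3)) (d : G.Adj y (c 1)) : False := by
  obtain ⟨j, hj, e⟩ := h.nb hI hy 1
  rcases fin6 j with rfl | rfl | rfl | rfl | rfl | rfl
  · exact six_nc h hy e d
  · exact hj rfl
  · exact six_nc (h.rot 1) (hy.rot 1) d e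
  · exact six_a (h.rot 1) (hI.rot 1) (hy.rot 1) d e
  · have hyx : y ≠ x := by
      rintro rfl
      exact six_nc h hx a d
    exact h.cf (c 0) [x, c 3, c 2, c 1, y, c 4, c 5] (by simp [h.aj, a, a.symm, b, b.symm, d, d.symm, e, e.symm]) (by simp [h.inj.eq_iff, hx.n1, hx.n2, hy.n1, hy.n2, hyx, Ne.symm hyx]) (by simp) (by simp)
  · exact six_a (h.rot 5) (hI.rot 5) (hy.rot 5) e d

/-- the only edges among `c 1, c 2, c 4, c 5` are the cycle edges -/
theorem six_E {c : Fin 6 → V} (m14 : ¬ G.Adj (c 1) (c 4)) (m25 : ¬ G.Adj (c 2) (c 5))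
    (m15 : ¬ G.Adj (c 1) (c 5)) (m24 : ¬ G.Adj (c 2) (c 4)) (i j : Fin 6)
    (hi : i ≠ 0 ∧ i ≠ 3) (hj : j ≠ 0 ∧ j ≠ 3) (e : G.Adj (c i) (c j)) :
    (i = 1 ∧ j = 2) ∨ (i = 2 ∧ j = 1) ∨ (i = 4 ∧ j = 5) ∨ (i = 5 ∧ j = 4) := by
  rcases fin6 i with rfl | rfl | rfl | rfl | rfl | rfl <;> first
    | exact absurd hi (by decide)
    | (rcases fin6 j with rfl | rfl | rfl | rfl | rfl | rfl <;> first
        | exact absurd hj (by decide)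
        | exact absurd rfl e.ne
        | decide
        | exact absurd e m14
        | exact absurd e.symm m14
        | exact absurd e m25
        | exact absurd e.symm m25
        | exact absurd e m15
        | exact absurd e.symm m15
        | exact absurd e m24
        | exact absurd e.symm m24)

/-- final count for `S = {c 0, c 3}` -/
theorem six_fin {c : Fin 6 → V} (h : CC G t 5 c)
    (m14 : ¬ G.Adj (c 1) (c 4)) (m25 : ¬ G.Adj (c 2) (c 5))
    (m15 : ¬ G.Adj (c 1) (c 5)) (m24 : ¬ G.Adj (c 2) (c 4))
    (hN : ∀ y, Out c y → ∀ j, G.Adj y (c j) → j = 0 ∨ j = 3)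
    (hU : ∀ u v w, Out c u → Out c v → Out c w → G.Adj u v → G.Adj v w → u = w) : False := by
  classical
  refine h.c3 (c 0) {c 0, c 3} (by simp) Finset.card_le_two h.lt ?_
  intro u v w huv hvw huw hu hv hw
  simp only [Finset.mem_insert, Finset.mem_singleton, not_or] at hu hv hw
  have K : ∀ y j, Out c y → G.Adj y (c j) → (c j ≠ c 0 ∧ c j ≠ c 3) → False := by
    intro y j hy f g
    rcases hN y hy j f with rfl | rfl
    · exact g.1 rfl
    · exact g.2 rfl
  have I : ∀ j, (c j ≠ c 0 ∧ c j ≠ c 3) → j ≠ 0 ∧ j ≠ 3 := fun j g =>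
    ⟨fun e => g.1 (by rw [e]), fun e => g.2 (by rw [e])⟩
  rcases out_or c v with ov | ⟨j, rfl⟩
  · rcases out_or c u with ou | ⟨i, rfl⟩
    · rcases out_or c w with ow | ⟨k, rfl⟩
      · exact huw (hU u v w ou ov ow huv hvw)
      · exact K v k ov hvw hw
    · exact K v i ov huv.symm hu
  · rcases out_or c u with ou | ⟨i, rfl⟩
    · exact K u j ou huv hv
    · rcases out_or c w with ow | ⟨k, rfl⟩
      · exact K w j ow hvw.symm hv
      · have h1 := six_E m14 m25 m15 m24 i j (I i hu) (I j hv) huv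
        have h2 := six_E m14 m25 m15 m24 j k (I j hv) (I k hw) hvw
        apply huw
        congr 1
        revert h1 h2
        clear * -
        revert i j k
        decide

theorem six_b {c : Fin 6 → V} (h : CC G t 5 c) (hI : Ind G c) {x : V} (hx : Out c x)
    (a : G.Adj x (c 0)) (b : G.Adj x (c 3)) : False := by
  have n1 : ∀ z, Out c z → ¬ G.Adj z (c 1) := fun z hz f => six_bn h hI hx hz a b f
  have n4 : ∀ z, Out c z → ¬ G.Adj z (c 4) := fun z hz f =>
    six_bn (h.rot 3) (hI.rot 3) (hx.rot 3) (hz.rot 3) b a f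
  have n5 : ∀ z, Out c z → ¬ G.Adj z (c 5) := fun z hz f =>
    six_bn h.refl hI.refl hx.refl hz.refl a b f
  have n2 : ∀ z, Out c z → ¬ G.Adj z (c 2) := fun z hz f =>
    six_bn (h.refl.rot 3) (hI.refl.rot 3) (hx.refl.rot 3) (hz.refl.rot 3) b a f
  have hN : ∀ y, Out c y → ∀ j, G.Adj y (c j) → j = 0 ∨ j = 3 := by
    intro y hy j f
    rcases fin6 j with rfl | rfl | rfl | rfl | rfl | rfl
    · exact Or.inl rfl
    · exact (n1 y hy f).elim
    · exact (n2 y hy f).elim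
    · exact Or.inr rfl
    · exact (n4 y hy f).elim
    · exact (n5 y hy f).elim
  have m14 : ¬ G.Adj (c 1) (c 4) := fun f => h.cf (c 0) [x, c 3, c 2, c 1, c 4, c 5] (by simp [h.aj, a, a.symm, b, b.symm, f, f.symm]) (by simp [h.inj.eq_iff, hx.n1, hx.n2]) (by simp) (by simp)
  have m25 : ¬ G.Adj (c 2) (c 5) := fun f => h.cf (c 0) [x, c 3, c 4, c 5, c 2, c 1] (by simp [h.aj, a, a.symm, b, b.symm, f, f.symm]) (by simp [h.inj.eq_iff, hx.n1, hx.n2]) (by simp) (by simp)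
  obtain ⟨y, hy, hyx⟩ := six_other h hx a
  have d : G.Adj y (c 0) := by
    obtain ⟨j, hj, g⟩ := h.nb hI hy 3
    rcases hN y hy j g with rfl | rfl
    · exact g
    · exact (hj rfl).elim
  have e : G.Adj y (c 3) := by
    obtain ⟨j, hj, g⟩ := h.nb hI hy 0
    rcases hN y hy j g with rfl | rfl
    · exact (hj rfl).elim
    · exact g
  have t8 := h.t8
  by_cases hch : G.Adj (c 1) (c 5) ∨ G.Adj (c 2) (c 4)
  · have ht : 8 ≤ t := by
      rcases hch with f | f
      · exact h.le [y, c 0, x, c 3, c 2, c 1, c 5, c 4] (by simp [h.aj, a, a.symm, b, b.symm, d, d.symm, f, f.symm]) (by simp [h.inj.eq_iff, hx.n1, hx.n2, hy.n1, hy.n2, hyx, Ne.symm hyx])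
      · exact h.le [y, c 3, x, c 0, c 1, c 2, c 4, c 5] (by simp [h.aj, a, a.symm, b, b.symm, e, e.symm, f, f.symm]) (by simp [h.inj.eq_iff, hx.n1, hx.n2, hy.n1, hy.n2, hyx, Ne.symm hyx])
    refine h.cDi hI {0, 3} {1, 2, 4, 5} (i0 := 0) (by decide) ?_ ?_ ?_
    · have e1 : ({0, 3} : Finset (Fin 6)).card = 2 := by decide
      have e2 : ({1, 2, 4, 5} : Finset (Fin 6)).card = 4 := by decide
      rw [e1, e2]; omega
    · intro z hz j hj f
      rcases hN z hz j f with rfl | rfl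
      · exact absurd hj (by decide)
      · exact absurd hj (by decide)
    · intro i j hi hj _ _
      revert hi hj
      clear * -
      revert i j
      decide
  · push Not at hch
    exact six_fin h m14 m25 hch.1 hch.2 hN (fun u v w hu hv _ huv _ => (hI u v hu hv huv).elim)

theorem six_ind {c : Fin 6 → V} (h : CC G t 5 c) (hI : Ind G c) : False := by
  obtain ⟨x, hx⟩ := h.exOut
  obtain ⟨c', h', hI', ho, k, hk, a, b⟩ := h.two hI hx
  have hx' := (ho x).2 hx
  rcases fin6 k with rfl | rfl | rfl | rfl | rfl | rfl
  · exact hk rfl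
  · exact six_nc h' hx' a b
  · exact six_a h' hI' hx' a b
  · exact six_b h' hI' hx' a b
  · exact six_a (h'.rot 4) (hI'.rot 4) (hx'.rot 4) b a
  · exact six_nc (h'.rot 5) (hx'.rot 5) b a

theorem six_pairX {c : Fin 6 → V} (h : CC G t 5 c) {p q : V} (hp : Out c p) (hq : Out c q)
    (hpq : G.Adj p q) : ∃ c' : Fin 6 → V, CC G t 5 c' ∧ (∀ v, Out c' v ↔ Out c v) ∧ t = 8 ∧ ∃ x y,
      Out c' x ∧ Out c' y ∧ G.Adj x y ∧ G.Adj x (c' 0) ∧ G.Adj y (c' 3) ∧ (OG G c).Reachable p x := by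
  obtain ⟨c', hc, ho, x, y, j, n, h1, h2, h3, h4, h5, h6, h7, h8, ⟨z, h9, h12⟩, h10, h11⟩ :=
    h.fan3 (by omega) p q hp hq hpq
  have hx := (ho x).2 h5
  have hy := (ho y).2 h6
  refine ⟨c', hc, ho, ?_, x, y, hx, hy, ?_⟩
  · have hz := (ho z).2 h9
    have hne := h12.ne
    have t8 := hc.t8
    have := hc.le [z, x, c' 0, c' 1, c' 2, c' 3, c' 4, c' 5] (by simp [hc.aj, h12, h12.symm, h3, h3.symm]) (by simp [hc.inj.eq_iff, hx.n1, hx.n2, hz.n1, hz.n2, hne, Ne.symm hne])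
    simp only [List.length] at this
    omega
  · rcases fin6 j with rfl | rfl | rfl | rfl | rfl | rfl
    · exact (h2 rfl).elim
    · have := h11 [c' 1, c' 2, c' 3, c' 4, c' 5, c' 0] (by simp [hc.aj, h3.symm, h4]) (by simp [hc.inj.eq_iff]) (by simp) (by simp)
      simp only [List.length] at this; omega
    · have := h11 [c' 2, c' 3, c' 4, c' 5, c' 0] (by simp [hc.aj, h3.symm, h4]) (by simp [hc.inj.eq_iff]) (by simp) (by simp)
      simp only [List.length] at this; omega
    · have := h11 [c' 3, c' 2, c' 1, c' 0] (by simp [hc.aj, h3.symm, h4]) (by simp [hc.inj.eq_iff]) (by simp) (by simp)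
      simp only [List.length] at this
      exact ⟨h10 (by omega), h3, h4, h7⟩
    · have := h11 [c' 4, c' 3, c' 2, c' 1, c' 0] (by simp [hc.aj, h3.symm, h4]) (by simp [hc.inj.eq_iff]) (by simp) (by simp)
      simp only [List.length] at this; omega
    · have := h11 [c' 5, c' 4, c' 3, c' 2, c' 1, c' 0] (by simp [hc.aj, h3.symm, h4]) (by simp [hc.inj.eq_iff]) (by simp) (by simp)
      simp only [List.length] at this; omega

theorem six_pz {c : Fin 6 → V} (h : CC G t 5 c) {x y z : V} (hx : Out c x) (hy : Out c y)
    (d : G.Adj x y) (a : G.Adj x (c 0)) (b : G.Adj y (c 3)) (hz : Out c z) (zx : z ≠ x) (zy : z ≠ y) :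
    ¬ G.Adj z x ∧ ¬ G.Adj z y ∧ ∀ j, G.Adj z (c j) → j = 0 ∨ j = 3 := by
  have t8 := h.t8
  have hxy := d.ne
  refine ⟨fun f => ?_, fun f => ?_, fun j f => ?_⟩
  · exact h.pf [z, x, y, c 3, c 2, c 1, c 0, c 5, c 4] (by simp [h.aj, d, d.symm, b, b.symm, f, f.symm]) (by simp [h.inj.eq_iff, hx.n1, hx.n2, hy.n1, hy.n2, hz.n1, hz.n2, hxy, Ne.symm hxy, zx, Ne.symm zx, zy, Ne.symm zy]) (by simp only [List.length]; omega)
  · exact h.pf [z, y, x, c 0, c 1, c 2, c 3, c 4, c 5] (by simp [h.aj, d, d.symm, a, a.symm, f, f.symm]) (by simp [h.inj.eq_iff, hx.n1, hx.n2, hy.n1, hy.n2, hz.n1, hz.n2, hxy, Ne.symm hxy, zx, Ne.symm zx, zy, Ne.symm zy]) (by simp only [List.length]; omega)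
  · rcases fin6 j with rfl | rfl | rfl | rfl | rfl | rfl
    · exact Or.inl rfl
    · exact (h.pf [y, x, c 0, c 5, c 4, c 3, c 2, c 1, z] (by simp [h.aj, d, d.symm, a, a.symm, f, f.symm]) (by simp [h.inj.eq_iff, hx.n1, hx.n2, hy.n1, hy.n2, hz.n1, hz.n2, hxy, Ne.symm hxy, zx, Ne.symm zx, zy, Ne.symm zy]) (by simp only [List.length]; omega)).elim
    · exact (h.pf [x, y, c 3, c 4, c 5, c 0, c 1, c 2, z] (by simp [h.aj, d, d.symm, b, b.symm, f, f.symm]) (by simp [h.inj.eq_iff, hx.n1, hx.n2, hy.n1, hy.n2, hz.n1, hz.n2, hxy, Ne.symm hxy, zx, Ne.symm zx, zy, Ne.symm zy]) (by simp only [List.length]; omega)).elim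
    · exact Or.inr rfl
    · exact (h.pf [x, y, c 3, c 2, c 1, c 0, c 5, c 4, z] (by simp [h.aj, d, d.symm, b, b.symm, f, f.symm]) (by simp [h.inj.eq_iff, hx.n1, hx.n2, hy.n1, hy.n2, hz.n1, hz.n2, hxy, Ne.symm hxy, zx, Ne.symm zx, zy, Ne.symm zy]) (by simp only [List.length]; omega)).elim
    · exact (h.pf [y, x, c 0, c 1, c 2, c 3, c 4, c 5, z] (by simp [h.aj, d, d.symm, a, a.symm, f, f.symm]) (by simp [h.inj.eq_iff, hx.n1, hx.n2, hy.n1, hy.n2, hz.n1, hz.n2, hxy, Ne.symm hxy, zx, Ne.symm zx, zy, Ne.symm zy]) (by simp only [List.length]; omega)).elim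

theorem six_px {c : Fin 6 → V} (h : CC G t 5 c) {x y : V} (hx : Out c x) (hy : Out c y)
    (d : G.Adj x y) (a : G.Adj x (c 0)) (b : G.Adj y (c 3)) (j : Fin 6) (f : G.Adj x (c j)) :
    j = 0 ∨ j = 3 := by
  have hxy := d.ne
  rcases fin6 j with rfl | rfl | rfl | rfl | rfl | rfl
  · exact Or.inl rfl
  · exact (h.cf (x) [c 1, c 0, c 5, c 4, c 3, y] (by simp [h.aj, d, d.symm, b, b.symm, f, f.symm]) (by simp [h.inj.eq_iff, hx.n1, hx.n2, hy.n1, hy.n2, hxy, Ne.symm hxy]) (by simp) (by simp)).elim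
  · exact (h.cf (x) [c 2, c 1, c 0, c 5, c 4, c 3, y] (by simp [h.aj, d, d.symm, b, b.symm, f, f.symm]) (by simp [h.inj.eq_iff, hx.n1, hx.n2, hy.n1, hy.n2, hxy, Ne.symm hxy]) (by simp) (by simp)).elim
  · exact Or.inr rfl
  · exact (h.cf (x) [c 4, c 5, c 0, c 1, c 2, c 3, y] (by simp [h.aj, d, d.symm, b, b.symm, f, f.symm]) (by simp [h.inj.eq_iff, hx.n1, hx.n2, hy.n1, hy.n2, hxy, Ne.symm hxy]) (by simp) (by simp)).elim
  · exact (h.cf (x) [c 5, c 0, c 1, c 2, c 3, y] (by simp [h.aj, d, d.symm, b, b.symm, f, f.symm]) (by simp [h.inj.eq_iff, hx.n1, hx.n2, hy.n1, hy.n2, hxy, Ne.symm hxy]) (by simp) (by simp)).elim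

theorem six_py {c : Fin 6 → V} (h : CC G t 5 c) {x y : V} (hx : Out c x) (hy : Out c y)
    (d : G.Adj x y) (a : G.Adj x (c 0)) (b : G.Adj y (c 3)) (j : Fin 6) (f : G.Adj y (c j)) :
    j = 0 ∨ j = 3 := by
  have hxy := d.ne
  rcases fin6 j with rfl | rfl | rfl | rfl | rfl | rfl
  · exact Or.inl rfl
  · exact (h.cf (y) [c 1, c 2, c 3, c 4, c 5, c 0, x] (by simp [h.aj, d, d.symm, a, a.symm, f, f.symm]) (by simp [h.inj.eq_iff, hx.n1, hx.n2, hy.n1, hy.n2, hxy, Ne.symm hxy]) (by simp) (by simp)).elim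
  · exact (h.cf (y) [c 2, c 3, c 4, c 5, c 0, x] (by simp [h.aj, d, d.symm, a, a.symm, f, f.symm]) (by simp [h.inj.eq_iff, hx.n1, hx.n2, hy.n1, hy.n2, hxy, Ne.symm hxy]) (by simp) (by simp)).elim
  · exact Or.inr rfl
  · exact (h.cf (y) [c 4, c 3, c 2, c 1, c 0, x] (by simp [h.aj, d, d.symm, a, a.symm, f, f.symm]) (by simp [h.inj.eq_iff, hx.n1, hx.n2, hy.n1, hy.n2, hxy, Ne.symm hxy]) (by simp) (by simp)).elim
  · exact (h.cf (y) [c 5, c 4, c 3, c 2, c 1, c 0, x] (by simp [h.aj, d, d.symm, a, a.symm, f, f.symm]) (by simp [h.inj.eq_iff, hx.n1, hx.n2, hy.n1, hy.n2, hxy, Ne.symm hxy]) (by simp) (by simp)).elim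

theorem six_uniq {c : Fin 6 → V} (h : CC G t 5 c) (u v w : V) (hu : Out c u) (hv : Out c v)
    (hw : Out c w) (huv : G.Adj u v) (hvw : G.Adj v w) : u = w := by
  obtain ⟨c', h', ho, t8, x, y, hx, hy, d, a, b, hr⟩ := six_pairX h hv hu huv.symm
  have cl : ∀ p q, p = x ∨ p = y → G.Adj p q → Out c q → q = x ∨ q = y := by
    intro p q hp hpq hq
    by_contra hcon
    push Not at hcon
    obtain ⟨k1, k2, _⟩ := six_pz h' hx hy d a b ((ho q).2 hq) hcon.1 hcon.2
    rcases hp with rfl | rfl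
    · exact k1 hpq.symm
    · exact k2 hpq.symm
  have hvm : v = x ∨ v = y := by
    obtain ⟨W⟩ := hr.symm
    have : ∀ p q, (OG G c).Walk p q → p = x ∨ p = y → q = x ∨ q = y := by
      intro p q W
      induction W with
      | nil => exact id
      | cons hh _ ih => exact fun hp => ih (cl _ _ hp hh.1 hh.2.2)
    exact this _ _ W (Or.inl rfl)
  have h1 := cl v u hvm huv.symm hu
  have h2 := cl v w hvm hvw hw
  have n1 := huv.ne
  have n2 := hvw.ne
  rcases hvm with rfl | rfl <;> rcases h1 with rfl | rfl <;> rcases h2 with rfl | rfl <;>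
    first | rfl | exact absurd rfl n1 | exact absurd rfl n2

theorem case_six {c : Fin 6 → V} (h : CC G t 5 c) : False := by
  refine six_ind h ?_
  intro p q hp hq hpq
  obtain ⟨c, h, ho, t8, x, y, hx, hy, d, a, b, hr⟩ := six_pairX h hp hq hpq
  have hxy := d.ne
  refine six_fin h ?_ ?_ ?_ ?_ ?_ (six_uniq h)
  · exact fun f => h.cf (x) [c 0, c 5, c 4, c 1, c 2, c 3, y] (by simp [h.aj, a, a.symm, b, b.symm, d, d.symm, f, f.symm]) (by simp [h.inj.eq_iff, hx.n1, hx.n2, hy.n1, hy.n2, hxy, Ne.symm hxy]) (by simp) (by simp)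
  · exact fun f => h.cf (x) [c 0, c 1, c 2, c 5, c 4, c 3, y] (by simp [h.aj, a, a.symm, b, b.symm, d, d.symm, f, f.symm]) (by simp [h.inj.eq_iff, hx.n1, hx.n2, hy.n1, hy.n2, hxy, Ne.symm hxy]) (by simp) (by simp)
  · exact fun f => h.cf (x) [c 0, c 5, c 1, c 2, c 3, y] (by simp [h.aj, a, a.symm, b, b.symm, d, d.symm, f, f.symm]) (by simp [h.inj.eq_iff, hx.n1, hx.n2, hy.n1, hy.n2, hxy, Ne.symm hxy]) (by simp) (by simp)
  · exact fun f => h.cf (y) [c 3, c 4, c 2, c 1, c 0, x] (by simp [h.aj, a, a.symm, b, b.symm, d, d.symm, f, f.symm]) (by simp [h.inj.eq_iff, hx.n1, hx.n2, hy.n1, hy.n2, hxy, Ne.symm hxy]) (by simp) (by simp)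
  · intro z hz j f
    by_cases zx : z = x
    · subst zx; exact six_px h hx hy d a b j f
    by_cases zy : z = y
    · subst zy; exact six_py h hx hy d a b j f
    exact (six_pz h hx hy d a b hz zx zy).2.2 j f
end

theorem stmt_14 {V : Type*} [Fintype V] (G : SimpleGraph V)
    (hconn : G.Connected) (hnt : ¬ Traceable G)
    (hdet : ∀ v : V, vertexDetourOrder G v = detourOrder G) :
    9 ≤ detourOrder G ∧ 10 ≤ Fintype.card V := by
  have h := ctx_of G hconn hnt hdet
  have h9 : 9 ≤ detourOrder G := by
    by_contra hlt
    obtain ⟨m, c, h2, h6, hc⟩ := exists_cc h (by omega)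
    interval_cases m
    · exact case_three hc
    · exact case_four hc
    · exact case_five hc
    · exact case_six hc
    · exact case_seven hc
  refine ⟨h9, ?_⟩
  obtain ⟨v⟩ := hconn.nonempty
  obtain ⟨l, h1, h2, h3⟩ := h.st v
  obtain ⟨x, hx⟩ := h.nt _ h1 h2
  have := (List.nodup_cons.2 ⟨hx, h2⟩).length_le_card
  simp only [List.length_cons] at this
  omega
end

section
/- Let G be a bipartite CND graph (a finite connected bipartite simple graph with no hamiltonian path in which every vertex has detour order equal to τ(G)). Then the maximum degree of G satisfies Δ(G) ≤ ⌈(τ(G) − 2)/2⌉. -/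
open SimpleGraph

theorem rot_aux {V : Type*} (G : SimpleGraph V) (i : ℕ) : ∀ (v w : V) (p : G.Walk v w),
    p.IsPath → G.Adj w v → i ≤ p.length →
    ∃ (z : V) (q : G.Walk (p.getVert i) z), q.IsPath ∧ q.length = p.length ∧
      ∀ x, x ∈ q.support → x ∈ p.support := by
  induction i with
  | zero =>
    intro v w p hp _ _
    refine ⟨w, p.copy (by simp) rfl, by simpa using hp, by simp, by simp⟩
  | succ i ih =>
    intro v w p hp hwv hi
    cases p with
    | nil => simp at hi
    | @cons _ b _ h p' =>
      rw [Walk.cons_isPath_iff] at hp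
      have hl : i ≤ p'.length := by simpa using hi
      have hp2 : (p'.concat hwv).IsPath := by
        rw [Walk.concat_isPath_iff]; exact hp
      obtain ⟨z, q, hq, hql, hqs⟩ := ih b v (p'.concat hwv) hp2 h (by simp; omega)
      have e : (p'.concat hwv).getVert i = (Walk.cons h p').getVert (i+1) := by
        rw [Walk.getVert_cons_succ, Walk.concat_eq_append, Walk.getVert_append]
        split_ifs with h1
        · rfl
        · have : i = p'.length := by omega
          subst this; simp
      rw [← e]
      refine ⟨z, q, hq, by simpa using hql, ?_⟩
      intro x hx
      have := hqs x hx
      simp [Walk.support_concat] at this ⊢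
      tauto

theorem bdd_aux {V : Type*} [Fintype V] (G : SimpleGraph V) :
    BddAbove {n | ∃ (u w : V) (p : G.Walk u w), p.IsPath ∧ n = p.length + 1} := by
  refine ⟨Fintype.card V, ?_⟩
  rintro n ⟨u, w, p, hp, rfl⟩
  exact hp.length_lt

theorem stmt_15 {V : Type*} [Fintype V] (G : SimpleGraph V) [DecidableRel G.Adj]
    (hbip : ∃ A : Set V, ∀ u w : V, G.Adj u w → (u ∈ A ↔ w ∉ A))
    (hconn : G.Connected) (hnt : ¬ Traceable G)
    (hdet : ∀ v : V, vertexDetourOrder G v = detourOrder G) :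
    G.maxDegree ≤ (detourOrder G - 2 + 1) / 2 := by
  classical
  obtain ⟨A, hA⟩ := hbip
  have hmax : ∀ (u w : V) (p : G.Walk u w), p.IsPath → p.length + 1 ≤ detourOrder G :=
    fun u w p hp => le_csSup (bdd_aux G) ⟨u, w, p, hp, rfl⟩
  apply G.maxDegree_le_of_forall_degree_le
  intro v
  obtain ⟨w, p, hp, hpl⟩ : vertexDetourOrder G v ∈
      {n | ∃ (w : V) (p : G.Walk v w), p.IsPath ∧ n = p.length + 1} := by
    apply Nat.sSup_mem
    · exact ⟨_, v, Walk.nil, Walk.IsPath.nil, rfl⟩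
    · refine ⟨Fintype.card V, ?_⟩
      rintro n ⟨w, p, hp, rfl⟩
      exact hp.length_lt
  rw [hdet] at hpl
  have hnvw : ¬ G.Adj w v := by
    intro hwv
    apply hnt
    refine ⟨v, w, p, hp, ?_⟩
    by_contra! hx
    obtain ⟨x, hx⟩ := hx
    obtain ⟨r⟩ := hconn.preconnected v x
    obtain ⟨d, -, hd1, hd2⟩ := r.exists_boundary_dart {y | y ∈ p.support} (by simp) hx
    simp only [Set.mem_setOf_eq] at hd1 hd2
    obtain ⟨i, hi, hil⟩ := Walk.mem_support_iff_exists_getVert.1 hd1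
    obtain ⟨z, q, hq, hql, hqs⟩ := rot_aux G i v w p hp hwv hil
    have hadj : G.Adj d.snd (p.getVert i) := by rw [hi]; exact d.adj.symm
    have := hmax _ _ (Walk.cons hadj q)
      ((Walk.cons_isPath_iff _ _).2 ⟨hq, fun h => hd2 (hqs _ h)⟩)
    simp at this
    omega
  have hpar : ∀ i, i ≤ p.length → ((p.getVert i ∈ A ↔ v ∈ A) ↔ Even i) := by
    intro i
    induction i with
    | zero => simp
    | succ i ih =>
      intro h
      have h1 := ih (by omega)
      have h2 := hA _ _ (p.adj_getVert_succ (i := i) (by omega))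
      rw [Nat.even_add_one, ← h1]
      tauto
  have hsub : G.neighborFinset v ⊆
      (Finset.range (p.length / 2)).image (fun k => p.getVert (2 * k + 1)) := by
    intro u hu
    rw [mem_neighborFinset] at hu
    have hus : u ∈ p.support := by
      by_contra hns
      have := hmax _ _ (Walk.cons hu.symm p) ((Walk.cons_isPath_iff _ _).2 ⟨hp, hns⟩)
      simp at this
      omega
    obtain ⟨i, hi, hil⟩ := Walk.mem_support_iff_exists_getVert.1 hus
    have h1 := hpar i hil
    have h2 := hA _ _ hu
    rw [hi] at h1
    have h3 : ¬ Even i := by rw [← h1]; tauto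
    obtain ⟨k, rfl⟩ := Nat.not_even_iff_odd.1 h3
    have hne : 2 * k + 1 ≠ p.length := by
      intro h
      rw [h, Walk.getVert_length] at hi
      subst hi
      exact hnvw hu.symm
    simp only [Finset.mem_image, Finset.mem_range]
    exact ⟨k, by omega, hi⟩
  have := (Finset.card_le_card hsub).trans Finset.card_image_le
  rw [card_neighborFinset_eq_degree, Finset.card_range] at this
  omega
end

section
/- For every positive integer d ≥ 1 there exists a finite bipartite CND graph G (a connected bipartite simple graph with no hamiltonian path in which every vertex has detour order equal to τ(G)) whose detour deficiency |V(G)| − τ(G) is at least d. -/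
open SimpleGraph

namespace CND

def nbQ (n : ℕ) : List ℕ :=
  [[9,10,13],[8,11,15],[9,11,14],[8,9,12],[10,12,15],[10,11],[12,16],[8,14],
   [1,3,7],[0,2,3],[0,4,5],[1,2,5],[3,4,6],[0,17],[2,7],[1,4],[6,17,18],[13,16,18],[16,17]].getD n []

def cnt (l : List ℕ) : ℕ := l.countP (fun x => Nat.blt x 16)

def chk : ℕ → ℕ → List ℕ → Bool
  | 0, _, _ => false
  | n+1, pos, vis =>
    Nat.ble (cnt vis) (if Nat.blt pos 16 then 15 else 14) &&
    (nbQ pos).all (fun q => if Nat.beq q 18 then chk n q vis else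
      (vis.any (fun z => Nat.beq z q) || chk n q (q :: vis)))

theorem chk_ok : chk 20 18 [] = true := by decide +kernel

def R (p q : ℕ) : Prop := q ∈ nbQ p ∨ (p = 18 ∧ q = 18)

theorem sound (l : List ℕ) : ∀ (n pos : ℕ) (vis : List ℕ), chk n pos vis = true →
    (pos :: l).IsChain R → (l.filter (fun q => q ≠ 18)).Nodup →
    (∀ q ∈ l, q ≠ 18 → q ∉ vis) →
    cnt l + cnt vis ≤ if (pos :: l).getLast (by simp) < 16 then 15 else 14 := by
  induction l with
  | nil =>
    intro n pos vis h _ _ _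
    cases n with
    | zero => simp [chk] at h
    | succ n =>
      simp only [chk, Bool.and_eq_true, Nat.ble_eq, Nat.blt_eq] at h
      have h1 := h.1
      by_cases hp : pos < 16
      · simp only [hp, if_true] at h1; simpa [cnt, hp] using h1
      · simp only [hp, if_false] at h1; simpa [cnt, hp] using h1
  | cons q l ih =>
    intro n pos vis h hc hn hd
    rw [List.isChain_cons_cons] at hc
    obtain ⟨hR, hc⟩ := hc
    rw [List.getLast_cons (by simp)]
    have hn' : (l.filter (fun q => q ≠ 18)).Nodup := by
      rw [List.filter_cons] at hn
      split at hn
      · exact (List.nodup_cons.1 hn).2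
      · exact hn
    rcases hR with hR | ⟨rfl, rfl⟩
    · cases n with
      | zero => simp [chk] at h
      | succ n =>
        simp only [chk, Bool.and_eq_true, List.all_eq_true] at h
        have h2 := h.2 q hR
        by_cases h18 : q = 18
        · subst h18
          simp only [Nat.beq_refl, if_true] at h2
          have := ih n 18 vis h2 hc hn' (fun q hq => hd q (by simp [hq]))
          simpa [cnt, Nat.blt] using this
        · have hb : Nat.beq q 18 = false := by
            rw [Bool.eq_false_iff, ne_eq, Nat.beq_eq]; exact h18
          rw [hb] at h2
          have hqv := hd q (by simp) h18
          have h3 : chk n q (q :: vis) = true := by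
            simp only [Bool.false_eq_true, if_false, Bool.or_eq_true, List.any_eq_true, Nat.beq_eq] at h2
            rcases h2 with ⟨z, hz, rfl⟩ | h2
            · exact absurd hz hqv
            · exact h2
          have hql : q ∉ l := by
            rw [List.filter_cons] at hn
            simp only [ne_eq, h18, not_false_eq_true, decide_true, if_true] at hn
            have := (List.nodup_cons.1 hn).1
            intro hq
            exact this (List.mem_filter.2 ⟨hq, by simp [h18]⟩)
          have := ih n q (q :: vis) h3 hc hn' (by
            intro r hr hr18
            simp only [List.mem_cons, not_or]
            exact ⟨fun e => hql (e ▸ hr), hd r (by simp [hr]) hr18⟩)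
          have e : cnt (q :: l) + cnt vis = cnt l + cnt (q :: vis) := by
            simp only [cnt, List.countP_cons]; omega
          rw [e]; exact this
    · have := ih n 18 vis h hc hn' (fun q hq => hd q (by simp [hq]))
      simpa [cnt, Nat.blt] using this

section
variable {k : ℕ}

def adj (u v : ZMod k × Fin 16) : Prop :=
  (u.1 = v.1 ∧ v.2.val ∈ nbQ u.2.val) ∨ (v.1 = u.1 + 1 ∧ u.2 = 13 ∧ v.2 = 6) ∨
  (u.1 = v.1 + 1 ∧ u.2 = 6 ∧ v.2 = 13)

theorem nb_symm : ∀ x y : Fin 16, y.val ∈ nbQ x.val → x.val ∈ nbQ y.val := by decide +kernel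
theorem nb_irr : ∀ x : Fin 16, x.val ∉ nbQ x.val := by decide +kernel
theorem nb_bip : ∀ x y : Fin 16, y.val ∈ nbQ x.val → (x < 8 ↔ ¬ y < 8) := by decide +kernel

def gr (k : ℕ) : SimpleGraph (ZMod k × Fin 16) where
  Adj := adj
  symm := ⟨by
    rintro u v (⟨h, h'⟩ | h | h)
    · exact Or.inl ⟨h.symm, nb_symm _ _ h'⟩
    · exact Or.inr (Or.inr ⟨h.1, h.2.2, h.2.1⟩)
    · exact Or.inr (Or.inl ⟨h.1, h.2.2, h.2.1⟩)⟩
  loopless := ⟨by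
    rintro u (⟨h, h'⟩ | ⟨_, h, h'⟩ | ⟨_, h, h'⟩)
    · exact nb_irr _ h'
    · rw [h] at h'; exact absurd h' (by decide)
    · rw [h] at h'; exact absurd h' (by decide)⟩

theorem adj_symm {u v : ZMod k × Fin 16} (h : adj u v) : adj v u :=
  SimpleGraph.Adj.symm (G := gr k) h

def pr (i : ZMod k) (v : ZMod k × Fin 16) : ℕ :=
  if v.1 = i then v.2.val else if v.1 + 1 = i ∧ v.2 = 13 then 16
  else if v.1 = i + 1 ∧ v.2 = 6 then 17 else 18

theorem one_ne (hk : 2 ≤ k) (i : ZMod k) : i + 1 ≠ i := by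
  have : Fact (1 < k) := ⟨by omega⟩
  simp

theorem pr_hom (hk : 2 ≤ k) (i : ZMod k) (u v : ZMod k × Fin 16) (h : adj u v) :
    R (pr i u) (pr i v) := by
  have h1 := one_ne hk
  obtain ⟨a, x⟩ := u
  obtain ⟨b, y⟩ := v
  rcases h with ⟨h, h'⟩ | ⟨h, h', h''⟩ | ⟨h, h', h''⟩
  · simp only at h h'
    subst h
    by_cases e : a = i
    · simp only [pr, e, if_true]; exact Or.inl h'
    · simp only [pr, e, if_false]
      have hx : ∀ z : Fin 16, x = z → y = z → False := by
        rintro z rfl rfl; exact nb_irr _ h'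
      have := hx 13
      have := hx 6
      split_ifs <;> first | (exfalso; tauto) | (simp [R, nbQ])
  · simp only at h h' h''
    subst h h' h''
    by_cases e : a = i
    · subst e
      simp [pr, h1, R, nbQ]
    · by_cases e' : a + 1 = i
      · subst e'
        simp [pr, R, nbQ, (h1 a).symm]
      · simp [pr, e, e', R, nbQ]
  · simp only at h h' h''
    subst h h' h''
    by_cases e : b = i
    · subst e
      simp [pr, h1, R, nbQ]
    · by_cases e' : b + 1 = i
      · subst e'
        simp [pr, R, nbQ, (h1 b).symm]
      · simp [pr, e, e', R, nbQ]

theorem pr_lt (i : ZMod k) (v : ZMod k × Fin 16) : pr i v < 16 ↔ v.1 = i := by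
  have := v.2.isLt
  unfold pr
  split_ifs <;> simp_all

theorem pr_inj (i : ZMod k) (u v : ZMod k × Fin 16) (h : pr i u ≠ 18) (e : pr i u = pr i v) :
    u = v := by
  obtain ⟨a, x⟩ := u
  obtain ⟨b, y⟩ := v
  have := x.isLt
  have := y.isLt
  simp only [pr] at h e
  split_ifs at h e <;> first | omega | skip
  all_goals first | (simp_all; done) | skip
  · ext <;> simp_all
  · obtain ⟨h1, rfl⟩ := ‹a + 1 = i ∧ x = 13›
    obtain ⟨h2, rfl⟩ := ‹b + 1 = i ∧ y = 13›
    rw [add_right_cancel (h1.trans h2.symm)]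

theorem local1 (hk : 2 ≤ k) (i : ZMod k) (l : List (ZMod k × Fin 16)) (hl : l ≠ [])
    (hc : l.IsChain adj) (hn : l.Nodup) (hh : (l.head hl).1 ≠ i) :
    l.countP (fun v => v.1 = i) ≤ 14 + if (l.getLast hl).1 = i then 1 else 0 := by
  have hne : l.map (pr i) ≠ [] := by simpa using hl
  have hch : (l.map (pr i)).IsChain R := by
    rw [List.isChain_map]
    exact hc.imp (fun a b h => pr_hom hk i a b h)
  have h1 : (18 :: l.map (pr i)).IsChain R := by
    obtain ⟨v, l, rfl⟩ := List.exists_cons_of_ne_nil hl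
    rw [List.map_cons, List.isChain_cons_cons]
    refine ⟨?_, hch⟩
    simp only [List.head_cons] at hh
    simp only [pr, hh, if_false]
    split_ifs <;> simp [R, nbQ]
  have h2 : ((l.map (pr i)).filter (fun q => q ≠ 18)).Nodup := by
    rw [List.filter_map]
    refine List.Nodup.map_on ?_ (hn.filter _)
    intro x hx y hy e
    have := (List.mem_filter.1 hx).2
    exact pr_inj i x y (by simpa using this) e
  have := sound _ 20 18 [] chk_ok h1 h2 (by simp)
  have e1 : cnt (l.map (pr i)) = l.countP (fun v => v.1 = i) := by
    unfold cnt
    rw [List.countP_map]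
    apply List.countP_congr
    intro v _
    simp [pr_lt]
  rw [e1, List.getLast_cons hne, List.getLast_map] at this
  simp only [pr_lt] at this
  split_ifs at this ⊢ <;> simpa [cnt] using this

theorem local2 (hk : 2 ≤ k) (i : ZMod k) (l : List (ZMod k × Fin 16)) (hl : l ≠ [])
    (hc : l.IsChain adj) (hn : l.Nodup) :
    l.countP (fun v => v.1 = i) ≤
      14 + (if (l.head hl).1 = i then 1 else 0) + if (l.getLast hl).1 = i then 1 else 0 := by
  by_cases h1 : (l.head hl).1 = i
  · by_cases h2 : (l.getLast hl).1 = i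
    · simp only [h1, h2, if_true]
      rw [List.countP_eq_length_filter]
      have : ((l.filter (fun v => v.1 = i)).map Prod.snd).Nodup := by
        refine List.Nodup.map_on ?_ (hn.filter _)
        intro x hx y hy e
        have a := (List.mem_filter.1 hx).2
        have b := (List.mem_filter.1 hy).2
        simp only [decide_eq_true_eq] at a b
        exact Prod.ext (a.trans b.symm) e
      have := this.length_le_card
      simpa using this
    · have := local1 hk i l.reverse (by simpa using hl) (by
        rw [List.isChain_reverse]
        exact hc.imp (fun a b h => adj_symm h)) (by simpa using hn) (by simpa using h2)
      simp only [List.countP_reverse, List.getLast_reverse] at this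
      omega
  · have := local1 hk i l hl hc hn h1
    omega

theorem sum_count [NeZero k] (l : List (ZMod k × Fin 16)) :
    ∑ i : ZMod k, l.countP (fun v => v.1 = i) = l.length := by
  induction l with
  | nil => simp
  | cons v l ih =>
    simp [List.countP_cons, Finset.sum_add_distrib, ih]

theorem upper [NeZero k] (hk : 2 ≤ k) (l : List (ZMod k × Fin 16)) (hl : l ≠ [])
    (hc : l.IsChain adj) (hn : l.Nodup) : l.length ≤ 14 * k + 2 := by
  rw [← sum_count]
  refine (Finset.sum_le_sum (fun i _ => local2 hk i l hl hc hn)).trans ?_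
  simp [Finset.sum_add_distrib, ZMod.card]
  omega

def pass : List (Fin 16) := [6,12,4,15,1,11,2,14,7,8,3,9,0,13]

def dat : List (List (Fin 16) × List (Fin 16)) := [
  ([15,4,12,3,9,2,14,7,8,1,11,5,10,0,13], [6]),
  ([7,14,2,11,5,10,0,13], [6,12,4,15,1,8,3,9]),
  ([0,13], [6,12,3,9,2,11,5,10,4,15,1,8,7,14]),
  ([13], [6,12,3,8,7,14,2,9,0,10,5,11,1,15,4]),
  ([3,8,7,14,2,9,0,13], [6,12,4,15,1,11,5,10]),
  ([5,11,1,15,4,10,0,13], [6,12,3,9,2,14,7,8]),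
  ([1,15,4,10,5,11,2,14,7,8,3,9,0,13], [6,12]),
  ([7,14,2,9,0,13], [6,12,3,8,1,15,4,10,5,11]),
  ([2,14,7,8,3,9,0,13], [6,12,4,10,5,11,1,15])]

abbrev rel (x y : Fin 16) : Prop := y.val ∈ nbQ x.val

theorem dat_ok : ∀ p ∈ dat, p.1.IsChain rel ∧ p.2.IsChain rel ∧ p.1.getLast? = some 13 ∧
    p.2.head? = some 6 ∧ (p.1 ++ p.2).Nodup ∧ (p.1 ++ p.2).length = 16 := by decide +kernel

theorem dat_cov : ∀ x : Fin 16, ∃ p ∈ dat, p.1.head? = some x ∨ p.2.getLast? = some x := by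
  decide +kernel

def lift (j : ZMod k) (p : List (Fin 16)) : List (ZMod k × Fin 16) := p.map (fun x => (j, x))

def mid : ZMod k → ℕ → List (ZMod k × Fin 16)
  | _, 0 => []
  | j, m+1 => lift j pass ++ mid (j+1) m

theorem lift_chain (j : ZMod k) (p : List (Fin 16)) (h : p.IsChain rel) :
    (lift j p).IsChain adj := by
  unfold lift
  rw [List.isChain_map]
  exact h.imp (fun a b h => Or.inl ⟨rfl, h⟩)

theorem glue (j : ZMod k) (p : List (Fin 16)) (h : p.IsChain rel) (hp : p.getLast? = some 13)
    (l : List (ZMod k × Fin 16)) (hl : l.IsChain adj) (hl' : l.head? = some (j+1, 6)) :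
    (lift j p ++ l).IsChain adj := by
  rw [List.isChain_append]
  refine ⟨lift_chain j p h, hl, ?_⟩
  intro x hx y hy
  simp only [lift, List.getLast?_map, hp, Option.map_some, Option.mem_def, Option.some.injEq] at hx
  rw [hl'] at hy
  simp only [Option.mem_def, Option.some.injEq] at hy
  subst hx hy
  exact Or.inr (Or.inl ⟨rfl, rfl, rfl⟩)

theorem pass_ok : pass.IsChain rel ∧ pass.getLast? = some 13 ∧ pass.Nodup := by decide +kernel

theorem mid_chain (p : List (Fin 16)) (h : p.IsChain rel) (hp : p.head? = some 6) (m : ℕ) :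
    ∀ j : ZMod k, (mid j m ++ lift (j + (m : ZMod k)) p).IsChain adj ∧
      (mid j m ++ lift (j + (m : ZMod k)) p).head? = some (j, 6) := by
  induction m with
  | zero =>
    intro j
    simp only [mid, List.nil_append, Nat.cast_zero, add_zero]
    exact ⟨lift_chain j p h, by simp [lift, hp]⟩
  | succ m ih =>
    intro j
    have := ih (j+1)
    have e : j + ((m + 1 : ℕ) : ZMod k) = j + 1 + m := by push_cast; ring
    rw [e, mid, List.append_assoc]
    exact ⟨glue j pass pass_ok.1 pass_ok.2.1 _ this.1 this.2, by simp [lift, pass]⟩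

theorem mid_mem (m : ℕ) : ∀ (j : ZMod k) (v : ZMod k × Fin 16), v ∈ mid j m →
    ∃ t < m, v.1 = j + (t : ℕ) := by
  induction m with
  | zero => intro j v h; simp [mid] at h
  | succ m ih =>
    intro j v h
    rw [mid, List.mem_append] at h
    rcases h with h | h
    · simp only [lift, List.mem_map] at h
      obtain ⟨x, _, rfl⟩ := h
      exact ⟨0, by omega, by simp⟩
    · obtain ⟨t, ht, e⟩ := ih _ _ h
      exact ⟨t+1, by omega, by rw [e]; push_cast; ring⟩

theorem mid_mem6 (m : ℕ) : ∀ (j : ZMod k) (t : ℕ), t < m → (j + (t : ZMod k), (6 : Fin 16)) ∈ mid j m := by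
  induction m with
  | zero => intro j t h; omega
  | succ m ih =>
    intro j t h
    rw [mid, List.mem_append]
    cases t with
    | zero => left; simp [lift, pass]
    | succ t =>
      right
      have := ih (j+1) t (by omega)
      convert this using 2
      push_cast; ring

theorem mid_len (m : ℕ) : ∀ j : ZMod k, (mid j m).length = 14 * m := by
  induction m with
  | zero => intro j; simp [mid]
  | succ m ih => intro j; rw [mid, List.length_append, ih]; simp [lift, pass]; omega

theorem add_ne (j : ZMod k) (t : ℕ) (h0 : 0 < t) (h : t < k) : j + (t : ZMod k) ≠ j := by
  intro e
  have : (t : ZMod k) = 0 := by simpa using e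
  rw [ZMod.natCast_eq_zero_iff] at this
  exact absurd (Nat.le_of_dvd h0 this) (by omega)

theorem lift_nodup (j : ZMod k) (p : List (Fin 16)) (h : p.Nodup) : (lift j p).Nodup :=
  h.map (fun _ _ e => (Prod.ext_iff.1 e).2)

theorem mid_nodup (m : ℕ) : ∀ j : ZMod k, m ≤ k → (mid j m).Nodup := by
  induction m with
  | zero => intro j _; simp [mid]
  | succ m ih =>
    intro j hm
    rw [mid, List.nodup_append]
    refine ⟨lift_nodup j _ pass_ok.2.2, ih _ (by omega), ?_⟩
    rintro a ha b hb rfl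
    simp only [lift, List.mem_map] at ha
    obtain ⟨x, _, rfl⟩ := ha
    obtain ⟨t, ht, e⟩ := mid_mem _ _ _ hb
    refine add_ne j (t+1) (by omega) (by omega) ?_
    simp only at e
    push_cast
    rw [← add_assoc, add_right_comm, ← e]

theorem lower_list [NeZero k] (hk : 2 ≤ k) (v : ZMod k × Fin 16) :
    ∃ l : List (ZMod k × Fin 16), l.IsChain adj ∧ l.Nodup ∧ l.length = 14 * k + 2 ∧
      (∀ j, (j, 6) ∈ l) ∧ l.head? = some v := by
  suffices H : ∃ l : List (ZMod k × Fin 16), l.IsChain adj ∧ l.Nodup ∧ l.length = 14 * k + 2 ∧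
      (∀ j, (j, 6) ∈ l) ∧ (l.head? = some v ∨ l.getLast? = some v) by
    obtain ⟨l, h1, h2, h3, h4, h5 | h5⟩ := H
    · exact ⟨l, h1, h2, h3, h4, h5⟩
    · refine ⟨l.reverse, ?_, by simpa using h2, by simpa using h3, by simpa using h4, by simpa using h5⟩
      rw [List.isChain_reverse]
      exact h1.imp (fun a b h => adj_symm h)
  obtain ⟨i, x⟩ := v
  obtain ⟨⟨p, q⟩, hpq, hx⟩ := dat_cov x
  obtain ⟨a1, a2, a3, a4, a5, a6⟩ := dat_ok _ hpq
  simp only at hx a1 a2 a3 a4 a5 a6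
  have ei : i + 1 + ((k - 1 : ℕ) : ZMod k) = i := by
    rw [Nat.cast_sub (by omega)]; simp
  have hm := mid_chain q a2 a4 (k-1) (i+1)
  rw [ei] at hm
  rw [List.nodup_append] at a5
  obtain ⟨b1, b2, b3⟩ := a5
  have hmi : ∀ y, (i, y) ∉ mid (i+1) (k-1) := by
    intro y hy
    obtain ⟨t, ht, e⟩ := mid_mem _ _ _ hy
    refine add_ne i (t+1) (by omega) (by omega) ?_
    simp only at e
    push_cast
    rw [← add_assoc, add_right_comm, ← e]
  refine ⟨lift i p ++ (mid (i+1) (k-1) ++ lift i q), glue i p a1 a3 _ hm.1 hm.2, ?_, ?_, ?_, ?_⟩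
  · rw [List.nodup_append, List.nodup_append]
    refine ⟨lift_nodup _ _ b1, ⟨mid_nodup _ _ (by omega), lift_nodup _ _ b2, ?_⟩, ?_⟩
    · rintro a ha b hb rfl
      simp only [lift, List.mem_map] at hb
      obtain ⟨x, _, rfl⟩ := hb
      exact hmi _ ha
    · rintro a ha b hb rfl
      simp only [lift, List.mem_map] at ha
      obtain ⟨x, hx, rfl⟩ := ha
      rw [List.mem_append] at hb
      rcases hb with hb | hb
      · exact hmi _ hb
      · simp only [lift, List.mem_map] at hb
        obtain ⟨y, hy, e⟩ := hb
        exact b3 x hx y hy ((Prod.ext_iff.1 e).2).symm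
  · simp only [List.length_append, lift, List.length_map, mid_len] at a6 ⊢
    omega
  · intro j
    have hj : j = i + ((j - i).val : ZMod k) := by simp
    have hlt := ZMod.val_lt (j - i)
    rcases Nat.eq_zero_or_pos (j - i).val with h0 | h0
    · rw [h0] at hj
      simp only [Nat.cast_zero, add_zero] at hj
      subst hj
      simp only [List.mem_append]
      right; right
      simp only [lift, List.mem_map]
      exact ⟨6, List.mem_of_mem_head? a4, rfl⟩
    · have := mid_mem6 (k-1) (i+1) ((j-i).val - 1) (by omega)
      have e : i + 1 + (((j-i).val - 1 : ℕ) : ZMod k) = j := by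
        rw [Nat.cast_sub h0]; simp
      rw [e] at this
      simp [this]
  · rcases hx with hx | hx
    · left; simp [lift, List.head?_append, hx]
    · right; simp [lift, List.getLast?_append, hx]

theorem lower [NeZero k] (hk : 2 ≤ k) (v : ZMod k × Fin 16) :
    ∃ w, ∃ p : (gr k).Walk v w, p.IsPath ∧ p.length + 1 = 14 * k + 2 ∧ ∀ j, (j, 6) ∈ p.support := by
  obtain ⟨l, h1, h2, h3, h4, h5⟩ := lower_list hk v
  have hne : l ≠ [] := by rintro rfl; simp at h5
  have hv : l.head hne = v := by
    rw [List.head?_eq_some_head hne] at h5; simpa using h5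
  subst hv
  have h1 : l.IsChain (gr k).Adj := h1
  refine ⟨_, SimpleGraph.Walk.ofSupport l hne h1, ?_, ?_, ?_⟩
  · rw [SimpleGraph.Walk.isPath_def, SimpleGraph.Walk.support_ofSupport]; exact h2
  · rw [← SimpleGraph.Walk.length_support, SimpleGraph.Walk.support_ofSupport, h3]
  · rw [SimpleGraph.Walk.support_ofSupport]; exact h4

theorem upper' [NeZero k] (hk : 2 ≤ k) {u w} (p : (gr k).Walk u w) (hp : p.IsPath) :
    p.length + 1 ≤ 14 * k + 2 := by
  rw [← SimpleGraph.Walk.length_support]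
  exact upper hk _ (by simp) p.isChain_adj_support hp.support_nodup

end
end CND

theorem stmt_16 (d : ℕ) (hd : 1 ≤ d) :
    ∃ (V : Type) (_ : Finite V) (G : SimpleGraph V),
      (∃ A : Set V, ∀ u w : V, G.Adj u w → (u ∈ A ↔ w ∉ A)) ∧
      G.Connected ∧ ¬ Traceable G ∧
      (∀ v : V, vertexDetourOrder G v = detourOrder G) ∧
      d ≤ Nat.card V - detourOrder G := by
  have hk : 2 ≤ d + 1 := by omega
  have hcard : Nat.card (ZMod (d+1) × Fin 16) = (d+1) * 16 := by simp
  have hD : detourOrder (CND.gr (d+1)) = 14 * (d+1) + 2 := by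
    apply IsGreatest.csSup_eq
    constructor
    · obtain ⟨w, p, h1, h2, _⟩ := CND.lower hk ((0 : ZMod (d+1)), (0 : Fin 16))
      exact ⟨_, w, p, h1, h2.symm⟩
    · rintro n ⟨u, w, p, hp, rfl⟩
      exact CND.upper' hk p hp
  refine ⟨ZMod (d+1) × Fin 16, inferInstance, CND.gr (d+1), ⟨{v | v.2 < 8}, ?_⟩, ?_, ?_, ?_, ?_⟩
  · rintro u v (⟨_, h⟩ | ⟨_, h, h'⟩ | ⟨_, h, h'⟩)
    · exact CND.nb_bip _ _ h
    · simp only [Set.mem_ofPred_eq, h, h']; decide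
    · simp only [Set.mem_ofPred_eq, h, h']; decide
  · have : Nonempty (ZMod (d+1) × Fin 16) := ⟨(0, 0)⟩
    refine ⟨fun u v => ?_⟩
    obtain ⟨w, p, _, _, h⟩ := CND.lower hk u
    obtain ⟨w', p', _, _, h'⟩ := CND.lower hk v
    exact (p.takeUntil _ (h 0)).reachable.trans (p'.takeUntil _ (h' 0)).reachable.symm
  · rintro ⟨u, w, p, hp, hs⟩
    have h1 := CND.upper' hk p hp
    have h2 : Nat.card (ZMod (d+1) × Fin 16) ≤ p.support.length := by
      classical
      rw [Nat.card_eq_fintype_card, ← List.toFinset_card_of_nodup hp.support_nodup,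
        ← Finset.card_univ]
      exact Finset.card_le_card (fun x _ => by simpa using hs x)
    rw [SimpleGraph.Walk.length_support, hcard] at h2
    omega
  · intro v
    rw [hD]
    apply IsGreatest.csSup_eq
    constructor
    · obtain ⟨w, p, h1, h2, _⟩ := CND.lower hk v
      exact ⟨w, p, h1, h2.symm⟩
    · rintro n ⟨w, p, hp, rfl⟩
      exact CND.upper' hk p hp
  · rw [hD, hcard]; omega
end

section
/- Let c and d be positive integers with c ≥ 3 and d ≥ 1. Then there exists a finite CND graph G (a connected simple graph with no hamiltonian path in which every vertex has detour order equal to τ(G)) whose chromatic number equals c and whose detour deficiency |V(G)| − τ(G) equals d. -/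
open SimpleGraph

namespace CND

section generic
variable {V : Type} {G : SimpleGraph V}

/-- There is a path from `a` to `b` with vertex set exactly `S`. -/
def HP (G : SimpleGraph V) (a b : V) (S : Set V) : Prop :=
  ∃ p : G.Walk a b, p.IsPath ∧ ∀ x, x ∈ p.support ↔ x ∈ S

theorem HP.single (a : V) : HP G a a {a} := ⟨Walk.nil, by simp, by simp⟩

theorem HP.symm {a b : V} {S : Set V} (h : HP G a b S) : HP G b a S := by
  obtain ⟨p, hp, hS⟩ := h
  exact ⟨p.reverse, hp.reverse, by simpa using hS⟩

theorem HP.append {a b x y : V} {S T : Set V} (h : HP G a b S) (h' : HP G x y T)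
    (hadj : G.Adj b x) (hd : ∀ v, v ∈ S → v ∈ T → False) : HP G a y (S ∪ T) := by
  obtain ⟨p, hp, hS⟩ := h
  obtain ⟨q, hq, hT⟩ := h'
  refine ⟨p.append (Walk.cons hadj q), ?_, ?_⟩
  · rw [Walk.isPath_def, Walk.support_append, Walk.support_cons, List.tail_cons, List.nodup_append]
    refine ⟨hp.support_nodup, hq.support_nodup, ?_⟩
    intro v hv w hw hvw
    subst hvw
    exact hd v ((hS v).1 hv) ((hT v).1 hw)
  · intro v
    rw [Walk.support_append, Walk.support_cons, List.tail_cons, List.mem_append, hS, hT]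
    rfl

theorem HP.cast {a b : V} {S T : Set V} (h : HP G a b S) (e : ∀ v, v ∈ S ↔ v ∈ T) :
    HP G a b T := by
  have : S = T := Set.ext e
  exact this ▸ h

theorem HP.cons {a x y : V} {T : Set V} (h' : HP G x y T)
    (hadj : G.Adj a x) (hd : a ∉ T) : HP G a y (insert a T) :=
  ((HP.single a).append h' hadj (by rintro v rfl; exact hd))

theorem HP.clique [DecidableEq V] (b : V) (T : Finset V) : ∀ a, b ∉ T → a ∉ T → a ≠ b →
    (∀ x ∈ insert a (insert b T), ∀ y ∈ insert a (insert b T), x ≠ y → G.Adj x y) →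
    HP G a b (insert a (insert b T) : Finset V) := by
  induction T using Finset.induction_on with
  | empty =>
    intro a _ _ hab h
    refine ((HP.single b).cons (a := a) (h a (by simp) b (by simp) hab) (by simpa using hab)).cast ?_
    intro v; simp
  | insert x T hx ih =>
    intro a hb ha hab h
    simp only [Finset.mem_insert, not_or] at hb ha
    have := ih x hb.2 hx (Ne.symm hb.1) (by
      intro y hy z hz
      apply h <;> simp only [Finset.mem_insert] at * <;> tauto)
    refine (this.cons (a := a) (h a (by simp) x (by simp) ha.1) ?_).cast ?_
    · simp; tauto
    · intro v; simp; tauto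

theorem parity [DecidableEq V] (f : V → Bool) {u w : V} (p : G.Walk u w) :
    (p.edges.countP (fun e => decide (¬ (e.map f).IsDiag))) % 2 = if f u = f w then 0 else 1 := by
  induction p with
  | nil => simp
  | @cons a b c h p ih =>
    rw [Walk.edges_cons, List.countP_cons]
    rw [Nat.add_mod, ih]
    simp only [Sym2.map_mk, Sym2.mk_isDiag_iff]
    cases f a <;> cases f b <;> cases f c <;> simp

theorem parity_card {ι : Type} [Fintype ι] [DecidableEq V] (f : V → Bool) {u w : V} (p : G.Walk u w)
    (hp : p.IsPath) (E : ι → Sym2 V) (hE : Function.Injective E)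
    (hcross : ∀ i, ¬ ((E i).map f).IsDiag)
    (hall : ∀ a b, G.Adj a b → f a = true → f b = false → ∃ i, s(a, b) = E i) :
    (Finset.univ.filter (fun i => E i ∈ p.edges)).card % 2 = if f u = f w then 0 else 1 := by
  rw [← parity f p, List.countP_eq_length_filter]
  congr 1
  rw [← List.toFinset_card_of_nodup (hp.isTrail.edges_nodup.filter _)]
  rw [← Finset.card_image_of_injective _ hE]
  congr 1
  ext e
  simp only [Finset.mem_image, Finset.mem_filter, Finset.mem_univ, true_and, List.mem_toFinset,
    List.mem_filter, decide_eq_true_eq]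
  constructor
  · rintro ⟨i, hi, rfl⟩
    exact ⟨hi, hcross i⟩
  · rintro ⟨he, hc⟩
    induction e with
    | _ a b =>
    have hadj := p.adj_of_mem_edges he
    simp only [Sym2.map_mk, Sym2.mk_isDiag_iff] at hc
    cases ha : f a <;> cases hb : f b
    · simp_all
    · obtain ⟨i, hi⟩ := hall b a hadj.symm hb ha
      exact ⟨i, by rw [← hi, Sym2.eq_swap]; exact he, by rw [← hi, Sym2.eq_swap]⟩
    · obtain ⟨i, hi⟩ := hall a b hadj ha hb
      exact ⟨i, by rw [← hi]; exact he, hi.symm⟩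
    · simp_all

end generic

section construction
variable (c d : ℕ) (port : Fin 3 → Fin c)

/-- Vertices: clique vertices and subdivision vertices. -/
abbrev VV : Type := ((ZMod (d+1) × Bool) × Fin c) ⊕ (ZMod (d+1) × Fin 3)

/-- The index of the clique on side `s` joined to subdivision vertex `e`. -/
def endp {d : ℕ} (e : ZMod (d+1) × Fin 3) (s : Bool) : ZMod (d+1) :=
  if e.2 = 2 ∧ s = false then e.1 + 1 else e.1

/-- The adjacency relation. -/
def adjR : VV c d → VV c d → Prop
  | .inl (h, x), .inl (h', x') => h = h' ∧ x ≠ x'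
  | .inl (h, x), .inr e => x = port e.2 ∧ h.1 = endp e h.2
  | .inr e, .inl (h, x) => x = port e.2 ∧ h.1 = endp e h.2
  | .inr _, .inr _ => False

/-- The graph. -/
def GG : SimpleGraph (VV c d) where
  Adj := adjR c d port
  symm := ⟨by
    rintro (⟨h, x⟩ | e) (⟨h', x'⟩ | e') H
    · exact ⟨H.1.symm, H.2.symm⟩
    · exact H
    · exact H
    · exact H⟩
  loopless := ⟨by
    rintro (⟨h, x⟩ | e) H
    · exact H.2 rfl
    · exact H⟩

variable {c d port}

theorem adj_ll (h h' : ZMod (d+1) × Bool) (x x' : Fin c) :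
    (GG c d port).Adj (.inl (h, x)) (.inl (h', x')) ↔ h = h' ∧ x ≠ x' := Iff.rfl
theorem adj_lr (h : ZMod (d+1) × Bool) (x : Fin c) (e : ZMod (d+1) × Fin 3) :
    (GG c d port).Adj (.inl (h, x)) (.inr e) ↔ x = port e.2 ∧ h.1 = endp e h.2 := Iff.rfl
theorem adj_rl (h : ZMod (d+1) × Bool) (x : Fin c) (e : ZMod (d+1) × Fin 3) :
    (GG c d port).Adj (.inr e) (.inl (h, x)) ↔ x = port e.2 ∧ h.1 = endp e h.2 := Iff.rfl
theorem adj_rr (e e' : ZMod (d+1) × Fin 3) :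
    (GG c d port).Adj (.inr e) (.inr e') ↔ False := Iff.rfl

/-- Part of a clique. -/
def CL (h : ZMod (d+1) × Bool) (J : Set (Fin c)) : Set (VV c d) :=
  {v | ∃ x ∈ J, v = .inl (h, x)}

theorem mem_CL_l (h h' : ZMod (d+1) × Bool) (J : Set (Fin c)) (x : Fin c) :
    (.inl (h', x) : VV c d) ∈ CL h J ↔ h' = h ∧ x ∈ J := by
  simp only [CL, Set.mem_ofPred_eq, Sum.inl.injEq, Prod.mk.injEq]
  constructor
  · rintro ⟨y, hy, rfl, rfl⟩; exact ⟨rfl, hy⟩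
  · rintro ⟨rfl, hy⟩; exact ⟨x, hy, rfl, rfl⟩

theorem mem_CL_r (h : ZMod (d+1) × Bool) (J : Set (Fin c)) (e) :
    (.inr e : VV c d) ∈ CL h J ↔ False := by
  simp [CL]

theorem HP_CL (h : ZMod (d+1) × Bool) (J : Set (Fin c)) (p q : Fin c) (hp : p ∈ J) (hq : q ∈ J)
    (hpq : p ≠ q) : HP (GG c d port) (.inl (h, p)) (.inl (h, q)) (CL h J) := by
  classical
  let T : Finset (VV c d) := ((Finset.univ.filter (fun x => x ∈ J ∧ x ≠ p ∧ x ≠ q)).image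
    (fun x => (.inl (h, x) : VV c d)))
  refine (HP.clique (G := GG c d port) (.inl (h, q)) T (.inl (h, p)) ?_ ?_ ?_ ?_).cast ?_
  · simp [T]
  · simp [T]
  · simpa using hpq
  · have key : ∀ x ∈ insert (.inl (h, p) : VV c d) (insert (.inl (h, q)) T),
        ∃ y, x = .inl (h, y) := by
      intro x hx
      simp only [Finset.mem_insert, T, Finset.mem_image] at hx
      rcases hx with rfl | rfl | ⟨y, _, rfl⟩
      · exact ⟨_, rfl⟩
      · exact ⟨_, rfl⟩
      · exact ⟨_, rfl⟩
    intro x hx y hy hxy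
    obtain ⟨a, rfl⟩ := key x hx
    obtain ⟨b, rfl⟩ := key y hy
    rw [adj_ll]
    exact ⟨rfl, fun e => hxy (by rw [e])⟩
  · rintro (⟨h', x⟩ | e)
    · simp only [mem_CL_l]
      simp only [T, Finset.coe_insert, Set.mem_insert_iff, Sum.inl.injEq, Prod.mk.injEq,
        Finset.coe_image, Set.mem_image, Finset.mem_coe, Finset.mem_filter, Finset.mem_univ, true_and]
      constructor
      · rintro (⟨rfl, rfl⟩ | ⟨rfl, rfl⟩ | ⟨y, hy, rfl, rfl⟩)
        · exact ⟨rfl, hp⟩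
        · exact ⟨rfl, hq⟩
        · exact ⟨rfl, hy.1⟩
      · rintro ⟨rfl, hx⟩
        by_cases h1 : x = p
        · exact Or.inl ⟨rfl, h1⟩
        by_cases h2 : x = q
        · exact Or.inr (Or.inl ⟨rfl, h2⟩)
        exact Or.inr (Or.inr ⟨x, ⟨hx, h1, h2⟩, rfl, rfl⟩)
    · simp [mem_CL_r, T]

/-- A set of vertices given by two predicates. -/
def SS (P : ZMod (d+1) × Bool → Prop) (Q : ZMod (d+1) → Fin 3 → Prop) : Set (VV c d) :=
  {v | Sum.elim (fun a => P a.1) (fun e => Q e.1 e.2) v}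

theorem mem_SS_l (P : ZMod (d+1) × Bool → Prop) (Q : ZMod (d+1) → Fin 3 → Prop) (h) (x : Fin c) :
    (.inl (h, x) : VV c d) ∈ SS P Q ↔ P h := Iff.rfl
theorem mem_SS_r (P : ZMod (d+1) × Bool → Prop) (Q : ZMod (d+1) → Fin 3 → Prop) (e) :
    (.inr e : VV c d) ∈ SS P Q ↔ Q e.1 e.2 := Iff.rfl

theorem HP_bead (hport : Function.Injective port) (i : ZMod (d+1)) :
    HP (GG c d port) (.inl ((i, false), port 2)) (.inr (i, 2))
      (SS (fun h => h.1 = i) (fun m j => m = i ∧ j ≠ 1)) := by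
  have h20 : port 2 ≠ port 0 := fun h => by simpa using hport h
  have A : HP (GG c d port) _ _ _ := HP_CL (i, false) Set.univ (port 2) (port 0) trivial trivial h20
  have B : HP (GG c d port) _ _ _ :=
    HP_CL (i, true) Set.univ (port 0) (port 2) trivial trivial h20.symm
  have C := (HP.single (G := GG c d port) (.inr (i, 0))).append B
    (by rw [adj_rl]; simp [endp]) (by
      rintro (⟨h, x⟩ | e) <;> simp [mem_CL_l, mem_CL_r])
  have D := C.append (HP.single (.inr (i, 2))) (by rw [adj_lr]; simp [endp]) (by
      rintro (⟨h, x⟩ | e) <;> simp [mem_CL_r]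
      rintro rfl; simp)
  refine (A.append D (by rw [adj_lr]; simp [endp]) ?_).cast ?_
  · rintro (⟨h, x⟩ | e) <;> simp [mem_CL_l, mem_CL_r]
    rintro rfl; simp
  · rintro (⟨⟨a, s⟩, x⟩ | ⟨m, j⟩)
    · simp [mem_CL_l, mem_SS_l]
      cases s <;> simp
    · simp [mem_CL_r, mem_SS_r]
      fin_cases j <;> simp

theorem natCast_inj' {a b : ℕ} (ha : a ≤ d) (hb : b ≤ d) (h : (a : ZMod (d+1)) = b) : a = b := by
  rw [ZMod.natCast_eq_natCast_iff', Nat.mod_eq_of_lt (by omega), Nat.mod_eq_of_lt (by omega)] at h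
  exact h

theorem HP_round (hport : Function.Injective port) (i : ZMod (d+1)) (t : ℕ) (ht : t ≤ d) :
    HP (GG c d port) (.inr (i, 2)) (.inr (i + t, 2))
      (SS (fun h => ∃ s : ℕ, 1 ≤ s ∧ s ≤ t ∧ h.1 = i + s)
        (fun m j => (m = i ∧ j = 2) ∨ (j ≠ 1 ∧ ∃ s : ℕ, 1 ≤ s ∧ s ≤ t ∧ m = i + s))) := by
  induction t with
  | zero =>
    have e : i + ((0 : ℕ) : ZMod (d+1)) = i := by simp
    rw [e]
    refine (HP.single _).cast ?_
    rintro (⟨⟨a, s⟩, x⟩ | ⟨m, j⟩)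
    · simp [mem_SS_l]
    · simp only [mem_SS_r, Set.mem_singleton_iff, Sum.inr.injEq, Prod.mk.injEq]
      constructor
      · exact Or.inl
      · rintro (h | ⟨_, s, h1, h2, _⟩)
        · exact h
        · omega
  | succ t ih =>
    have ne0 : ∀ s : ℕ, s ≤ t → i + ((t + 1 : ℕ) : ZMod (d+1)) ≠ i + s := by
      intro s hs h
      have := natCast_inj' ht (by omega) (add_left_cancel h)
      omega
    have ne1 : i + ((t + 1 : ℕ) : ZMod (d+1)) ≠ i := by
      intro h
      exact ne0 0 (by omega) (by simpa using h)
    refine ((ih (by omega)).append (HP_bead hport (i + ((t + 1 : ℕ) : ZMod (d+1)))) ?_ ?_).cast ?_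
    · rw [adj_rl]; simp [endp, add_assoc]
    · rintro (⟨⟨a, s⟩, x⟩ | ⟨m, j⟩)
      · simp only [mem_SS_l]
        rintro ⟨s, h1, h2, h3⟩ h4
        exact ne0 s h2 (h4 ▸ h3)
      · simp only [mem_SS_r]
        rintro (⟨h1, h2⟩ | ⟨h, s, h1, h2, h3⟩) ⟨h4, h5⟩
        · exact ne1 (h4 ▸ h1)
        · exact ne0 s h2 (h4 ▸ h3)
    · have key : ∀ m : ZMod (d+1), (∃ s : ℕ, 1 ≤ s ∧ s ≤ t + 1 ∧ m = i + s) ↔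
          (∃ s : ℕ, 1 ≤ s ∧ s ≤ t ∧ m = i + s) ∨ m = i + ((t + 1 : ℕ) : ZMod (d+1)) := by
        intro m
        constructor
        · rintro ⟨s, h1, h2, h3⟩
          rcases Nat.lt_or_ge t s with h | h
          · right
            obtain rfl : s = t + 1 := by omega
            exact h3
          · exact Or.inl ⟨s, h1, h, h3⟩
        · rintro (⟨s, h1, h2, h3⟩ | h)
          · exact ⟨s, h1, by omega, h3⟩
          · exact ⟨t + 1, by omega, le_rfl, h⟩
      rintro (⟨⟨a, s⟩, x⟩ | ⟨m, j⟩)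
      · rw [Set.mem_union]
        simp only [mem_SS_l, key]
      · rw [Set.mem_union]
        simp only [mem_SS_r, key]
        generalize (∃ s : ℕ, 1 ≤ s ∧ s ≤ t ∧ m = i + s) = X
        tauto

/-- Subdivision vertex of the link leaving bead `i` at side `s`. -/
def lk (i : ZMod (d+1)) (s : Bool) : ZMod (d+1) := if s then i else i - 1

/-- Everything outside bead `i` except omitted vertices. -/
def RS (i : ZMod (d+1)) : Set (VV c d) :=
  SS (fun h => h.1 ≠ i) (fun m j => j ≠ 1 ∧ (m = i → j = 2))

theorem HP_R (hport : Function.Injective port) (i : ZMod (d+1)) (s : Bool) :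
    HP (GG c d port) (.inr (lk i s, 2)) (.inr (lk i (!s), 2)) (RS i) := by
  have main : HP (GG c d port) (.inr (lk i true, 2)) (.inr (lk i false, 2)) (RS i) := by
    have h := HP_round hport i d le_rfl
    have e : i + (d : ZMod (d+1)) = i - 1 := by
      have : ((d + 1 : ℕ) : ZMod (d+1)) = 0 := ZMod.natCast_self _
      push_cast at this
      rw [eq_neg_of_add_eq_zero_left this, sub_eq_add_neg]
    rw [e] at h
    have key : ∀ m : ZMod (d+1), (∃ s : ℕ, 1 ≤ s ∧ s ≤ d ∧ m = i + s) ↔ m ≠ i := by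
      intro m
      constructor
      · rintro ⟨s, h1, h2, h3⟩ rfl
        have : ((s : ℕ) : ZMod (d+1)) = ((0 : ℕ) : ZMod (d+1)) := by
          simpa using h3
        have := natCast_inj' h2 (by omega) this
        omega
      · intro hm
        refine ⟨(m - i).val, ?_, ?_, ?_⟩
        · rw [Nat.one_le_iff_ne_zero]
          intro h
          rw [ZMod.val_eq_zero, sub_eq_zero] at h
          exact hm h
        · have := ZMod.val_lt (m - i)
          omega
        · simp
    refine h.cast ?_
    rintro (⟨⟨a, s⟩, x⟩ | ⟨m, j⟩)
    · simp only [mem_SS_l, key, RS]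
    · simp only [mem_SS_r, key, RS]
      by_cases hm : m = i
      · simp [hm]
        rintro rfl; decide
      · simp [hm]
  cases s
  · exact main.symm
  · exact main

/-- Everything covered. -/
def FS (i : ZMod (d+1)) : Set (VV c d) :=
  SS (fun _ => True) (fun m j => m = i ∨ j ≠ 1)

theorem adj_link (i : ZMod (d+1)) (s : Bool) :
    (GG c d port).Adj (.inl ((i, s), port 2)) (.inr (lk i s, 2)) := by
  rw [adj_lr]
  cases s <;> simp [endp, lk]

theorem adj_mid (i : ZMod (d+1)) (s : Bool) (p : Fin 3) (hp : p ≠ 2) :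
    (GG c d port).Adj (.inl ((i, s), port p)) (.inr (i, p)) := by
  rw [adj_lr]
  simp [endp, hp]

theorem tail1 (hport : Function.Injective port) (i : ZMod (d+1)) (s : Bool) (p q : Fin 3)
    (hp : p ≠ 2) (hq : q ≠ 2) (hpq : p ≠ q) (J : Set (Fin c)) (h2J : port 2 ∈ J) (hqJ : port q ∈ J) :
    HP (GG c d port) (.inr (i, p)) (.inr (i, q)) (FS i \ CL (i, s) Jᶜ) := by
  have A : HP (GG c d port) _ _ _ :=
    HP_CL (i, !s) Set.univ (port p) (port 2) trivial trivial (fun h => hp (hport h))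
  have B : HP (GG c d port) _ _ _ :=
    HP_CL (i, s) J (port 2) (port q) h2J hqJ (fun h => hq (hport h).symm)
  have C := B.append (HP.single (.inr (i, q))) (adj_mid i s q hq) (by
      rintro (⟨h, x⟩ | e) <;> simp [mem_CL_r])
  have R := HP_R hport i (!s)
  rw [Bool.not_not] at R
  have D := R.append C (adj_link i s).symm (by
    rintro (⟨⟨a, s'⟩, x⟩ | ⟨m, j⟩) <;> simp [RS, mem_SS_l, mem_SS_r, mem_CL_l, mem_CL_r]
    · intro h1 h2; exact absurd h2 h1
    · rintro _ h1 h2 rfl; exact hq (h1 h2))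
  have E := A.append D (adj_link i (!s)) (by
    rintro (⟨⟨a, s'⟩, x⟩ | ⟨m, j⟩) <;> simp [RS, mem_SS_l, mem_CL_l, mem_CL_r]
    rintro rfl rfl; simp)
  refine ((HP.single _).append E (adj_mid i (!s) p hp).symm ?_).cast ?_
  · rintro (⟨⟨a, s'⟩, x⟩ | ⟨m, j⟩) <;> simp [RS, mem_SS_r, mem_CL_r]
    rintro rfl rfl
    simp [hp, hpq]
  · rintro (⟨⟨a, s'⟩, x⟩ | ⟨m, j⟩) <;>
      simp [RS, FS, mem_SS_l, mem_SS_r, mem_CL_l, mem_CL_r]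
    · by_cases ha : a = i
      · cases s <;> cases s' <;> simp [ha]
      · simp [ha]
    · by_cases ha : m = i
      · simp [ha]
        clear A B C R D E h2J hqJ
        revert p q j; decide
      · simp [ha]

theorem tail2 (hport : Function.Injective port) (i : ZMod (d+1)) (s : Bool)
    (J : Set (Fin c)) (h0J : port 0 ∈ J) (h1J : port 1 ∈ J) :
    HP (GG c d port) (.inr (lk i s, 2)) (.inr (i, 1)) (FS i \ CL (i, s) Jᶜ) := by
  have A : HP (GG c d port) _ _ _ :=
    HP_CL (i, !s) Set.univ (port 2) (port 0) trivial trivial (fun h => by simpa using hport h)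
  have B : HP (GG c d port) _ _ _ :=
    HP_CL (i, s) J (port 0) (port 1) h0J h1J (fun h => by simpa using hport h)
  have C := B.append (HP.single (.inr (i, 1))) (adj_mid i s 1 (by decide)) (by
      rintro (⟨h, x⟩ | e) <;> simp [mem_CL_r])
  have D := (HP.single _).append C (adj_mid i s 0 (by decide)).symm (by
    rintro (⟨⟨a, s'⟩, x⟩ | ⟨m, j⟩) <;> simp [mem_CL_r]
    rintro rfl rfl; simp)
  have E := A.append D (adj_mid i (!s) 0 (by decide)) (by
    rintro (⟨⟨a, s'⟩, x⟩ | ⟨m, j⟩) <;> simp [mem_CL_l, mem_CL_r]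
    rintro rfl rfl; simp)
  refine ((HP_R hport i s).append E (adj_link i (!s)).symm ?_).cast ?_
  · rintro (⟨⟨a, s'⟩, x⟩ | ⟨m, j⟩) <;> simp [RS, mem_SS_l, mem_SS_r, mem_CL_l, mem_CL_r]
    · intro h; simp [h]
    · intro h1 h2
      by_cases h : m = i
      · simp [h2 h]
      · simp [h]
  · rintro (⟨⟨a, s'⟩, x⟩ | ⟨m, j⟩) <;>
      simp [RS, FS, mem_SS_l, mem_SS_r, mem_CL_l, mem_CL_r]
    · by_cases ha : a = i
      · cases s <;> cases s' <;> simp [ha]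
      · simp [ha]
    · by_cases ha : m = i
      · simp [ha]
        revert j; decide
      · simp [ha]

theorem exists_HP (hport : Function.Injective port) (v : VV c d) :
    ∃ i b, HP (GG c d port) v b (FS i) := by
  have hU : ∀ (i : ZMod (d+1)) (s : Bool) (v : VV c d),
      v ∈ FS i \ CL (i, s) (Set.univ : Set (Fin c))ᶜ ↔ v ∈ FS i := by
    intro i s v
    simp [CL]
  rcases v with ⟨⟨i, s⟩, x⟩ | ⟨m, j⟩
  · by_cases hx2 : x = port 2
    · subst hx2
      refine ⟨i, _, ((tail2 hport i s {y | y ≠ port 2} ?_ ?_).cons (adj_link i s) ?_).cast ?_⟩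
      · intro h; simpa using hport h
      · intro h; simpa using hport h
      · simp [mem_CL_l]
      · rintro (⟨⟨a, s'⟩, x⟩ | ⟨m, j⟩) <;> simp [FS, mem_SS_l, mem_SS_r, mem_CL_l, mem_CL_r]
        tauto
    · obtain ⟨p, q, hp, hq, hpq, hxq⟩ : ∃ p q : Fin 3, p ≠ 2 ∧ q ≠ 2 ∧ p ≠ q ∧ x ≠ port q := by
        by_cases h : x = port 1
        · refine ⟨1, 0, by decide, by decide, by decide, ?_⟩
          rw [h]; intro h; simpa using hport h
        · exact ⟨0, 1, by decide, by decide, by decide, h⟩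
      have T := tail1 hport i s p q hp hq hpq {y | y ≠ x ∧ y ≠ port p}
        ⟨Ne.symm hx2, fun h => hp (hport h).symm⟩ ⟨hxq.symm, fun h => hpq (hport h).symm⟩
      have T' := T.cons (adj_mid i s p hp) (by simp [mem_CL_l])
      by_cases hxp : x = port p
      · rw [← hxp] at T'
        refine ⟨i, _, T'.cast ?_⟩
        rintro (⟨⟨a, s'⟩, y⟩ | ⟨m, j⟩) <;> simp [FS, mem_SS_l, mem_SS_r, mem_CL_l, mem_CL_r, hxp]
        tauto
      · refine ⟨i, _, (T'.cons (a := .inl ((i, s), x)) ?_ ?_).cast ?_⟩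
        · rw [adj_ll]; exact ⟨rfl, hxp⟩
        · simp [mem_CL_l, hxp]
        · rintro (⟨⟨a, s'⟩, y⟩ | ⟨m, j⟩) <;> simp [FS, mem_SS_l, mem_SS_r, mem_CL_l, mem_CL_r]
          tauto
  · by_cases hj : j = 2
    · subst hj
      exact ⟨m, _, (tail2 hport m true Set.univ trivial trivial).cast (hU _ _)⟩
    · obtain ⟨q, hq, hpq⟩ : ∃ q : Fin 3, q ≠ 2 ∧ j ≠ q := by
        revert j; decide
      exact ⟨m, _, (tail1 hport m true j q hj hq hpq Set.univ trivial trivial).cast (hU _ _)⟩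

instance decMem (l : List (VV c d)) (x : VV c d) : Decidable (x ∈ l) :=
  @List.instDecidableMemOfLawfulBEq _ instBEqOfDecidableEq inferInstance x l

instance decMem2 (l : List (Sym2 (VV c d))) (x : Sym2 (VV c d)) : Decidable (x ∈ l) :=
  @List.instDecidableMemOfLawfulBEq _ instBEqOfDecidableEq inferInstance x l

/-- Position of the subdivision vertex at port `j` of clique `h`. -/
def bk (h : ZMod (d+1) × Bool) (j : Fin 3) : ZMod (d+1) :=
  if j = 2 ∧ h.2 = false then h.1 - 1 else h.1

theorem bk_endp (e : ZMod (d+1) × Fin 3) (s : Bool) : bk (endp e s, s) e.2 = e.1 := by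
  simp only [bk, endp]
  split_ifs <;> simp

theorem endp_bk (h : ZMod (d+1) × Bool) (j : Fin 3) : endp (bk h j, j) h.2 = h.1 := by
  simp only [bk, endp]
  split_ifs <;> simp

/-- The half edge at port `j` of clique `h`. -/
def ed (port : Fin 3 → Fin c) (h : ZMod (d+1) × Bool) (j : Fin 3) : Sym2 (VV c d) :=
  s(.inl (h, port j), .inr (bk h j, j))

/-- Membership in the clique `h`. -/
def isC (h : ZMod (d+1) × Bool) (v : VV c d) : Bool :=
  Sum.elim (fun a => decide (a.1 = h)) (fun _ => false) v

theorem sum_swap (F : ZMod (d+1) × Bool → Fin 3 → ℕ) :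
    ∑ h, ∑ j, F h j = ∑ e : ZMod (d+1) × Fin 3, ∑ s, F (endp e s, s) e.2 := by
  rw [← Finset.sum_product', ← Finset.sum_product']
  refine Finset.sum_bij' (fun x _ => ((bk x.1 x.2, x.2), x.1.2))
    (fun y _ => ((endp y.1 y.2, y.2), y.1.2)) ?_ ?_ ?_ ?_ ?_
  · simp
  · simp
  · rintro ⟨⟨i, s⟩, j⟩ _
    simp [endp_bk (i, s) j]
  · rintro ⟨⟨i, j⟩, s⟩ _
    simp [bk_endp (i, j) s]
  · rintro ⟨⟨i, s⟩, j⟩ _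
    simp [endp_bk (i, s) j]

theorem lem1 {u w : VV c d} (p : (GG c d port).Walk u w) (hp : p.IsPath)
    (h : ZMod (d+1) × Bool) :
    1 ≤ (∑ j, if ed port h j ∈ p.edges then 0 else 1) + (isC h u).toNat + (isC h w).toNat := by
  have key := parity_card (isC h) p hp (ed port h) (by
      intro j j' hj
      simp only [ed, Sym2.eq_iff] at hj
      simp at hj
      exact hj.2.2) (by
      intro j
      simp [ed, isC]) (by
      rintro (⟨h', x⟩ | e) (⟨h'', x'⟩ | e') hadj ha hb
      · rw [adj_ll] at hadj
        simp [isC] at ha hb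
        exact absurd (hadj.1 ▸ ha) hb
      · rw [adj_lr] at hadj
        simp [isC] at ha
        subst ha
        refine ⟨e'.2, ?_⟩
        have := bk_endp e' h'.2
        rw [← hadj.2] at this
        simp [ed, hadj.1, this]
      · simp [isC] at ha
      · simp [isC] at ha)
  by_contra hcon
  have hsum : (∑ j, if ed port h j ∈ p.edges then 0 else 1) = 0 := by omega
  have hu : (isC h u).toNat = 0 := by omega
  have hw : (isC h w).toNat = 0 := by omega
  simp only [Bool.toNat_eq_zero] at hu hw
  rw [Finset.sum_eq_zero_iff] at hsum
  have hall : ∀ j, ed port h j ∈ p.edges := by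
    intro j
    by_contra hj
    have := hsum j (Finset.mem_univ _)
    simp [hj] at this
  simp [hall, hu, hw] at key

theorem lem2 {u w : VV c d} (p : (GG c d port).Walk u w) (hp : p.IsPath)
    (e : ZMod (d+1) × Fin 3) :
    (∑ s, if ed port (endp e s, s) e.2 ∈ p.edges then 0 else 1) ≤
      2 * (if (.inr e : VV c d) ∈ p.support then 0 else 1) +
        (decide (u = .inr e)).toNat + (decide (w = .inr e)).toNat := by
  have hed : ∀ s, ed port (endp e s, s) e.2 = s(.inl ((endp e s, s), port e.2), .inr e) := by
    intro s
    simp [ed, bk_endp]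
  have hnb : ∀ v, (GG c d port).Adj (.inr e) v → ∃ s, v = .inl ((endp e s, s), port e.2) := by
    rintro (⟨h, x⟩ | e') hadj
    · rw [adj_rl] at hadj
      exact ⟨h.2, by rw [hadj.1, ← hadj.2]⟩
    · exact hadj.elim
  have key := parity_card (fun v => decide (v = .inr e)) p hp
    (fun s => ed port (endp e s, s) e.2) (by
      intro s s' hs
      simp only [hed, Sym2.eq_iff] at hs
      simp at hs
      exact hs.2) (by
      intro j
      simp [hed]) (by
      intro a b hadj ha hb
      simp at ha
      subst ha
      obtain ⟨s, rfl⟩ := hnb b hadj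
      exact ⟨s, by rw [hed, Sym2.eq_swap]⟩)
  have hcard : (∑ s, if ed port (endp e s, s) e.2 ∈ p.edges then 0 else 1) +
      (Finset.univ.filter (fun s : Bool => ed port (endp e s, s) e.2 ∈ p.edges)).card = 2 := by
    rw [Finset.card_filter, ← Finset.sum_add_distrib]
    have : ∀ s : Bool, ((if ed port (endp e s, s) e.2 ∈ p.edges then 0 else 1) +
      (if ed port (endp e s, s) e.2 ∈ p.edges then 1 else 0)) = 1 := by
      intro s; split_ifs <;> rfl
    simp only [this]; simp
  by_cases hs : (.inr e : VV c d) ∈ p.support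
  · by_cases hu : u = .inr e
    · by_cases hw : w = .inr e
      · simp only [hu, hw, decide_true, Bool.toNat_true]; omega
      · simp only [hu, hw, decide_true, decide_false, Bool.toNat_true] at key ⊢
        simp only [reduceCtorEq, if_false] at key
        omega
    · by_cases hw : w = .inr e
      · simp only [hu, hw, decide_true, decide_false, Bool.toNat_true] at key ⊢
        simp only [reduceCtorEq, if_false] at key
        omega
      · simp only [hu, hw, decide_false] at key ⊢
        simp only [if_true] at key
        have hpos : 0 < (Finset.univ.filter
            (fun s : Bool => ed port (endp e s, s) e.2 ∈ p.edges)).card := by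
          rw [Finset.card_pos]
          rcases Walk.mem_support_iff_exists_mem_edges.1 hs with h | ⟨e', he', hv⟩
          · exact absurd h.symm hw
          · obtain ⟨b, rfl⟩ := Sym2.mem_iff_exists.1 hv
            obtain ⟨s, rfl⟩ := hnb b (p.adj_of_mem_edges he')
            refine ⟨s, ?_⟩
            rw [Finset.mem_filter, hed, Sym2.eq_swap]
            exact ⟨Finset.mem_univ _, he'⟩
        omega
  · simp only [hs, if_false]
    omega

theorem sum_one (u : VV c d) :
    ∑ h, (isC h u).toNat + ∑ e, (decide (u = .inr e)).toNat = 1 := by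
  rcases u with ⟨h, x⟩ | e
  · simp [isC, Bool.toNat, Bool.cond_decide]
  · simp [isC, Bool.toNat, Bool.cond_decide]

theorem upper_s17 {u w : VV c d} (p : (GG c d port).Walk u w) (hp : p.IsPath) :
    p.length + 1 + d ≤ Fintype.card (VV c d) := by
  have h1 := Finset.sum_le_sum (fun h (_ : h ∈ Finset.univ) => lem1 p hp h)
  have h2 := Finset.sum_le_sum (fun e (_ : e ∈ Finset.univ) => lem2 p hp e)
  rw [Finset.sum_add_distrib, Finset.sum_add_distrib, sum_swap] at h1
  rw [Finset.sum_add_distrib, Finset.sum_add_distrib, ← Finset.mul_sum] at h2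
  have hu := sum_one u
  have hw := sum_one w
  have hc : ∑ h : ZMod (d+1) × Bool, 1 = 2 * (d + 1) := by
    simp [ZMod.card, mul_comm]
  have hmiss : ∑ e : ZMod (d+1) × Fin 3, (if (.inr e : VV c d) ∈ p.support then 0 else 1) +
      p.support.toFinset.card ≤ Fintype.card (VV c d) := by
    rw [← Finset.card_add_card_compl p.support.toFinset, add_comm]
    apply Nat.add_le_add_left
    have : ∀ e : ZMod (d+1) × Fin 3, (if (.inr e : VV c d) ∈ p.support then 0 else 1) =
        if (.inr e : VV c d) ∉ p.support then 1 else 0 := by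
      intro e; split_ifs <;> rfl
    simp only [this]
    rw [← Finset.card_filter]
    apply Finset.card_le_card_of_injOn (fun e => (.inr e : VV c d))
    · intro e he
      simpa using he
    · intro a _ b _ h
      simpa using h
  rw [List.toFinset_card_of_nodup hp.support_nodup, Walk.length_support] at hmiss
  omega

theorem card_FS (i : ZMod (d+1)) {a b : VV c d} (p : (GG c d port).Walk a b) (hp : p.IsPath)
    (h : ∀ x, x ∈ p.support ↔ x ∈ FS i) : p.length + 1 + d = Fintype.card (VV c d) := by
  rw [← Finset.card_add_card_compl p.support.toFinset,
    List.toFinset_card_of_nodup hp.support_nodup, Walk.length_support]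
  congr 1
  have : p.support.toFinsetᶜ =
      (Finset.univ.erase i).image (fun m => (.inr (m, 1) : VV c d)) := by
    ext v
    rw [Finset.mem_compl, List.mem_toFinset, h]
    rcases v with ⟨⟨a, s⟩, x⟩ | ⟨m, j⟩
    · simp [FS, mem_SS_l]
    · simp only [FS, mem_SS_r]
      simp
      intro _
      exact eq_comm
  rw [this, Finset.card_image_of_injective _ (by intro a b hab; simpa using hab)]
  simp [ZMod.card]

end construction

end CND

theorem stmt_17 (c d : ℕ) (hc : 3 ≤ c) (hd : 1 ≤ d) :
    ∃ (V : Type) (_ : Finite V) (G : SimpleGraph V),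
      G.Connected ∧ ¬ Traceable G ∧
      (∀ v : V, vertexDetourOrder G v = detourOrder G) ∧
      G.chromaticNumber = (c : ℕ∞) ∧
      Nat.card V - detourOrder G = d := by
  let port : Fin 3 → Fin c := Fin.castLE hc
  have hport : Function.Injective port := Fin.castLE_injective hc
  let N := Fintype.card (CND.VV c d) - d
  have hlong : ∀ v : CND.VV c d, ∃ (w : CND.VV c d) (p : (CND.GG c d port).Walk v w),
      p.IsPath ∧ N = p.length + 1 := by
    intro v
    obtain ⟨i, b, p, hp, h⟩ := CND.exists_HP hport v
    refine ⟨b, p, hp, ?_⟩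
    have := CND.card_FS i p hp h
    simp only [N]; omega
  have hv : ∀ v, vertexDetourOrder (CND.GG c d port) v = N := by
    intro v
    apply IsGreatest.csSup_eq
    refine ⟨hlong v, ?_⟩
    rintro n ⟨w, p, hp, rfl⟩
    have := CND.upper_s17 p hp
    simp only [N]; omega
  have v0 : CND.VV c d := .inr (0, 0)
  have hG : detourOrder (CND.GG c d port) = N := by
    apply IsGreatest.csSup_eq
    refine ⟨⟨v0, hlong v0⟩, ?_⟩
    rintro n ⟨u, w, p, hp, rfl⟩
    have := CND.upper_s17 p hp
    simp only [N]; omega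
  refine ⟨CND.VV c d, inferInstance, CND.GG c d port, ?_, ?_, ?_, ?_, ?_⟩
  · rw [connected_iff_exists_forall_reachable]
    refine ⟨.inr (0, 2), fun v => ?_⟩
    obtain ⟨i, b, p, hp, h⟩ := CND.exists_HP hport v
    have : (.inr (0, 2) : CND.VV c d) ∈ p.support := by
      rw [h]
      right; exact (by decide : (2 : Fin 3) ≠ 1)
    exact (p.takeUntil _ this).reachable.symm
  · rintro ⟨u, w, p, hp, h⟩
    have h1 := CND.upper_s17 p hp
    have h2 : Fintype.card (CND.VV c d) = p.support.toFinset.card := by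
      rw [← Finset.card_univ]
      congr 1
      ext x; simp [h]
    rw [List.toFinset_card_of_nodup hp.support_nodup, Walk.length_support] at h2
    omega
  · intro v
    rw [hv, hG]
  · apply le_antisymm
    · apply Colorable.chromaticNumber_le
      let C : (CND.GG c d port).Coloring (Fin c) := Coloring.mk
        (Sum.elim (fun a => a.2) (fun e => if e.2 = 0 then port 1 else port 0)) (by
          have hne : ∀ j : Fin 3, port j ≠ (if j = 0 then port 1 else port 0) := by
            intro j
            split_ifs with h
            · subst h; intro h; simpa using hport h
            · intro h'; exact h (hport h')
          rintro (⟨h, x⟩ | e) (⟨h', x'⟩ | e') hadj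
          · exact hadj.2
          · have := hadj.1
            simp only [Sum.elim_inl, Sum.elim_inr, this]
            exact hne _
          · have := hadj.1
            simp only [Sum.elim_inl, Sum.elim_inr, this]
            exact (hne _).symm
          · exact hadj.elim)
      simpa using C.colorable
    · have hcl : (CND.GG c d port).IsClique
          ((Finset.univ.image (fun x : Fin c => (.inl ((0, false), x) : CND.VV c d)) :
            Finset (CND.VV c d)) : Set (CND.VV c d)) := by
        intro a ha b hb hab
        simp only [Finset.coe_image, Finset.coe_univ, Set.image_univ, Set.mem_range] at ha hb
        obtain ⟨x, rfl⟩ := ha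
        obtain ⟨y, rfl⟩ := hb
        exact ⟨rfl, fun h => hab (by rw [h])⟩
      have := hcl.card_le_chromaticNumber
      rw [Finset.card_image_of_injective _ (by intro a b hab; simpa using hab)] at this
      simpa using this
  · rw [hG, Nat.card_eq_fintype_card]
    obtain ⟨w, p, hp, h⟩ := hlong v0
    have := CND.upper_s17 p hp
    simp only [N]; omega
end
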